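/- arXiv:1412.8713 — 6 statements merged into one kernel-verified Lean document; each statement's English description precedes it below -/
import Mathlib

section
/- Let ρ:[0,1]→(0,∞) be a periodic probability density of class C^{3,α} with 0 < λ ≤ ρ ≤ 1/λ. There exist constants ε̄ > 0 and C > 0 such that the following holds: if ‖ρ'‖_∞ + ‖ρ''‖_∞ ≤ ε̄ and (x^1,…,x^N) is a minimizer of F_{N,2}, then MK_1(μ^N, γρ^{1/3}dθ) ≤ C/N, where μ^N := (1/N)Σ_{i=1}^N δ_{x^i} and γ := 1/∫_0^1 ρ(θ)^{1/3}dθ. -/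
open MeasureTheory

/-- `f` is of class `C^{3,α}` on `[0,1]` with all relevant norms bounded by `K`. -/
def C3HolderBound (α K : ℝ) (f : ℝ → ℝ) : Prop :=
  ContDiff ℝ 3 f ∧
    (∀ k : ℕ, k ≤ 3 → ∀ y ∈ Set.Icc (0 : ℝ) 1, |iteratedDeriv k f y| ≤ K) ∧
    ∀ y ∈ Set.Icc (0 : ℝ) 1, ∀ y' ∈ Set.Icc (0 : ℝ) 1,
      |iteratedDeriv 3 f y - iteratedDeriv 3 f y'| ≤ K * |y - y'| ^ α

/-- A point of `[0,1]` minimizing the second moment of a cell is the centroid of that cell. -/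
lemma integral_sub_mul_eq_zero_of_isMin {ρ : ℝ → ℝ} (hρ : Continuous ρ) {A B z : ℝ}
    (hA : 0 ≤ A) (hAB : A ≤ B) (hB : B ≤ 1) (hpos : ∀ v ∈ Set.Icc (0 : ℝ) 1, 0 < ρ v)
    (hmin : ∀ t ∈ Set.Icc (0 : ℝ) 1,
      ∫ v in A..B, (z - v) ^ 2 * ρ v ≤ ∫ v in A..B, (t - v) ^ 2 * ρ v) :
    ∫ v in A..B, (v - z) * ρ v = 0 := by
  have hii : ∀ g : ℝ → ℝ, Continuous g → IntervalIntegrable g volume A B :=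
    fun g hg => hg.intervalIntegrable A B
  rcases hAB.eq_or_lt with rfl | hlt
  · simp
  have hW : 0 < ∫ v in A..B, ρ v :=
    intervalIntegral.intervalIntegral_pos_of_pos_on (hii _ hρ)
      (fun v hv => hpos v ⟨hA.trans hv.1.le, hv.2.le.trans hB⟩) hlt
  have hexp : ∀ t : ℝ, ∫ v in A..B, (t - v) * ρ v
      = (t - z) * (∫ v in A..B, ρ v) - ∫ v in A..B, (v - z) * ρ v := by
    intro t
    rw [← intervalIntegral.integral_const_mul, ← intervalIntegral.integral_sub
      (hii _ (by fun_prop)) (hii _ (by fun_prop))]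
    congr 1; ext v; ring
  have hexp2 : ∀ t : ℝ, ∫ v in A..B, (t - v) ^ 2 * ρ v
      = (∫ v in A..B, (z - v) ^ 2 * ρ v) - 2 * (t - z) * (∫ v in A..B, (v - z) * ρ v)
        + (t - z) ^ 2 * ∫ v in A..B, ρ v := by
    intro t
    rw [← intervalIntegral.integral_const_mul, ← intervalIntegral.integral_const_mul,
      ← intervalIntegral.integral_sub (hii _ (by fun_prop)) (hii _ (by fun_prop)),
      ← intervalIntegral.integral_add (hii _ (by fun_prop)) (hii _ (by fun_prop))]
    congr 1; ext v; ring
  have h1 : ∫ v in A..B, (A - v) * ρ v ≤ 0 := by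
    have := intervalIntegral.integral_mono_on hAB (hii (fun v => (A - v) * ρ v) (by fun_prop))
      (hii (fun _ => (0 : ℝ)) (by fun_prop)) (fun v hv => mul_nonpos_of_nonpos_of_nonneg
        (by linarith [hv.1]) (hpos v ⟨hA.trans hv.1, hv.2.trans hB⟩).le)
    simpa using this
  have h2 : 0 ≤ ∫ v in A..B, (B - v) * ρ v :=
    intervalIntegral.integral_nonneg hAB (fun v hv => mul_nonneg
      (by linarith [hv.2]) (hpos v ⟨hA.trans hv.1, hv.2.trans hB⟩).le)
  rw [hexp] at h1 h2
  set W := ∫ v in A..B, ρ v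
  set M := ∫ v in A..B, (v - z) * ρ v
  have hc : z + M / W ∈ Set.Icc (0 : ℝ) 1 := by
    have e : M = (M / W) * W := by field_simp
    constructor
    · nlinarith
    · nlinarith
  have h3 := hmin _ hc
  rw [hexp2 (z + M / W)] at h3
  have e : -(2 * (z + M / W - z) * M) + (z + M / W - z) ^ 2 * W = - (M ^ 2 / W) := by
    field_simp; ring
  have h4 : M ^ 2 / W ≤ 0 := by linarith
  have h5 : M ^ 2 ≤ 0 := by
    by_contra hcon
    exact absurd h4 (not_le.2 (div_pos (not_le.1 hcon) hW))
  exact pow_eq_zero_iff (two_ne_zero) |>.1 (le_antisymm h5 (sq_nonneg M))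

lemma continuous_iInf_sq {N : ℕ} [NeZero N] (w : Fin N → ℝ) :
    Continuous fun v : ℝ => ⨅ j : Fin N, (w j - v) ^ 2 := by
  have : (fun v : ℝ => ⨅ j : Fin N, (w j - v) ^ 2)
      = fun v => Finset.univ.inf' Finset.univ_nonempty (fun j => (w j - v) ^ 2) := by
    ext v; rw [Finset.inf'_univ_eq_ciInf]
  rw [this]
  exact Continuous.finset_inf'_apply _ (fun i _ => by fun_prop)

/-- If a point dominates a cell and is superfluous outside it, global optimality of the
configuration yields optimality of the point in its cell. -/
lemma cell_isMin_of_isMin {N : ℕ} [NeZero N] {ρ : ℝ → ℝ} (hρ : Continuous ρ)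
    (hpos : ∀ v ∈ Set.Icc (0 : ℝ) 1, 0 < ρ v) (w : Fin N → ℝ) (i : Fin N) {A B t : ℝ}
    (hA : 0 ≤ A) (hAB : A ≤ B) (hB : B ≤ 1)
    (hin : ∀ v ∈ Set.Ioo A B, ∀ j, (w i - v) ^ 2 ≤ (w j - v) ^ 2)
    (hleft : ∀ v ∈ Set.Ioo 0 A, ∃ k ≠ i, (w k - v) ^ 2 ≤ (w i - v) ^ 2)
    (hright : ∀ v ∈ Set.Ioo B 1, ∃ k ≠ i, (w k - v) ^ 2 ≤ (w i - v) ^ 2)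
    (hmin : ∫ v in (0 : ℝ)..1, (⨅ j, (w j - v) ^ 2) * ρ v
      ≤ ∫ v in (0 : ℝ)..1, (⨅ j, (Function.update w i t j - v) ^ 2) * ρ v) :
    ∫ v in A..B, (w i - v) ^ 2 * ρ v ≤ ∫ v in A..B, (t - v) ^ 2 * ρ v := by
  have hbdd : ∀ (u : Fin N → ℝ) (v : ℝ), BddBelow (Set.range fun j => (u j - v) ^ 2) :=
    fun u v => (Set.finite_range _).bddBelow
  have hout : ∀ v, (∃ k ≠ i, (w k - v) ^ 2 ≤ (w i - v) ^ 2) →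
      (⨅ j, (Function.update w i t j - v) ^ 2) ≤ ⨅ j, (w j - v) ^ 2 := by
    rintro v ⟨k, hk, hkv⟩
    refine le_ciInf fun j => ?_
    by_cases hj : j = i
    · subst hj
      refine (ciInf_le (hbdd _ v) k).trans ?_
      simpa [Function.update_of_ne hk] using hkv
    · refine (ciInf_le (hbdd _ v) j).trans ?_
      simp [Function.update_of_ne hj]
  have c1 : Continuous fun v => (⨅ j, (w j - v) ^ 2) * ρ v := (continuous_iInf_sq w).mul hρ
  have c2 : Continuous fun v => (⨅ j, (Function.update w i t j - v) ^ 2) * ρ v :=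
    (continuous_iInf_sq (Function.update w i t)).mul hρ
  have I1 := fun a b => c1.intervalIntegrable (μ := volume) a b
  have I2 := fun a b => c2.intervalIntegrable (μ := volume) a b
  rw [← intervalIntegral.integral_add_adjacent_intervals (I1 0 A) (I1 A 1),
    ← intervalIntegral.integral_add_adjacent_intervals (I1 A B) (I1 B 1),
    ← intervalIntegral.integral_add_adjacent_intervals (I2 0 A) (I2 A 1),
    ← intervalIntegral.integral_add_adjacent_intervals (I2 A B) (I2 B 1)] at hmin
  have L := intervalIntegral.integral_mono_on_of_le_Ioo hA (I2 0 A) (I1 0 A) (fun v hv =>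
    mul_le_mul_of_nonneg_right (hout v (hleft v hv))
      (hpos v ⟨hv.1.le, hv.2.le.trans (hAB.trans hB)⟩).le)
  have R := intervalIntegral.integral_mono_on_of_le_Ioo hB (I2 B 1) (I1 B 1) (fun v hv =>
    mul_le_mul_of_nonneg_right (hout v (hright v hv))
      (hpos v ⟨(hA.trans hAB).trans hv.1.le, hv.2.le⟩).le)
  have M1 := intervalIntegral.integral_mono_on_of_le_Ioo hAB
    (f := fun v => (w i - v) ^ 2 * ρ v) (Continuous.intervalIntegrable (by fun_prop) A B)
    (I1 A B) (fun v hv => mul_le_mul_of_nonneg_right (le_ciInf (hin v hv))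
      (hpos v ⟨hA.trans hv.1.le, hv.2.le.trans hB⟩).le)
  have M2 := intervalIntegral.integral_mono_on_of_le_Ioo hAB (I2 A B)
    (g := fun v => (t - v) ^ 2 * ρ v) (Continuous.intervalIntegrable (by fun_prop) A B)
    (fun v hv => mul_le_mul_of_nonneg_right
      ((ciInf_le (hbdd _ v) i).trans (by simp))
      (hpos v ⟨hA.trans hv.1.le, hv.2.le.trans hB⟩).le)
  linarith

/-- The second-order Taylor bound on `[0,1]`. -/
lemma abs_sub_taylor_le {ρ : ℝ → ℝ} (hρ : ContDiff ℝ 2 ρ)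
    (hd : ∀ y ∈ Set.Icc (0 : ℝ) 1, |deriv (deriv ρ) y| ≤ 1)
    {z v : ℝ} (hz : z ∈ Set.Icc (0 : ℝ) 1) (hv : v ∈ Set.Icc (0 : ℝ) 1) :
    |ρ v - ρ z - deriv ρ z * (v - z)| ≤ (v - z) ^ 2 := by
  have hsub : Set.uIcc z v ⊆ Set.Icc 0 1 := Set.uIcc_subset_Icc hz hv
  have hD : Differentiable ℝ ρ := hρ.differentiable (by norm_num)
  have hD' : Differentiable ℝ (deriv ρ) :=
    ((contDiff_succ_iff_deriv (n := 1)).1 hρ).2.2.differentiable (by norm_num)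
  have h1 : ∀ y ∈ Set.uIcc z v, |deriv ρ y - deriv ρ z| ≤ |v - z| := by
    intro y hy
    have := (convex_uIcc z v).norm_image_sub_le_of_norm_deriv_le (f := deriv ρ)
      (fun x _ => hD' x) (C := 1) (fun x hx => hd x (hsub hx)) Set.left_mem_uIcc hy
    rw [one_mul] at this
    exact this.trans (Set.abs_sub_left_of_mem_uIcc hy)
  have h2 := (convex_uIcc z v).norm_image_sub_le_of_norm_hasDerivWithin_le
    (f := fun y => ρ y - deriv ρ z * y) (f' := fun y => deriv ρ y - deriv ρ z * 1)
    (fun x _ => ((hD x).hasDerivAt.sub ((hasDerivAt_id x).const_mul _)).hasDerivWithinAt)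
    (C := |v - z|) (fun x hx => by simpa using h1 x hx) Set.left_mem_uIcc Set.right_mem_uIcc
  have e : ρ v - ρ z - deriv ρ z * (v - z)
      = (ρ v - deriv ρ z * v) - (ρ z - deriv ρ z * z) := by ring
  rw [e, ← sq_abs, sq]
  exact h2

/-- In a centroidal cell the two arms are comparable. -/
lemma mul_le_of_centroid {ρ : ℝ → ℝ} (hρ : Continuous ρ) {lam z a b : ℝ} (hlam : 0 < lam)
    (ha : 0 ≤ a) (hb : 0 ≤ b)
    (hbd : ∀ v ∈ Set.Icc (z - a) (z + b), lam ≤ ρ v ∧ ρ v ≤ 1 / lam)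
    (hc : ∫ v in (z - a)..(z + b), (v - z) * ρ v = 0) :
    lam * a ≤ b ∧ lam * b ≤ a := by
  have I : ∀ g : ℝ → ℝ, Continuous g → ∀ u v, IntervalIntegrable g volume u v :=
    fun g hg u v => hg.intervalIntegrable u v
  have hl : ∀ c : ℝ, ∫ v in (z - a)..z, (v - z) * c = - (c * a ^ 2 / 2) := by
    intro c
    rw [intervalIntegral.integral_mul_const, intervalIntegral.integral_sub (I _ (by fun_prop) _ _)
      (I _ (by fun_prop) _ _)]
    simp; ring
  have hr : ∀ c : ℝ, ∫ v in z..(z + b), (v - z) * c = c * b ^ 2 / 2 := by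
    intro c
    rw [intervalIntegral.integral_mul_const, intervalIntegral.integral_sub (I _ (by fun_prop) _ _)
      (I _ (by fun_prop) _ _)]
    simp; ring
  have cont : Continuous fun v => (v - z) * ρ v := by fun_prop
  rw [← intervalIntegral.integral_add_adjacent_intervals (I _ cont (z - a) z) (I _ cont z (z + b))]
    at hc
  have hza : z - a ≤ z := by linarith
  have hzb : z ≤ z + b := by linarith
  have l1 := intervalIntegral.integral_mono_on hza (I (fun v => (v - z) * ρ v) cont _ _)
    (I (fun v => (v - z) * lam) (by fun_prop) _ _) (fun v hv => mul_le_mul_of_nonpos_left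
      (hbd v ⟨hv.1, hv.2.trans hzb⟩).1 (by linarith [hv.2]))
  have l2 := intervalIntegral.integral_mono_on hza (I (fun v => (v - z) * (1 / lam))
    (by fun_prop) _ _) (I (fun v => (v - z) * ρ v) cont _ _) (fun v hv =>
      mul_le_mul_of_nonpos_left (hbd v ⟨hv.1, hv.2.trans hzb⟩).2 (by linarith [hv.2]))
  have r1 := intervalIntegral.integral_mono_on hzb (I (fun v => (v - z) * lam) (by fun_prop) _ _)
    (I (fun v => (v - z) * ρ v) cont _ _) (fun v hv => mul_le_mul_of_nonneg_left
      (hbd v ⟨hza.trans hv.1, hv.2⟩).1 (by linarith [hv.1]))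
  have r2 := intervalIntegral.integral_mono_on hzb (I (fun v => (v - z) * ρ v) cont _ _)
    (I (fun v => (v - z) * (1 / lam)) (by fun_prop) _ _) (fun v hv => mul_le_mul_of_nonneg_left
      (hbd v ⟨hza.trans hv.1, hv.2⟩).2 (by linarith [hv.1]))
  rw [hl] at l1 l2
  rw [hr] at r1 r2
  have key : ∀ s t : ℝ, 0 ≤ t → lam * s ^ 2 / 2 ≤ 1 / lam * t ^ 2 / 2 → lam * s ≤ t := by
    intro s t ht h
    refine abs_le_of_sq_le_sq' ?_ ht |>.2
    have : lam * (lam * s ^ 2 / 2) ≤ lam * (1 / lam * t ^ 2 / 2) :=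
      mul_le_mul_of_nonneg_left h hlam.le
    have e : lam * (1 / lam * t ^ 2 / 2) = t ^ 2 / 2 := by field_simp
    nlinarith
  exact ⟨key a b hb (by linarith), key b a ha (by linarith)⟩

/-- The algebraic core of the almost-conservation of `ρ(m) h³`: here `p`, `q` are the Taylor
coefficients of the density at the centroid and `E`, `Ra`, `Rb` are remainders. -/
lemma abs_mul_cube_sub_le_of_taylor {lam p q a b E Ra Rb : ℝ} (hlam : 0 < lam) (hlam1 : lam ≤ 1)
    (ha : 0 ≤ a) (hb : 0 ≤ b) (hab : a + b ≤ 1) (hpl : lam ≤ p) (hq1 : |q| ≤ 1)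
    (hE : |E| ≤ (a + b) ^ 4) (hEq : p * (b ^ 2 - a ^ 2) / 2 + q * (b ^ 3 + a ^ 3) / 3 = E)
    (hTa : |Ra| ≤ a ^ 2) (hTb : |Rb| ≤ b ^ 2) :
    |(Rb + p + q * b) * b ^ 3 - (Ra + p - q * a) * a ^ 3| ≤ 9 / lam ^ 2 * (a + b) ^ 5 := by
  set s := a + b with hs
  have hs0 : 0 ≤ s := by positivity
  have hs1 : s ≤ 1 := by linarith
  rcases hs0.eq_or_lt with h0 | hspos
  · have ha0 : a = 0 := by linarith
    have hb0 : b = 0 := by linarith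
    simp [ha0, hb0, ← h0]
  have hab3 : a ^ 3 + b ^ 3 ≤ s ^ 3 := by
    have : s ^ 3 - (a ^ 3 + b ^ 3) = 3 * a * b * s := by rw [hs]; ring
    have : 0 ≤ 3 * a * b * s := by positivity
    linarith
  obtain ⟨e, he⟩ : ∃ e, E = e * s := ⟨E / s, by field_simp⟩
  have he3 : |e| ≤ s ^ 3 := by
    rw [he, abs_mul, abs_of_pos hspos] at hE
    exact le_of_mul_le_mul_right (by linarith [show s ^ 4 = s ^ 3 * s by ring]) hspos
  set X := b ^ 2 - a ^ 2 with hX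
  have hXb : |X| ≤ 4 / lam * s ^ 3 := by
    have h1 : p * X = 2 * E - 2 / 3 * q * (b ^ 3 + a ^ 3) := by linarith
    have h2 : |p * X| ≤ 4 * s ^ 3 := by
      rw [h1]
      have h3 : |2 * E| ≤ 2 * s ^ 3 := by
        rw [abs_mul, abs_two]
        have : s ^ 4 ≤ s ^ 3 := pow_le_pow_of_le_one hs0 hs1 (by norm_num)
        linarith
      have h4 : |2 / 3 * q * (b ^ 3 + a ^ 3)| ≤ 2 / 3 * 1 * s ^ 3 := by
        rw [abs_mul, abs_mul, abs_of_nonneg (show (0 : ℝ) ≤ 2 / 3 by norm_num),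
          abs_of_nonneg (show 0 ≤ b ^ 3 + a ^ 3 by positivity)]
        gcongr; linarith
      have := abs_sub (2 * E) (2 / 3 * q * (b ^ 3 + a ^ 3))
      have : 0 ≤ s ^ 3 := by positivity
      linarith
    rw [abs_mul, abs_of_pos (hlam.trans_le hpl)] at h2
    have h3 : lam * |X| ≤ 4 * s ^ 3 := (mul_le_mul_of_nonneg_right hpl (abs_nonneg _)).trans h2
    rw [div_mul_eq_mul_div, le_div_iff₀ hlam]; linarith
  have hXs : X ^ 2 ≤ 16 / lam ^ 2 * s ^ 5 := by
    have h1 : X ^ 2 ≤ (4 / lam * s ^ 3) ^ 2 := by rw [← sq_abs]; gcongr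
    have h2 : (4 / lam * s ^ 3) ^ 2 = 16 / lam ^ 2 * s ^ 6 := by ring
    have h3 : s ^ 6 ≤ s ^ 5 := pow_le_pow_of_le_one hs0 hs1 (by norm_num)
    rw [h2] at h1
    exact h1.trans (by gcongr)
  have hdiff : p * (b - a) = 2 * e - 2 / 3 * q * (a ^ 2 - a * b + b ^ 2) := by
    have h1 : s * (p * (b - a)) = s * (2 * e - 2 / 3 * q * (a ^ 2 - a * b + b ^ 2)) := by
      rw [he] at hEq
      linear_combination 2 * hEq
    exact mul_left_cancel₀ hspos.ne' h1
  have hmain : (Rb + p + q * b) * b ^ 3 - (Ra + p - q * a) * a ^ 3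
      = q / 3 * X ^ 2 + 2 * e * (a ^ 2 + a * b + b ^ 2) + (Rb * b ^ 3 - Ra * a ^ 3) := by
    rw [hX]
    linear_combination (a ^ 2 + a * b + b ^ 2) * hdiff
  have t1 : |q / 3 * X ^ 2| ≤ 6 / lam ^ 2 * s ^ 5 := by
    rw [abs_mul, abs_div, abs_of_nonneg (sq_nonneg X), abs_of_pos (show (0 : ℝ) < 3 by norm_num)]
    have : |q| / 3 * X ^ 2 ≤ 1 / 3 * (16 / lam ^ 2 * s ^ 5) := by gcongr
    refine this.trans ?_
    have : 0 ≤ 1 / lam ^ 2 * s ^ 5 := by positivity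
    have e1 : 1 / 3 * (16 / lam ^ 2 * s ^ 5) = 16 / 3 * (1 / lam ^ 2 * s ^ 5) := by ring
    have e2 : 6 / lam ^ 2 * s ^ 5 = 6 * (1 / lam ^ 2 * s ^ 5) := by ring
    rw [e1, e2]; linarith
  have t2 : |2 * e * (a ^ 2 + a * b + b ^ 2)| ≤ 2 * s ^ 5 := by
    rw [abs_mul, abs_mul, abs_two, abs_of_nonneg (show 0 ≤ a ^ 2 + a * b + b ^ 2 by positivity)]
    have : a ^ 2 + a * b + b ^ 2 ≤ s ^ 2 := by rw [hs]; nlinarith [mul_nonneg ha hb]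
    calc 2 * |e| * (a ^ 2 + a * b + b ^ 2) ≤ 2 * s ^ 3 * s ^ 2 := by gcongr
      _ = 2 * s ^ 5 := by ring
  have t3 : |Rb * b ^ 3 - Ra * a ^ 3| ≤ s ^ 5 := by
    have h1 : |Rb * b ^ 3| ≤ b ^ 2 * b ^ 3 := by
      rw [abs_mul, abs_of_nonneg (show 0 ≤ b ^ 3 by positivity)]
      gcongr
    have h2 : |Ra * a ^ 3| ≤ a ^ 2 * a ^ 3 := by
      rw [abs_mul, abs_of_nonneg (show 0 ≤ a ^ 3 by positivity)]
      gcongr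
    have h3 : b ^ 2 * b ^ 3 ≤ s ^ 2 * b ^ 3 := by gcongr; linarith
    have h4 : a ^ 2 * a ^ 3 ≤ s ^ 2 * a ^ 3 := by gcongr; linarith
    have h5 : s ^ 2 * (a ^ 3 + b ^ 3) ≤ s ^ 2 * s ^ 3 := by gcongr
    have := abs_sub (Rb * b ^ 3) (Ra * a ^ 3)
    linarith [show s ^ 5 = s ^ 2 * s ^ 3 by ring]
  rw [hmain]
  have hl : (1 : ℝ) ≤ 1 / lam ^ 2 := by
    rw [le_div_iff₀ (by positivity)]; nlinarith
  have h5 : s ^ 5 ≤ 1 / lam ^ 2 * s ^ 5 := le_mul_of_one_le_left (by positivity) hl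
  have := abs_add_three (q / 3 * X ^ 2) (2 * e * (a ^ 2 + a * b + b ^ 2)) (Rb * b ^ 3 - Ra * a ^ 3)
  have e1 : 6 / lam ^ 2 * s ^ 5 = 6 * (1 / lam ^ 2 * s ^ 5) := by ring
  have e2 : 9 / lam ^ 2 * s ^ 5 = 9 * (1 / lam ^ 2 * s ^ 5) := by ring
  rw [e2]; rw [e1] at t1
  linarith

/-- The quantity `ρ(m) h³` is almost conserved across a centroidal cell. -/
lemma abs_mul_cube_sub_le_of_centroid {ρ : ℝ → ℝ} (hρ : ContDiff ℝ 2 ρ) {lam z a b : ℝ}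
    (hlam : 0 < lam) (hlam1 : lam ≤ 1) (ha : 0 ≤ a) (hb : 0 ≤ b)
    (hm : 0 ≤ z - a) (hm' : z + b ≤ 1)
    (hbd : ∀ v ∈ Set.Icc (0 : ℝ) 1, lam ≤ ρ v)
    (hd1 : ∀ y ∈ Set.Icc (0 : ℝ) 1, |deriv ρ y| ≤ 1)
    (hd2 : ∀ y ∈ Set.Icc (0 : ℝ) 1, |deriv (deriv ρ) y| ≤ 1)
    (hc : ∫ v in (z - a)..(z + b), (v - z) * ρ v = 0) :
    |ρ (z + b) * b ^ 3 - ρ (z - a) * a ^ 3| ≤ 9 / lam ^ 2 * (a + b) ^ 5 := by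
  have hz : z ∈ Set.Icc (0 : ℝ) 1 := ⟨by linarith, by linarith⟩
  have hT := fun v (hv : v ∈ Set.Icc (0 : ℝ) 1) => abs_sub_taylor_le hρ hd2 hz hv
  set p := ρ z with hp
  set q := deriv ρ z with hq
  have hpl : lam ≤ p := hbd z hz
  have hq1 : |q| ≤ 1 := hd1 z hz
  have I : ∀ g : ℝ → ℝ, Continuous g → IntervalIntegrable g volume (z - a) (z + b) :=
    fun g hg => hg.intervalIntegrable _ _
  have hρc : Continuous ρ := hρ.continuous
  have hpoly : ∫ v in (z - a)..(z + b), (v - z) * (p + q * (v - z))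
      = p * (b ^ 2 - a ^ 2) / 2 + q * (b ^ 3 + a ^ 3) / 3 := by
    have e := intervalIntegral.integral_comp_sub_right (a := z - a) (b := z + b)
      (fun t : ℝ => t * (p + q * t)) z
    rw [e]
    have e2 : (fun t : ℝ => t * (p + q * t)) = fun t => p * t + q * t ^ 2 := by ext t; ring
    have e3 : z - a - z = -a := by ring
    have e4 : z + b - z = b := by ring
    rw [e2, e3, e4, intervalIntegral.integral_add (Continuous.intervalIntegrable (by fun_prop) _ _)
      (Continuous.intervalIntegrable (by fun_prop) _ _)]
    rw [intervalIntegral.integral_const_mul, intervalIntegral.integral_const_mul, integral_id,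
      integral_pow]
    norm_num; ring
  have hrem : ∃ E, |E| ≤ (a + b) ^ 4 ∧
      p * (b ^ 2 - a ^ 2) / 2 + q * (b ^ 3 + a ^ 3) / 3 = E := by
    refine ⟨∫ v in (z - a)..(z + b), (v - z) * (p + q * (v - z) - ρ v), ?_, ?_⟩
    · have := intervalIntegral.norm_integral_le_of_norm_le_const (a := z - a) (b := z + b)
        (f := fun v => (v - z) * (p + q * (v - z) - ρ v)) (C := (a + b) ^ 3) (by
          intro v hv
          rw [Set.uIoc_of_le (by linarith)] at hv
          have h1 := hT v ⟨hm.trans hv.1.le, hv.2.trans hm'⟩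
          have h2 : |v - z| ≤ a + b := abs_le.2 ⟨by linarith [hv.1], by linarith [hv.2]⟩
          rw [Real.norm_eq_abs, abs_mul]
          have h3 : |p + q * (v - z) - ρ v| ≤ |v - z| ^ 2 := by
            rw [abs_sub_comm, sq_abs]; convert h1 using 2; ring
          calc |v - z| * |p + q * (v - z) - ρ v| ≤ |v - z| * |v - z| ^ 2 := by gcongr
            _ = |v - z| ^ 3 := by ring
            _ ≤ (a + b) ^ 3 := by gcongr)
      rw [Real.norm_eq_abs] at this
      refine this.trans (le_of_eq ?_)
      rw [abs_of_nonneg (by linarith)]; ring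
    · rw [← hpoly, ← sub_zero (∫ v in (z - a)..(z + b), (v - z) * (p + q * (v - z))), ← hc,
        ← intervalIntegral.integral_sub (I _ (by fun_prop)) (I _ (by fun_prop))]
      congr 1; ext v; ring
  obtain ⟨E, hE, hEq⟩ := hrem
  have hTb := hT (z + b) ⟨by linarith, hm'⟩
  have hTa := hT (z - a) ⟨hm, by linarith⟩
  have := abs_mul_cube_sub_le_of_taylor hlam hlam1 ha hb (by linarith) hpl hq1 hE hEq
    (by simpa using hTa) (by simpa using hTb)
  convert this using 5 <;> ring

/-- Multiplicative form of the almost-conservation of `ρ(m) h³`. -/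
lemma mul_cube_le_mul_exp_of_centroid {ρ : ℝ → ℝ} (hρ : ContDiff ℝ 2 ρ) {lam z a b : ℝ}
    (hlam : 0 < lam) (hlam1 : lam ≤ 1) (ha : 0 ≤ a) (hb : 0 ≤ b)
    (hm : 0 ≤ z - a) (hm' : z + b ≤ 1)
    (hbd : ∀ v ∈ Set.Icc (0 : ℝ) 1, lam ≤ ρ v ∧ ρ v ≤ 1 / lam)
    (hd1 : ∀ y ∈ Set.Icc (0 : ℝ) 1, |deriv ρ y| ≤ 1)
    (hd2 : ∀ y ∈ Set.Icc (0 : ℝ) 1, |deriv (deriv ρ) y| ≤ 1)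
    (hc : ∫ v in (z - a)..(z + b), (v - z) * ρ v = 0) :
    ρ (z + b) * b ^ 3 ≤ ρ (z - a) * a ^ 3 * Real.exp (72 / lam ^ 6 * (a + b) ^ 2) ∧
    ρ (z - a) * a ^ 3 ≤ ρ (z + b) * b ^ 3 * Real.exp (72 / lam ^ 6 * (a + b) ^ 2) := by
  obtain ⟨hab, hba⟩ := mul_le_of_centroid hρ.continuous hlam ha hb
    (fun v hv => hbd v ⟨hm.trans hv.1, hv.2.trans hm'⟩) hc
  have habs := abs_mul_cube_sub_le_of_centroid hρ hlam hlam1 ha hb hm hm'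
    (fun v hv => (hbd v hv).1) hd1 hd2 hc
  have hla : lam * a ≤ a := by nlinarith
  have hlb : lam * b ≤ b := by nlinarith
  have key : ∀ (r t : ℝ), lam ≤ r → lam * (a + b) / 2 ≤ t →
      9 / lam ^ 2 * (a + b) ^ 5 ≤ 72 / lam ^ 6 * (a + b) ^ 2 * (r * t ^ 3) := by
    intro r t hr ht
    have h1 : lam * (lam * (a + b) / 2) ^ 3 ≤ r * t ^ 3 := by
      have : 0 ≤ r := hlam.le.trans hr
      gcongr
    calc 9 / lam ^ 2 * (a + b) ^ 5
        = 72 / lam ^ 6 * (a + b) ^ 2 * (lam * (lam * (a + b) / 2) ^ 3) := by field_simp; ring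
      _ ≤ _ := by gcongr
  have hE : ∀ J : ℝ, 0 ≤ J → J + 72 / lam ^ 6 * (a + b) ^ 2 * J
      ≤ J * Real.exp (72 / lam ^ 6 * (a + b) ^ 2) := by
    intro J hJ
    have := Real.add_one_le_exp (72 / lam ^ 6 * (a + b) ^ 2)
    nlinarith
  have hrb := (hbd (z + b) ⟨by linarith, hm'⟩).1
  have hra := (hbd (z - a) ⟨hm, by linarith⟩).1
  have k1 := key _ a hra (by linarith)
  have k2 := key _ b hrb (by linarith)
  have e1 := hE (ρ (z - a) * a ^ 3) (by have := hlam.trans_le hra; positivity)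
  have e2 := hE (ρ (z + b) * b ^ 3) (by have := hlam.trans_le hrb; positivity)
  obtain ⟨x1, x2⟩ := abs_le.1 habs
  constructor <;> linarith

/-- A discrete Grönwall (Harnack-type) inequality. -/
lemma le_mul_exp_sum_of_step {J δ : ℕ → ℝ} {N : ℕ} (hδ : ∀ k < N, 0 ≤ δ k)
    (hJ : ∀ k ≤ N, 0 ≤ J k)
    (h1 : ∀ k < N, J (k + 1) ≤ J k * Real.exp (δ k))
    (h2 : ∀ k < N, J k ≤ J (k + 1) * Real.exp (δ k)) {i k : ℕ} (hi : i ≤ N) (hk : k ≤ N) :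
    J i ≤ J k * Real.exp (∑ l ∈ Finset.range N, δ l) := by
  have key : ∀ i k, i ≤ k → k ≤ N → J i ≤ J k * Real.exp (∑ l ∈ Finset.Ico i k, δ l) ∧
      J k ≤ J i * Real.exp (∑ l ∈ Finset.Ico i k, δ l) := by
    intro i k hik
    induction k, hik using Nat.le_induction with
    | base => simp
    | succ k hik ih =>
      intro hkN
      obtain ⟨a, b⟩ := ih (by omega)
      rw [Finset.sum_Ico_succ_top hik, Real.exp_add]
      constructor
      · calc J i ≤ J k * Real.exp (∑ l ∈ Finset.Ico i k, δ l) := a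
          _ ≤ (J (k + 1) * Real.exp (δ k)) * Real.exp (∑ l ∈ Finset.Ico i k, δ l) := by
            gcongr; exact h2 k (by omega)
          _ = _ := by ring
      · calc J (k + 1) ≤ J k * Real.exp (δ k) := h1 k (by omega)
          _ ≤ (J i * Real.exp (∑ l ∈ Finset.Ico i k, δ l)) * Real.exp (δ k) := by gcongr
          _ = _ := by ring
  have mono : ∀ i k, k ≤ N → Real.exp (∑ l ∈ Finset.Ico i k, δ l)
      ≤ Real.exp (∑ l ∈ Finset.range N, δ l) := by
    intro i k hk
    refine Real.exp_le_exp.2 (Finset.sum_le_sum_of_subset_of_nonneg (fun l hl => ?_)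
      fun l hl _ => hδ l (Finset.mem_range.1 hl))
    simp only [Finset.mem_Ico, Finset.mem_range] at hl ⊢; omega
  rcases le_total i k with h | h
  · exact (key i k h hk).1.trans (mul_le_mul_of_nonneg_left (mono i k hk) (hJ k hk))
  · exact (key k i h hi).2.trans (mul_le_mul_of_nonneg_left (mono k i hi) (hJ k hk))

/-- Cells of a chain in which `r h³` is almost conserved, with `r` bounded above and below, all
have length of order `1/N`, and `g h` is constant up to `O(1/N²)` where `g³ = r`. -/
lemma cell_bounds_of_almost_conserved {lam C : ℝ} (hlam : 0 < lam) (hlam1 : lam ≤ 1) (hC : 0 ≤ C)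
    {N : ℕ} (hN : 1 ≤ N) {h r g : ℕ → ℝ} (hh : ∀ k ≤ N, 0 ≤ h k)
    (hsum : ∑ k ∈ Finset.range N, (h k + h (k + 1)) = 1)
    (hr : ∀ k ≤ N, lam ≤ r k ∧ r k ≤ 1 / lam) (hg : ∀ k ≤ N, lam ≤ g k ∧ g k ≤ 1 / lam)
    (hgr : ∀ k ≤ N, g k ^ 3 = r k)
    (h1 : ∀ k < N, r (k + 1) * h (k + 1) ^ 3
      ≤ r k * h k ^ 3 * Real.exp (C * (h k + h (k + 1)) ^ 2))
    (h2 : ∀ k < N, r k * h k ^ 3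
      ≤ r (k + 1) * h (k + 1) ^ 3 * Real.exp (C * (h k + h (k + 1)) ^ 2))
    {M : ℝ} (hM : M = Real.exp C / lam ^ 2) :
    (∀ k ≤ N, h k ≤ M / N) ∧ (∀ k < N, h k + h (k + 1) ≤ M / N) ∧
    ∀ i ≤ N, ∀ k ≤ N, g i * h i - g k * h k ≤ 1 / lam * M * (C * M * Real.exp (C * M)) / N ^ 2 := by
  have hN0 : (0 : ℝ) < N := by exact_mod_cast hN
  have hN1 : (1 : ℝ) ≤ N := by exact_mod_cast hN
  have hM1 : 1 ≤ M := by
    rw [hM, le_div_iff₀ (by positivity)]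
    have := Real.one_le_exp hC
    nlinarith
  have hs0 : ∀ k < N, 0 ≤ h k + h (k + 1) := fun k hk => add_nonneg (hh k hk.le) (hh _ hk)
  have hrpos : ∀ k ≤ N, 0 < r k := fun k hk => hlam.trans_le (hr k hk).1
  have gron := fun (i k : ℕ) (hi : i ≤ N) (hk : k ≤ N) =>
    le_mul_exp_sum_of_step (J := fun k => r k * h k ^ 3)
      (δ := fun k => C * (h k + h (k + 1)) ^ 2) (N := N) (fun k _ => by positivity)
      (fun k hk => mul_nonneg (hrpos k hk).le (pow_nonneg (hh k hk) 3)) h1 h2 hi hk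
  have hsq : ∀ B : ℝ, (∀ k < N, h k + h (k + 1) ≤ B) →
      ∑ k ∈ Finset.range N, C * (h k + h (k + 1)) ^ 2 ≤ C * B := by
    intro B hB
    rw [← Finset.mul_sum]
    refine mul_le_mul_of_nonneg_left ?_ hC
    calc ∑ k ∈ Finset.range N, (h k + h (k + 1)) ^ 2
        ≤ ∑ k ∈ Finset.range N, B * (h k + h (k + 1)) :=
          Finset.sum_le_sum fun k hk => by
            have hk := Finset.mem_range.1 hk
            rw [sq]; exact mul_le_mul_of_nonneg_right (hB k hk) (hs0 k hk)
      _ = B := by rw [← Finset.mul_sum, hsum, mul_one]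
  have hone : ∀ k < N, h k + h (k + 1) ≤ 1 := fun k hk => by
    rw [← hsum]
    exact Finset.single_le_sum (f := fun k => h k + h (k + 1))
      (fun l hl => hs0 l (Finset.mem_range.1 hl)) (Finset.mem_range.2 hk)
  have hcomp : ∀ i ≤ N, ∀ k ≤ N, h i ≤ M * h k := by
    intro i hi k hk
    have e := gron i k hi hk
    have e1 : Real.exp (∑ l ∈ Finset.range N, C * (h l + h (l + 1)) ^ 2) ≤ Real.exp C :=
      Real.exp_le_exp.2 (by simpa using hsq 1 hone)
    have hk3 : 0 ≤ h k ^ 3 := pow_nonneg (hh k hk) 3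
    have hi3 : 0 ≤ h i ^ 3 := pow_nonneg (hh i hi) 3
    have e2 : lam * h i ^ 3 ≤ 1 / lam * h k ^ 3 * Real.exp C := by
      calc lam * h i ^ 3 ≤ r i * h i ^ 3 := by gcongr; exact (hr i hi).1
        _ ≤ _ := e
        _ ≤ 1 / lam * h k ^ 3 * Real.exp C := by gcongr; exact (hr k hk).2
    have e3 : h i ^ 3 ≤ M * h k ^ 3 := by
      have : lam * h i ^ 3 ≤ lam * (M * h k ^ 3) := by
        refine e2.trans (le_of_eq ?_)
        rw [hM]; field_simp
      exact le_of_mul_le_mul_left this hlam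
    have e4 : h i ^ 3 ≤ (M * h k) ^ 3 := by
      rw [mul_pow]
      refine e3.trans (mul_le_mul_of_nonneg_right ?_ hk3)
      exact le_self_pow₀ hM1 (by norm_num)
    exact le_of_pow_le_pow_left₀ (by norm_num) (mul_nonneg (by linarith) (hh k hk)) e4
  obtain ⟨k₀, hk₀, hmin⟩ := Finset.exists_min_image (Finset.range (N + 1)) h ⟨0, by simp⟩
  have hk₀N : k₀ ≤ N := by simpa [Nat.lt_succ_iff] using hk₀
  have hk₀b : 2 * (N * h k₀) ≤ 1 := by
    calc 2 * (N * h k₀) = ∑ k ∈ Finset.range N, (h k₀ + h k₀) := by simp; ring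
      _ ≤ ∑ k ∈ Finset.range N, (h k + h (k + 1)) := Finset.sum_le_sum fun k hk => by
          have hk := Finset.mem_range.1 hk
          exact add_le_add (hmin k (Finset.mem_range.2 (by omega)))
            (hmin (k + 1) (Finset.mem_range.2 (by omega)))
      _ = 1 := hsum
  have hhalf : ∀ k ≤ N, h k ≤ M / N / 2 := by
    intro k hk
    have e := hcomp k hk k₀ hk₀N
    have : h k₀ ≤ 1 / N / 2 := by
      rw [le_div_iff₀ (by norm_num), le_div_iff₀ hN0]; linarith
    calc h k ≤ M * h k₀ := e
      _ ≤ M * (1 / N / 2) := by gcongr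
      _ = _ := by ring
  have hMN : 0 ≤ M / N := by positivity
  have hs : ∀ k < N, h k + h (k + 1) ≤ M / N := fun k hk => by
    linarith [hhalf k hk.le, hhalf (k + 1) hk]
  refine ⟨fun k hk => (hhalf k hk).trans (by linarith), hs, fun i hi k hk => ?_⟩
  have e := gron i k hi hk
  set x := C * (M / N) with hx
  have hx0 : 0 ≤ x := by positivity
  have gk0 : 0 ≤ g k := hlam.le.trans (hg k hk).1
  have gh0 : 0 ≤ g k * h k := mul_nonneg gk0 (hh k hk)
  have e1 : (g i * h i) ^ 3 ≤ (g k * h k * Real.exp x) ^ 3 := by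
    rw [mul_pow, mul_pow, mul_pow, hgr i hi, hgr k hk]
    refine e.trans (mul_le_mul_of_nonneg_left ?_
      (mul_nonneg (hrpos k hk).le (pow_nonneg (hh k hk) 3)))
    exact (Real.exp_le_exp.2 (hsq _ hs)).trans (le_self_pow₀ (Real.one_le_exp hx0) (by norm_num))
  have e2 := le_of_pow_le_pow_left₀ (by norm_num) (mul_nonneg gh0 (Real.exp_pos x).le) e1
  have e3 : Real.exp x - 1 ≤ x * Real.exp (C * M) := by
    have a1 := Real.add_one_le_exp (-x)
    have a2 : Real.exp x * Real.exp (-x) = 1 := by rw [← Real.exp_add]; simp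
    have a3 : Real.exp x ≤ Real.exp (C * M) := Real.exp_le_exp.2 (by
      rw [hx]; gcongr; exact div_le_self (by linarith) hN1)
    have a4 : Real.exp x * (-x + 1) ≤ Real.exp x * Real.exp (-x) := by gcongr
    have a5 : x * Real.exp x ≤ x * Real.exp (C * M) := by gcongr
    linarith
  have e4 : g k * h k ≤ 1 / lam * (M / N) :=
    mul_le_mul (hg k hk).2 ((hhalf k hk).trans (by linarith)) (hh k hk) (by positivity)
  calc g i * h i - g k * h k ≤ g k * h k * (Real.exp x - 1) := by linarith
    _ ≤ g k * h k * (x * Real.exp (C * M)) := by gcongr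
    _ ≤ 1 / lam * (M / N) * (x * Real.exp (C * M)) := by gcongr
    _ = _ := by rw [hx]; field_simp

/-- The one-sided rectangle rule for a Lipschitz function. -/
lemma abs_integral_sub_mul_le {f : ℝ → ℝ} (hf : Continuous f) {L u v w : ℝ} (hL : 0 ≤ L)
    (huv : u ≤ v) (hw : w ∈ Set.Icc u v)
    (hlip : ∀ s ∈ Set.Icc u v, |f s - f w| ≤ L * |s - w|) :
    |(∫ s in u..v, f s) - f w * (v - u)| ≤ L * (v - u) ^ 2 := by
  have e : (∫ s in u..v, f s) - f w * (v - u) = ∫ s in u..v, (f s - f w) := by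
    rw [intervalIntegral.integral_sub (hf.intervalIntegrable _ _)
      (continuous_const.intervalIntegrable _ _)]
    simp; ring
  rw [e]
  have := intervalIntegral.norm_integral_le_of_norm_le_const (a := u) (b := v)
    (f := fun s => f s - f w) (C := L * (v - u)) (fun s hs => by
      rw [Set.uIoc_of_le huv] at hs
      refine (hlip s ⟨hs.1.le, hs.2⟩).trans ?_
      gcongr
      exact abs_le.2 ⟨by linarith [hs.1, hw.2], by linarith [hs.2, hw.1]⟩)
  rw [Real.norm_eq_abs, abs_of_nonneg (by linarith : 0 ≤ v - u)] at this
  linarith [show L * (v - u) * (v - u) = L * (v - u) ^ 2 by ring]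

/-- If the cells of a partition of `[0,1]` have length at most `D / N` and their masses differ by
at most `E / N²`, the empirical measure of points in the cells is `O(1/N)`-close to the density. -/
lemma empirical_sub_integral_le {N : ℕ} (hN : 1 ≤ N) {p : ℝ → ℝ} (hp : Continuous p)
    (hp0 : ∀ v ∈ Set.Icc (0 : ℝ) 1, 0 ≤ p v) (hp1 : ∫ v in (0 : ℝ)..1, p v = 1)
    {m z : ℕ → ℝ} (hm0 : m 0 = 0) (hmN : m N = 1) (hmz : ∀ k < N, m k ≤ z k)
    (hzm : ∀ k < N, z k ≤ m (k + 1)) (hm01 : ∀ k ≤ N, m k ∈ Set.Icc (0 : ℝ) 1)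
    {D E : ℝ} (hD : ∀ k < N, m (k + 1) - m k ≤ D / N)
    (hE : ∀ i < N, ∀ k < N,
      (∫ v in m i..m (i + 1), p v) - (∫ v in m k..m (k + 1), p v) ≤ E / N ^ 2)
    {φ : ℝ → ℝ} (hφ : LipschitzWith 1 φ) :
    1 / (N : ℝ) * ∑ k ∈ Finset.range N, φ (z k) - ∫ v in (0 : ℝ)..1, φ v * p v
      ≤ (D + E) / N := by
  have hN0 : (0 : ℝ) < N := by exact_mod_cast hN
  have hφc := hφ.continuous
  have hφ1 : ∀ s t, |φ s - φ t| ≤ |s - t| := fun s t => by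
    simpa [Real.dist_eq] using hφ.dist_le_mul s t
  have part : ∀ g : ℝ → ℝ, Continuous g →
      ∑ k ∈ Finset.range N, ∫ v in m k..m (k + 1), g v = ∫ v in (0 : ℝ)..1, g v := by
    intro g hg
    rw [intervalIntegral.sum_integral_adjacent_intervals
      (fun k _ => hg.intervalIntegrable _ _), hm0, hmN]
  set c : ℕ → ℝ := fun k => ∫ v in m k..m (k + 1), p v with hc
  have hcsum : ∑ k ∈ Finset.range N, c k = 1 := (part p hp).trans hp1
  have hcabs : ∀ k < N, |1 / (N : ℝ) - c k| ≤ E / N ^ 2 := by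
    intro k hk
    have s1 : ∑ i ∈ Finset.range N, (c i - c k) ≤ ∑ i ∈ Finset.range N, E / (N : ℝ) ^ 2 :=
      Finset.sum_le_sum fun i hi => hE i (Finset.mem_range.1 hi) k hk
    have s2 : ∑ i ∈ Finset.range N, (c k - c i) ≤ ∑ i ∈ Finset.range N, E / (N : ℝ) ^ 2 :=
      Finset.sum_le_sum fun i hi => hE k hk i (Finset.mem_range.1 hi)
    rw [Finset.sum_sub_distrib, hcsum] at s1 s2
    simp only [Finset.sum_const, Finset.card_range, nsmul_eq_mul] at s1 s2
    have e : N * (1 / (N : ℝ) - c k) = 1 - N * c k := by field_simp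
    rw [abs_le]
    constructor
    · refine le_of_mul_le_mul_left ?_ hN0
      linarith
    · refine le_of_mul_le_mul_left ?_ hN0
      linarith
  have hz01 : ∀ k < N, z k ∈ Set.Icc (0 : ℝ) 1 := fun k hk =>
    ⟨(hm01 k hk.le).1.trans (hmz k hk), (hzm k hk).trans (hm01 (k + 1) hk).2⟩
  have hcell : ∀ k < N, φ (z k) * c k - ∫ v in m k..m (k + 1), φ v * p v ≤ D / N * c k := by
    intro k hk
    have hmm : m k ≤ m (k + 1) := (hmz k hk).trans (hzm k hk)
    rw [hc, ← intervalIntegral.integral_const_mul, ← intervalIntegral.integral_const_mul,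
      ← intervalIntegral.integral_sub (Continuous.intervalIntegrable (by fun_prop) _ _)
      (Continuous.intervalIntegrable (by fun_prop) _ _)]
    refine intervalIntegral.integral_mono_on hmm (Continuous.intervalIntegrable (by fun_prop) _ _)
      (Continuous.intervalIntegrable (by fun_prop) _ _) fun v hv => ?_
    rw [← sub_mul]
    refine mul_le_mul_of_nonneg_right ?_
      (hp0 v ⟨(hm01 k hk.le).1.trans hv.1, hv.2.trans (hm01 (k + 1) hk).2⟩)
    refine (le_abs_self _).trans ((hφ1 _ _).trans (le_trans ?_ (hD k hk)))
    exact abs_le.2 ⟨by linarith [hv.2, hmz k hk], by linarith [hv.1, hzm k hk]⟩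
  have hpt : ∀ k < N, (φ (z k) - φ 0) * (1 / N - c k) ≤ E / N ^ 2 := by
    intro k hk
    refine (le_abs_self _).trans ?_
    rw [abs_mul]
    have a1 : |φ (z k) - φ 0| ≤ 1 := (hφ1 _ _).trans (by
      rw [sub_zero, abs_of_nonneg (hz01 k hk).1]; exact (hz01 k hk).2)
    calc |φ (z k) - φ 0| * |1 / (N : ℝ) - c k| ≤ 1 * (E / N ^ 2) :=
          mul_le_mul a1 (hcabs k hk) (abs_nonneg _) zero_le_one
      _ = _ := one_mul _
  have S1 := Finset.sum_le_sum fun k (hk : k ∈ Finset.range N) => hcell k (Finset.mem_range.1 hk)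
  have S2 := Finset.sum_le_sum fun k (hk : k ∈ Finset.range N) => hpt k (Finset.mem_range.1 hk)
  rw [Finset.sum_sub_distrib, part (fun v => φ v * p v) (by fun_prop), ← Finset.mul_sum, hcsum]
    at S1
  have e2 : ∑ k ∈ Finset.range N, (φ (z k) - φ 0) * (1 / (N : ℝ) - c k)
      = 1 / (N : ℝ) * ∑ k ∈ Finset.range N, φ (z k) - ∑ k ∈ Finset.range N, φ (z k) * c k := by
    have : ∀ k, (φ (z k) - φ 0) * (1 / (N : ℝ) - c k)
        = 1 / (N : ℝ) * φ (z k) - φ (z k) * c k - φ 0 * (1 / N) + φ 0 * c k := fun k => by ring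
    simp only [this]
    rw [Finset.sum_add_distrib, Finset.sum_sub_distrib, Finset.sum_sub_distrib, ← Finset.mul_sum,
      ← Finset.mul_sum,
      ← Finset.mul_sum, hcsum]
    simp only [Finset.sum_const, Finset.card_range, nsmul_eq_mul]
    field_simp; ring
  rw [e2] at S2
  simp only [Finset.sum_const, Finset.card_range, nsmul_eq_mul] at S2
  have e3 : (N : ℝ) * (E / N ^ 2) = E / N := by field_simp
  rw [add_div]
  linarith

lemma lipschitz_of_cube {lam s t B : ℝ} (hlam : 0 < lam) (hs : lam ≤ s) (ht : lam ≤ t)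
    (h : |s ^ 3 - t ^ 3| ≤ B) : |s - t| ≤ 1 / lam ^ 2 * B := by
  have e : s ^ 3 - t ^ 3 = (s - t) * (s ^ 2 + s * t + t ^ 2) := by ring
  have hs0 := hlam.trans_le hs
  have ht0 := hlam.trans_le ht
  have h1 : lam ^ 2 ≤ s ^ 2 + s * t + t ^ 2 := by
    have : lam ^ 2 ≤ s ^ 2 := by gcongr
    have : 0 ≤ s * t + t ^ 2 := by positivity
    linarith
  rw [e, abs_mul, abs_of_pos (by positivity : 0 < s ^ 2 + s * t + t ^ 2)] at h
  rw [div_mul_eq_mul_div, one_mul, le_div_iff₀ (by positivity)]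
  exact (mul_le_mul_of_nonneg_left h1 (abs_nonneg _)).trans h

/-- The Wasserstein estimate for a centroidal configuration. Here `z k` is the centroid of the
cell `[m k, m (k + 1)]`, at distance `h k` from its left end and `h (k + 1)` from its right end. -/
lemma centroidal_empirical_sub_integral_le {lam : ℝ} (hlam : 0 < lam) (hlam1 : lam ≤ 1)
    {ρ : ℝ → ℝ} (hρ : ContDiff ℝ 2 ρ)
    (hbd : ∀ v ∈ Set.Icc (0 : ℝ) 1, lam ≤ ρ v ∧ ρ v ≤ 1 / lam)
    (hd1 : ∀ y ∈ Set.Icc (0 : ℝ) 1, |deriv ρ y| ≤ 1)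
    (hd2 : ∀ y ∈ Set.Icc (0 : ℝ) 1, |deriv (deriv ρ) y| ≤ 1)
    {N : ℕ} (hN : 1 ≤ N) {m z h : ℕ → ℝ} (hm0 : m 0 = 0) (hmN : m N = 1)
    (hh : ∀ k ≤ N, 0 ≤ h k) (hmz : ∀ k < N, z k - h k = m k)
    (hzm : ∀ k < N, z k + h (k + 1) = m (k + 1)) (hm01 : ∀ k ≤ N, m k ∈ Set.Icc (0 : ℝ) 1)
    (hc : ∀ k < N, ∫ v in (m k)..(m (k + 1)), (v - z k) * ρ v = 0)
    {C M : ℝ} (hC : C = 72 / lam ^ 6) (hM : M = Real.exp C / lam ^ 2)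
    {φ : ℝ → ℝ} (hφ : LipschitzWith 1 φ) :
    1 / (N : ℝ) * ∑ k ∈ Finset.range N, φ (z k) - ∫ θ in (0 : ℝ)..1,
        φ θ * ((∫ y in (0 : ℝ)..1, ρ y ^ ((1 : ℝ) / 3))⁻¹ * ρ θ ^ ((1 : ℝ) / 3))
      ≤ (M + 1 / lam * (2 * (1 / lam * M * (C * M * Real.exp (C * M)))
          + 4 * (1 / lam ^ 2) * M ^ 2)) / N := by
  have hN0 : (0 : ℝ) < N := by exact_mod_cast hN
  have hC0 : 0 ≤ C := by rw [hC]; positivity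
  have hM0 : 0 ≤ M := by rw [hM]; positivity
  set f : ℝ → ℝ := fun v => ρ v ^ ((1 : ℝ) / 3) with hf
  have hfc : Continuous f := hρ.continuous.rpow_const fun _ => Or.inr (by norm_num)
  have hf3 : ∀ v ∈ Set.Icc (0 : ℝ) 1, f v ^ 3 = ρ v := by
    intro v hv
    rw [hf, ← Real.rpow_natCast, ← Real.rpow_mul (hlam.le.trans (hbd v hv).1)]
    norm_num
  have hf0 : ∀ v ∈ Set.Icc (0 : ℝ) 1, 0 ≤ f v := fun v hv =>
    Real.rpow_nonneg (hlam.le.trans (hbd v hv).1) _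
  have hl1 : 1 ≤ 1 / lam := by rw [le_div_iff₀ hlam]; linarith
  have hfb : ∀ v ∈ Set.Icc (0 : ℝ) 1, lam ≤ f v ∧ f v ≤ 1 / lam := by
    intro v hv
    constructor
    · refine le_of_pow_le_pow_left₀ (n := 3) (by norm_num) (hf0 v hv) ?_
      rw [hf3 v hv]
      exact (pow_le_of_le_one hlam.le hlam1 (by norm_num)).trans (hbd v hv).1
    · refine le_of_pow_le_pow_left₀ (n := 3) (by norm_num) (by positivity) ?_
      rw [hf3 v hv]
      exact (hbd v hv).2.trans (le_self_pow₀ hl1 (by norm_num))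
  have hflip : ∀ s ∈ Set.Icc (0 : ℝ) 1, ∀ t ∈ Set.Icc (0 : ℝ) 1,
      |f s - f t| ≤ 1 / lam ^ 2 * |s - t| := by
    intro s hs t ht
    refine lipschitz_of_cube hlam (hfb s hs).1 (hfb t ht).1 ?_
    rw [hf3 s hs, hf3 t ht]
    have := (convex_Icc (0 : ℝ) 1).norm_image_sub_le_of_norm_deriv_le (f := ρ)
      (fun x _ => hρ.differentiable (by norm_num) x) (C := 1) (fun x hx => hd1 x hx) ht hs
    simpa using this
  have hlen : ∀ k < N, h k + h (k + 1) = m (k + 1) - m k := fun k hk => by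
    rw [← hzm k hk, ← hmz k hk]; ring
  have hsum : ∑ k ∈ Finset.range N, (h k + h (k + 1)) = 1 := by
    rw [Finset.sum_congr rfl fun k hk => hlen k (Finset.mem_range.1 hk), Finset.sum_range_sub,
      hm0, hmN, sub_zero]
  have step : ∀ k < N, _ := fun k hk =>
    mul_cube_le_mul_exp_of_centroid hρ hlam hlam1 (hh k hk.le) (hh (k + 1) hk)
      (z := z k) (by rw [hmz k hk]; exact (hm01 k hk.le).1)
      (by rw [hzm k hk]; exact (hm01 (k + 1) hk).2) hbd hd1 hd2
      (by rw [hmz k hk, hzm k hk]; exact hc k hk)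
  rw [← hC] at step
  obtain ⟨b1, b2, b3⟩ := cell_bounds_of_almost_conserved hlam hlam1 hC0 hN (r := fun k => ρ (m k))
    (g := fun k => f (m k)) hh hsum (fun k hk => hbd _ (hm01 k hk))
    (fun k hk => hfb _ (hm01 k hk)) (fun k hk => hf3 _ (hm01 k hk))
    (fun k hk => by have := (step k hk).1; rwa [hmz k hk, hzm k hk] at this)
    (fun k hk => by have := (step k hk).2; rwa [hmz k hk, hzm k hk] at this) hM
  have hmz' : ∀ k < N, m k ≤ z k := fun k hk => by linarith [hmz k hk, hh k hk.le]
  have hzm' : ∀ k < N, z k ≤ m (k + 1) := fun k hk => by linarith [hzm k hk, hh (k + 1) hk]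
  have hcell : ∀ k < N, |(∫ v in m k..m (k + 1), f v)
      - (f (m k) * h k + f (m (k + 1)) * h (k + 1))| ≤ 2 * (1 / lam ^ 2) * M ^ 2 / N ^ 2 := by
    intro k hk
    have i0 := hm01 k hk.le
    have i1 := hm01 (k + 1) hk
    have r1 := abs_integral_sub_mul_le hfc (L := 1 / lam ^ 2) (by positivity) (hmz' k hk)
      (w := m k) ⟨le_rfl, hmz' k hk⟩ (fun s hs => hflip s
        ⟨i0.1.trans hs.1, hs.2.trans ((hzm' k hk).trans i1.2)⟩ _ i0)
    have r2 := abs_integral_sub_mul_le hfc (L := 1 / lam ^ 2) (by positivity) (hzm' k hk)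
      (w := m (k + 1)) ⟨hzm' k hk, le_rfl⟩ (fun s hs => hflip s
        ⟨(i0.1.trans (hmz' k hk)).trans hs.1, hs.2.trans i1.2⟩ _ i1)
    rw [show z k - m k = h k by linarith [hmz k hk]] at r1
    rw [show m (k + 1) - z k = h (k + 1) by linarith [hzm k hk]] at r2
    have q : ∀ j ≤ N, 1 / lam ^ 2 * h j ^ 2 ≤ 1 / lam ^ 2 * (M / N) ^ 2 := fun j hj => by
      have := hh j hj
      gcongr
      exact b1 j hj
    have q1 := q k hk.le
    have q2 := q (k + 1) hk
    rw [← intervalIntegral.integral_add_adjacent_intervals (b := z k)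
      (hfc.intervalIntegrable _ _) (hfc.intervalIntegrable _ _)]
    have e : 2 * (1 / lam ^ 2) * M ^ 2 / N ^ 2 = 2 * (1 / lam ^ 2 * (M / N) ^ 2) := by
      rw [div_pow]; ring
    rw [e]
    obtain ⟨x1, x2⟩ := abs_le.1 r1
    obtain ⟨y1, y2⟩ := abs_le.1 r2
    exact abs_le.2 ⟨by linarith, by linarith⟩
  set T := ∫ y in (0 : ℝ)..1, f y with hT
  have hTl : lam ≤ T := by
    have := intervalIntegral.integral_mono_on (zero_le_one (α := ℝ))
      (continuous_const.intervalIntegrable (μ := volume) 0 1) (hfc.intervalIntegrable 0 1)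
      (fun v hv => (hfb v hv).1)
    simpa using this
  have hT0 : 0 < T := hlam.trans_le hTl
  have hTi : T⁻¹ ≤ 1 / lam := by rw [one_div]; gcongr
  refine empirical_sub_integral_le hN (p := fun θ => T⁻¹ * f θ) (by fun_prop)
    (fun v hv => mul_nonneg (inv_nonneg.2 hT0.le) (hf0 v hv)) ?_ hm0 hmN hmz' hzm' hm01
    (fun k hk => by rw [← hlen k hk]; exact b2 k hk) (fun i hi k hk => ?_) hφ
  · rw [intervalIntegral.integral_const_mul]; exact inv_mul_cancel₀ hT0.ne'
  · rw [intervalIntegral.integral_const_mul, intervalIntegral.integral_const_mul, ← mul_sub,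
      mul_div_assoc]
    have u1 := b3 i hi.le k hk.le
    have u2 := b3 (i + 1) hi (k + 1) hk
    obtain ⟨x1, x2⟩ := abs_le.1 (hcell i hi)
    obtain ⟨y1, y2⟩ := abs_le.1 (hcell k hk)
    have e : (2 * (1 / lam * M * (C * M * Real.exp (C * M))) + 4 * (1 / lam ^ 2) * M ^ 2) / (N : ℝ) ^ 2
        = 2 * (1 / lam * M * (C * M * Real.exp (C * M)) / N ^ 2)
          + 2 * (2 * (1 / lam ^ 2) * M ^ 2 / N ^ 2) := by ring
    have hdiff : (∫ v in m i..m (i + 1), f v) - ∫ v in m k..m (k + 1), f v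
        ≤ (2 * (1 / lam * M * (C * M * Real.exp (C * M))) + 4 * (1 / lam ^ 2) * M ^ 2) / N ^ 2 := by
      rw [e]; linarith
    refine (mul_le_mul_of_nonneg_left hdiff (inv_nonneg.2 hT0.le)).trans ?_
    exact mul_le_mul_of_nonneg_right hTi (by positivity)

/-- The centroidal structure of a sorted minimizing configuration. -/
lemma exists_centroidal_cells {N : ℕ} (hN : 1 ≤ N) {ρ : ℝ → ℝ} (hρ : Continuous ρ)
    (hpos : ∀ v ∈ Set.Icc (0 : ℝ) 1, 0 < ρ v) {z : ℕ → ℝ}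
    (hmono : ∀ i j, i ≤ j → j < N → z i ≤ z j) (hz01 : ∀ k < N, z k ∈ Set.Icc (0 : ℝ) 1)
    (hmin : ∀ (i : Fin N), ∀ t ∈ Set.Icc (0 : ℝ) 1,
      ∫ v in (0 : ℝ)..1, (⨅ j : Fin N, (z j - v) ^ 2) * ρ v ≤ ∫ v in (0 : ℝ)..1,
        (⨅ j : Fin N, (Function.update (fun j : Fin N => z j) i t j - v) ^ 2) * ρ v) :
    ∃ m h : ℕ → ℝ, m 0 = 0 ∧ m N = 1 ∧ (∀ k ≤ N, 0 ≤ h k) ∧ (∀ k < N, z k - h k = m k) ∧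
      (∀ k < N, z k + h (k + 1) = m (k + 1)) ∧ (∀ k ≤ N, m k ∈ Set.Icc (0 : ℝ) 1) ∧
      ∀ k < N, ∫ v in (m k)..(m (k + 1)), (v - z k) * ρ v = 0 := by
  have : NeZero N := ⟨by omega⟩
  obtain ⟨m, hm0, hmN, hmid⟩ : ∃ m : ℕ → ℝ, m 0 = 0 ∧ m N = 1 ∧
      ∀ k, k + 1 < N → m (k + 1) = (z k + z (k + 1)) / 2 :=
    ⟨fun k => if k = 0 then 0 else if k = N then 1 else (z (k - 1) + z k) / 2, by simp,
      by simp [show N ≠ 0 by omega], fun k hk => by simp [show k + 1 ≠ N by omega]⟩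
  have hzm : ∀ k < N, z k ≤ m (k + 1) := by
    intro k hk
    rcases Nat.lt_or_ge (k + 1) N with h | h
    · rw [hmid k h]; linarith [hmono k (k + 1) (by omega) h]
    · rw [show k + 1 = N by omega, hmN]; exact (hz01 k hk).2
  have hmz : ∀ k < N, m k ≤ z k := by
    intro k hk
    rcases k with _ | k
    · rw [hm0]; exact (hz01 0 hk).1
    · rw [hmid k hk]; linarith [hmono k (k + 1) (by omega) hk]
  have hm01 : ∀ k ≤ N, m k ∈ Set.Icc (0 : ℝ) 1 := by
    intro k hk
    rcases k with _ | k
    · simp [hm0]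
    · refine ⟨(hz01 k hk).1.trans (hzm k hk), ?_⟩
      rcases hk.lt_or_eq with h | h
      · exact (hmz _ h).trans (hz01 _ h).2
      · rw [show k + 1 = N from h, hmN]
  refine ⟨m, fun k => if k = 0 then z 0 else m k - z (k - 1), hm0, hmN, ?_, ?_, ?_, hm01, ?_⟩
  · intro k hk
    rcases k with _ | k
    · simpa using (hz01 0 (by omega)).1
    · simpa using hzm k hk
  · intro k hk
    rcases k with _ | k
    · simp [hm0]
    · simp [hmid k hk]; ring
  · intro k hk
    simp
  · intro k hk
    have hle : m k ≤ m (k + 1) := (hmz k hk).trans (hzm k hk)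
    refine integral_sub_mul_eq_zero_of_isMin hρ (hm01 k hk.le).1 hle (hm01 (k + 1) hk).2 hpos
      fun t ht => ?_
    refine cell_isMin_of_isMin hρ hpos (fun j : Fin N => z j) ⟨k, hk⟩ (hm01 k hk.le).1 hle
      (hm01 (k + 1) hk).2 ?_ ?_ ?_ (hmin ⟨k, hk⟩ t ht)
    · rintro v ⟨hv1, hv2⟩ ⟨j, hj⟩
      show (z k - v) ^ 2 ≤ (z j - v) ^ 2
      rcases lt_trichotomy j k with h | rfl | h
      · obtain ⟨k, rfl⟩ : ∃ l, k = l + 1 := ⟨k - 1, by omega⟩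
        rw [hmid k hk] at hv1
        have a1 := hmono j k (by omega) (by omega)
        have a2 := hmono k (k + 1) (by omega) hk
        nlinarith
      · exact le_rfl
      · rw [hmid k (by omega)] at hv2
        have a1 := hmono (k + 1) j h hj
        have a2 := hmono k (k + 1) (by omega) (by omega)
        nlinarith
    · rintro v ⟨hv1, hv2⟩
      rcases k with _ | k
      · rw [hm0] at hv2; linarith
      · refine ⟨⟨k, by omega⟩, by simp, ?_⟩
        show (z k - v) ^ 2 ≤ (z (k + 1) - v) ^ 2
        rw [hmid k hk] at hv2
        have a2 := hmono k (k + 1) (by omega) hk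
        nlinarith
    · rintro v ⟨hv1, hv2⟩
      rcases Nat.lt_or_ge (k + 1) N with h | h
      · refine ⟨⟨k + 1, h⟩, by simp, ?_⟩
        show (z (k + 1) - v) ^ 2 ≤ (z k - v) ^ 2
        rw [hmid k h] at hv1
        have a2 := hmono k (k + 1) (by omega) h
        nlinarith
      · rw [show k + 1 = N by omega, hmN] at hv1; linarith

theorem MK1_bound_for_minimizers (lam α Kρ : ℝ)
    (hlam0 : 0 < lam) (hlam1 : lam ≤ 1) (hα : 0 < α) (hKρ : 0 < Kρ) :
    ∃ εbar C : ℝ, 0 < εbar ∧ 0 < C ∧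
      ∀ (N : ℕ), 1 ≤ N → ∀ (ρ : ℝ → ℝ) (x : ℕ → ℝ),
        -- `ρ` is a periodic probability density of class `C^{3,α}` with `λ ≤ ρ ≤ 1/λ`
        Function.Periodic ρ 1 →
        (∀ y ∈ Set.Icc (0 : ℝ) 1, lam ≤ ρ y ∧ ρ y ≤ 1 / lam) →
        (∫ y in (0 : ℝ)..1, ρ y) = 1 →
        C3HolderBound α Kρ ρ →
        -- smallness: `‖ρ'‖_∞ + ‖ρ''‖_∞ ≤ ε̄`
        (∀ y ∈ Set.Icc (0 : ℝ) 1, ∀ y' ∈ Set.Icc (0 : ℝ) 1,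
          |deriv ρ y| + |deriv (deriv ρ) y'| ≤ εbar) →
        -- `(x¹, …, x^N)` is a minimizer of `F_{N,2}` over `[0,1]^N`
        (∀ i ∈ Finset.Icc 1 N, x i ∈ Set.Icc (0 : ℝ) 1) →
        (∀ y : ℕ → ℝ, (∀ i ∈ Finset.Icc 1 N, y i ∈ Set.Icc (0 : ℝ) 1) →
          (∫ v in (0 : ℝ)..1, (⨅ i : Fin N, (x ((i : ℕ) + 1) - v) ^ 2) * ρ v) ≤
            ∫ v in (0 : ℝ)..1, (⨅ i : Fin N, (y ((i : ℕ) + 1) - v) ^ 2) * ρ v) →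
        -- conclusion: `MK₁(μ^N, γ ρ^{1/3} dθ) ≤ C/N`
        ∀ φ : ℝ → ℝ, LipschitzWith 1 φ →
          (1 / (N : ℝ)) * ∑ i ∈ Finset.Icc 1 N, φ (x i)
            - ∫ θ in (0 : ℝ)..1,
                φ θ * ((∫ y in (0 : ℝ)..1, ρ y ^ ((1 : ℝ) / 3))⁻¹ * ρ θ ^ ((1 : ℝ) / 3)) ≤
            C / (N : ℝ) := by
  set C : ℝ := 72 / lam ^ 6 with hC
  set M : ℝ := Real.exp C / lam ^ 2 with hM
  refine ⟨1, M + 1 / lam * (2 * (1 / lam * M * (C * M * Real.exp (C * M)))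
    + 4 * (1 / lam ^ 2) * M ^ 2), one_pos, by positivity, ?_⟩
  intro N hN ρ x _ hbd _ hhol hsmall hx hmin φ hφ
  have hρ : ContDiff ℝ 2 ρ := hhol.1.of_le (by norm_num)
  have hpos : ∀ v ∈ Set.Icc (0 : ℝ) 1, 0 < ρ v := fun v hv => hlam0.trans_le (hbd v hv).1
  have hd1 : ∀ y ∈ Set.Icc (0 : ℝ) 1, |deriv ρ y| ≤ 1 := fun y hy => by
    linarith [hsmall y hy y hy, abs_nonneg (deriv (deriv ρ) y)]
  have hd2 : ∀ y ∈ Set.Icc (0 : ℝ) 1, |deriv (deriv ρ) y| ≤ 1 := fun y hy => by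
    linarith [hsmall y hy y hy, abs_nonneg (deriv ρ y)]
  set u : Fin N → ℝ := fun i => x ((i : ℕ) + 1) with hu
  set σ := Tuple.sort u with hσ
  have hsort : Monotone (u ∘ σ) := Tuple.monotone_sort u
  set z : ℕ → ℝ := fun k => if hk : k < N then u (σ ⟨k, hk⟩) else 0 with hz
  have hzf : ∀ j : Fin N, z j = u (σ j) := fun j => by simp [hz]
  have hu01 : ∀ j, u j ∈ Set.Icc (0 : ℝ) 1 := fun j =>
    hx _ (Finset.mem_Icc.2 ⟨by omega, j.2⟩)
  have hmono : ∀ i j, i ≤ j → j < N → z i ≤ z j := by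
    intro i j hij hj
    rw [hzf ⟨i, hij.trans_lt hj⟩, hzf ⟨j, hj⟩]
    exact hsort (Fin.mk_le_mk.2 hij)
  have hz01 : ∀ k < N, z k ∈ Set.Icc (0 : ℝ) 1 := fun k hk => by
    rw [hzf ⟨k, hk⟩]; exact hu01 _
  have hmin' : ∀ (i : Fin N), ∀ t ∈ Set.Icc (0 : ℝ) 1,
      ∫ v in (0 : ℝ)..1, (⨅ j : Fin N, (z j - v) ^ 2) * ρ v ≤ ∫ v in (0 : ℝ)..1,
        (⨅ j : Fin N, (Function.update (fun j : Fin N => z j) i t j - v) ^ 2) * ρ v := by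
    intro i t ht
    have h := hmin (Function.update x ((σ i : ℕ) + 1) t) (fun k hk => by
      rcases eq_or_ne k ((σ i : ℕ) + 1) with rfl | hne
      · simpa using ht
      · rw [Function.update_of_ne hne]; exact hx k hk)
    have e1 : ∀ v : ℝ, (⨅ j : Fin N, (z j - v) ^ 2)
        = ⨅ j : Fin N, (x ((j : ℕ) + 1) - v) ^ 2 := by
      intro v
      rw [← σ.iInf_comp (g := fun j : Fin N => (x ((j : ℕ) + 1) - v) ^ 2)]
      simp only [hzf, hu]
    have e2 : ∀ v : ℝ,
        (⨅ j : Fin N, (Function.update (fun j : Fin N => z j) i t j - v) ^ 2)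
          = ⨅ j : Fin N, (Function.update x ((σ i : ℕ) + 1) t ((j : ℕ) + 1) - v) ^ 2 := by
      intro v
      rw [← σ.iInf_comp
        (g := fun j : Fin N => (Function.update x ((σ i : ℕ) + 1) t ((j : ℕ) + 1) - v) ^ 2)]
      congr 1; ext j
      rcases eq_or_ne j i with rfl | hne
      · simp
      · have : (σ j : ℕ) + 1 ≠ (σ i : ℕ) + 1 := fun h' =>
          hne (σ.injective (Fin.ext (Nat.succ_injective h')))
        rw [Function.update_of_ne hne, Function.update_of_ne this, hzf]
    simp only [e1, e2]
    exact h
  obtain ⟨m, h, hm0, hmN, hh, hmz, hzm, hm01, hc⟩ :=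
    exists_centroidal_cells hN hρ.continuous hpos hmono hz01 hmin'
  have hsum : ∑ i ∈ Finset.Icc 1 N, φ (x i) = ∑ k ∈ Finset.range N, φ (z k) := by
    have e1 : ∑ i ∈ Finset.Icc 1 N, φ (x i) = ∑ k ∈ Finset.range N, φ (x (k + 1)) := by
      rw [Finset.range_eq_Ico, Finset.sum_Ico_add' (fun i => φ (x i)) 0 N 1]
      rfl
    rw [e1, Finset.sum_range (fun k => φ (x (k + 1))), Finset.sum_range (fun k => φ (z k))]
    simp only [hzf]
    exact (Equiv.sum_comp σ (fun j => φ (u j))).symm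
  rw [hsum]
  exact centroidal_empirical_sub_integral_le hlam0 hlam1 hρ hbd hd1 hd2 hN hm0 hmN hh hmz hzm hm01
    hc hC hM hφ
end

section
/- Let λ ∈ (0,1] and let ρ:[0,1]→[λ,1/λ] be periodic and continuous. Let f = f(t,x) be a positive smooth periodic-in-x solution of ∂_t f = −(1/6) ∂_x( f ∂_x( ρ/f^3 ) ) on [0,∞)×[0,1], with 0 < a_1 ≤ f(0,x) ≤ A_1 for all x. Then λ^{2/3} a_1 ≤ f(t,x) ≤ A_1/λ^{2/3} for all t ≥ 0 and all x ∈ [0,1]. -/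
open MeasureTheory

/-- At a global maximum of a continuous `v`, the derivative of `g v'` is nonpositive when `g > 0`.
No differentiability is needed, since `deriv` vanishes where it does not exist. -/
theorem deriv_mul_deriv_nonpos_of_isMax {g v : ℝ → ℝ} {x₀ : ℝ} (hg : ∀ x, 0 < g x)
    (hv : Continuous v) (hmax : ∀ x, v x ≤ v x₀) :
    deriv (fun y => g y * deriv v y) x₀ ≤ 0 := by
  by_contra! hpos
  have hd : HasDerivAt (fun y => g y * deriv v y) (deriv (fun y => g y * deriv v y) x₀) x₀ :=
    (differentiableAt_of_deriv_ne_zero hpos.ne').hasDerivAt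
  have hv0 : deriv v x₀ = 0 := IsLocalMax.deriv_eq_zero (Filter.Eventually.of_forall hmax)
  have hslope := (hasDerivAt_iff_tendsto_slope.1 hd).eventually (lt_mem_nhds hpos)
  have hright := hslope.filter_mono (nhdsWithin_mono x₀ fun y (hy : y ∈ Set.Ioi x₀) => ne_of_gt hy)
  obtain ⟨b, hb, hsub⟩ := (mem_nhdsGT_iff_exists_Ioo_subset).1 hright
  have hb' : x₀ < b := hb
  have hderiv : ∀ y ∈ Set.Ioo x₀ b, 0 < deriv v y := by
    intro y hy
    have h : 0 < slope (fun y => g y * deriv v y) x₀ y := hsub hy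
    rw [slope_def_field, hv0, mul_zero, sub_zero] at h
    have h' := (div_pos_iff_of_pos_right (sub_pos.2 hy.1)).1 h
    exact (mul_pos_iff_of_pos_left (hg y)).1 h'
  have hmono : StrictMonoOn v (Set.Icc x₀ b) :=
    strictMonoOn_of_deriv_pos (convex_Icc x₀ b) hv.continuousOn (by rwa [interior_Icc])
  exact absurd (hmono (Set.left_mem_Icc.2 hb'.le) (Set.right_mem_Icc.2 hb'.le) hb')
    (not_lt.2 (hmax b))

/-- At a global minimum of a continuous `v`, the derivative of `g v'` is nonnegative when `g > 0`. -/
theorem deriv_mul_deriv_nonneg_of_isMin {g v : ℝ → ℝ} {x₀ : ℝ} (hg : ∀ x, 0 < g x)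
    (hv : Continuous v) (hmin : ∀ x, v x₀ ≤ v x) :
    0 ≤ deriv (fun y => g y * deriv v y) x₀ := by
  have h := deriv_mul_deriv_nonpos_of_isMax (v := fun x => -v x) hg hv.neg
    (fun x => neg_le_neg (hmin x))
  simpa [deriv.fun_neg] using h

/-- Parabolic maximum principle for functions that are `1`-periodic in space: if the time
derivative is nonpositive at every spatial maximum, an initial upper bound propagates. -/
theorem le_of_timeDeriv_nonpos_at_max {u u' : ℝ → ℝ → ℝ} {C : ℝ}
    (hcont : ContinuousOn (Function.uncurry u) (Set.Ici 0 ×ˢ Set.univ))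
    (hper : ∀ t, 0 ≤ t → Function.Periodic (u t) 1)
    (hderiv : ∀ t, 0 ≤ t → ∀ x, HasDerivAt (fun s => u s x) (u' t x) t)
    (hmax : ∀ t, 0 ≤ t → ∀ x, (∀ y, u t y ≤ u t x) → u' t x ≤ 0)
    (hinit : ∀ x, u 0 x ≤ C) {t : ℝ} (ht : 0 ≤ t) (x : ℝ) : u t x ≤ C := by
  have key : ∀ ε > 0, u t x - ε * t ≤ C := by
    intro ε hε
    have hK : IsCompact (Set.Icc (0 : ℝ) t ×ˢ Set.Icc (0 : ℝ) 1) :=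
      isCompact_Icc.prod isCompact_Icc
    have hw : ContinuousOn (fun p : ℝ × ℝ => u p.1 p.2 - ε * p.1)
        (Set.Icc (0 : ℝ) t ×ˢ Set.Icc (0 : ℝ) 1) :=
      (hcont.mono (Set.prod_mono Set.Icc_subset_Ici_self (Set.subset_univ _))).sub
        (by fun_prop)
    obtain ⟨⟨s, z⟩, ⟨hs, hz⟩, hsz⟩ := hK.exists_isMaxOn
      ⟨(0, 0), ⟨Set.left_mem_Icc.2 ht, Set.left_mem_Icc.2 zero_le_one⟩⟩ hw
    have hle : ∀ r ∈ Set.Icc 0 t, ∀ y, u r y - ε * r ≤ u s z - ε * s := by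
      intro r hr y
      obtain ⟨y', hy', hyy⟩ := (hper r hr.1).exists_mem_Ico₀ one_pos y
      rw [hyy]
      exact hsz (show (r, y') ∈ _ from ⟨hr, Set.Ico_subset_Icc_self hy'⟩)
    rcases hs.1.eq_or_lt with h0 | h0
    · have := hle t ⟨ht, le_rfl⟩ x
      have h1 := hinit z
      change 0 = s at h0
      subst h0
      linarith
    · exfalso
      change 0 < s at h0
      have hu' : u' s z ≤ 0 := hmax s h0.le z fun y => by linarith [hle s hs y]
      have hd : HasDerivAt (fun r => u r z - ε * r) (u' s z - ε) s := by
        simpa using (hderiv s h0.le z).fun_sub ((hasDerivAt_id s).const_mul ε)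
      have hneg : u' s z - ε < 0 := by linarith
      have hslope := (hasDerivAt_iff_tendsto_slope.1 hd).eventually (gt_mem_nhds hneg)
      have hleft := hslope.filter_mono
        (nhdsWithin_mono s fun y (hy : y ∈ Set.Iio s) => ne_of_lt hy)
      obtain ⟨r, hr, hr0⟩ := (hleft.and (Ioo_mem_nhdsLT h0)).exists
      rw [slope_def_field] at hr
      have h2 := hle r ⟨hr0.1.le, hr0.2.le.trans hs.2⟩ z
      exact absurd (div_nonneg_of_nonpos (sub_nonpos.2 h2) (sub_nonpos.2 hr0.2.le))
        (not_le.2 hr)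
  have hlim : Filter.Tendsto (fun ε : ℝ => u t x - ε * t) (nhdsWithin 0 (Set.Ioi 0))
      (nhds (u t x)) := by
    have : Continuous (fun ε : ℝ => u t x - ε * t) := by fun_prop
    simpa using (this.tendsto 0).mono_left nhdsWithin_le_nhds
  exact le_of_tendsto hlim (Filter.eventually_of_mem self_mem_nhdsWithin key)

theorem eulerian_bounds_propagate (lam a1 A1 : ℝ)
    (hlam0 : 0 < lam) (hlam1 : lam ≤ 1) (ha1 : 0 < a1)
    (ρ : ℝ → ℝ) (hρcont : Continuous ρ) (hρper : Function.Periodic ρ 1)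
    (hρbd : ∀ y ∈ Set.Icc (0 : ℝ) 1, lam ≤ ρ y ∧ ρ y ≤ 1 / lam)
    (f : ℝ → ℝ → ℝ) (hf : ContDiff ℝ (⊤ : ℕ∞) (Function.uncurry f))
    (hfper : ∀ t, 0 ≤ t → Function.Periodic (f t) 1)
    (hfpos : ∀ t, 0 ≤ t → ∀ x, 0 < f t x)
    -- the PDE `∂ₜf = -(1/6) ∂ₓ( f ∂ₓ(ρ/f³) )`
    (hpde : ∀ t, 0 ≤ t → ∀ x : ℝ,
      HasDerivAt (fun s => f s x)
        (-(1 / 6) * deriv (fun y => f t y * deriv (fun z => ρ z / (f t z) ^ 3) y) x) t)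
    -- initial bounds
    (hinit : ∀ x : ℝ, a1 ≤ f 0 x ∧ f 0 x ≤ A1) :
    ∀ t, 0 ≤ t → ∀ x ∈ Set.Icc (0 : ℝ) 1,
      lam ^ ((2 : ℝ) / 3) * a1 ≤ f t x ∧ f t x ≤ A1 / lam ^ ((2 : ℝ) / 3) := by
  have hρ : ∀ y, lam ≤ ρ y ∧ ρ y ≤ 1 / lam := by
    intro y
    obtain ⟨y', hy', hyy⟩ := hρper.exists_mem_Ico₀ one_pos y
    rw [hyy]
    exact hρbd y' (Set.Ico_subset_Icc_self hy')
  have hρpos : ∀ y, 0 < ρ y := fun y => hlam0.trans_le (hρ y).1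
  have hA1 : 0 < A1 := ha1.trans_le ((hinit 0).1.trans (hinit 0).2)
  have hcont : ContinuousOn (Function.uncurry fun t x => ρ x / f t x ^ 3)
      (Set.Ici 0 ×ˢ Set.univ) :=
    ((hρcont.comp continuous_snd).continuousOn).div ((hf.continuous.pow 3).continuousOn)
      fun p hp => (pow_pos (hfpos p.1 hp.1 p.2) 3).ne'
  have hper : ∀ t, 0 ≤ t → Function.Periodic (fun x => ρ x / f t x ^ 3) 1 := fun t ht x => by
    simp only [hρper x, hfper t ht x]
  have hvcont : ∀ t, 0 ≤ t → Continuous fun x => ρ x / f t x ^ 3 := fun t ht =>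
    hρcont.div ((hf.continuous.comp (Continuous.prodMk_right t)).pow 3)
      fun x => (pow_pos (hfpos t ht x) 3).ne'
  have hderiv : ∀ t, 0 ≤ t → ∀ x, HasDerivAt (fun s => ρ x / f s x ^ 3)
      (ρ x / (2 * f t x ^ 4) * deriv (fun y => f t y * deriv (fun z => ρ z / f t z ^ 3) y) x)
      t := by
    intro t ht x
    have hne := (hfpos t ht x).ne'
    refine ((hasDerivAt_const t (ρ x)).fun_div ((hpde t ht x).fun_pow 3)
      (pow_ne_zero 3 hne)).congr_deriv ?_
    field_simp
    ring
  have hcoef : ∀ t, 0 ≤ t → ∀ x, 0 ≤ ρ x / (2 * f t x ^ 4) := fun t ht x => by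
    have := hρpos x
    have := hfpos t ht x
    positivity
  have hlam3 : (lam ^ ((2 : ℝ) / 3)) ^ 3 = lam ^ 2 := by
    rw [← Real.rpow_natCast, ← Real.rpow_mul hlam0.le, ← Real.rpow_natCast]
    norm_num
  have hq : 0 < lam ^ ((2 : ℝ) / 3) := Real.rpow_pos_of_pos hlam0 _
  intro t ht x _
  have hfp := hfpos t ht x
  have hupper : ρ x / f t x ^ 3 ≤ 1 / lam / a1 ^ 3 :=
    le_of_timeDeriv_nonpos_at_max hcont hper hderiv
      (fun s hs y hy => mul_nonpos_of_nonneg_of_nonpos (hcoef s hs y)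
        (deriv_mul_deriv_nonpos_of_isMax (hfpos s hs) (hvcont s hs) hy))
      (fun y => div_le_div₀ (by positivity) (hρ y).2 (by positivity)
        (pow_le_pow_left₀ ha1.le (hinit y).1 3)) ht x
  have hlower : -(ρ x / f t x ^ 3) ≤ -(lam / A1 ^ 3) :=
    le_of_timeDeriv_nonpos_at_max (u := fun t x => -(ρ x / f t x ^ 3)) hcont.neg
      (fun s hs y => congrArg Neg.neg (hper s hs y)) (fun s hs y => (hderiv s hs y).neg)
      (fun s hs y hy => neg_nonpos.2 (mul_nonneg (hcoef s hs y)
        (deriv_mul_deriv_nonneg_of_isMin (hfpos s hs) (hvcont s hs)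
          fun z => neg_le_neg_iff.1 (hy z))))
      (fun y => neg_le_neg (div_le_div₀ (hρpos y).le (hρ y).1 (pow_pos (hfpos 0 le_rfl y) 3)
        (pow_le_pow_left₀ (hfpos 0 le_rfl y).le (hinit y).2 3))) ht x
  constructor
  · refine le_of_pow_le_pow_left₀ three_ne_zero hfp.le ?_
    rw [mul_pow, hlam3]
    have h : lam / f t x ^ 3 ≤ 1 / lam / a1 ^ 3 :=
      (div_le_div_of_nonneg_right (hρ x).1 (by positivity)).trans hupper
    rw [div_div, div_le_div_iff₀ (by positivity) (by positivity)] at h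
    linarith
  · refine le_of_pow_le_pow_left₀ three_ne_zero (by positivity) ?_
    rw [div_pow, hlam3, le_div_iff₀ (by positivity)]
    have h : lam / A1 ^ 3 ≤ 1 / lam / f t x ^ 3 :=
      (neg_le_neg_iff.1 hlower).trans (div_le_div_of_nonneg_right (hρ x).2 (by positivity))
    rw [div_div, div_le_div_iff₀ (by positivity) (by positivity)] at h
    linarith
end

section
/- Let λ ∈ (0,1] and let ρ:[0,1]→[λ,1/λ] be periodic and of class C^1. Let X = X(t,θ) be a smooth solution of ∂_t X = (1/2)ρ(X)∂_θX ∂²_{θθ}X + (1/6)ρ'(X)(∂_θX)^3 on [0,∞)×[0,1] with X(t,0)=0, X(t,1)=1, satisfying 0 < a_1 ≤ ∂_θX(0,θ) ≤ A_1 for all θ. Then λ^{2/3} a_1 ≤ ∂_θX(t,θ) ≤ A_1/λ^{2/3} for all t ≥ 0 and all θ ∈ [0,1]. -/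
open MeasureTheory

open Set Filter Topology Function

/-- If `g` is positive at the initial time and can never touch zero from above
with nonpositive time derivative, then `g` stays positive. -/
theorem pos_of_no_first_touching {g g' : ℝ → ℝ → ℝ} {T : ℝ}
    (hg : Continuous (uncurry g))
    (hg' : ∀ t θ, HasDerivAt (fun s => g s θ) (g' t θ) t)
    (hinit : ∀ θ ∈ Icc (0 : ℝ) 1, 0 < g 0 θ)
    (htouch : ∀ t ∈ Icc 0 T, ∀ θ ∈ Icc (0 : ℝ) 1, g t θ = 0 →
      (∀ η ∈ Icc (0 : ℝ) 1, 0 ≤ g t η) → 0 < g' t θ) :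
    ∀ t ∈ Icc 0 T, ∀ θ ∈ Icc (0 : ℝ) 1, 0 < g t θ := by
  intro t ht θ hθ
  by_contra! hneg
  have hK : IsCompact ((Icc 0 T ×ˢ Icc (0 : ℝ) 1) ∩ {z | uncurry g z ≤ 0}) :=
    (isCompact_Icc.prod isCompact_Icc).inter_right (isClosed_le hg continuous_const)
  obtain ⟨⟨t₀, θ₀⟩, ⟨⟨ht₀, hθ₀⟩, hle⟩, hmin⟩ :=
    hK.exists_isMinOn ⟨(t, θ), ⟨ht, hθ⟩, hneg⟩ continuous_fst.continuousOn
  simp only [mem_ofPred_eq, uncurry_apply_pair] at hle ht₀ hθ₀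
  have hbefore : ∀ s ∈ Ico 0 t₀, ∀ η ∈ Icc (0 : ℝ) 1, 0 < g s η := by
    intro s hs η hη
    by_contra! h
    have : t₀ ≤ s := hmin (a := (s, η)) ⟨⟨⟨hs.1, hs.2.le.trans ht₀.2⟩, hη⟩, h⟩
    exact absurd hs.2 this.not_gt
  have ht₀pos : 0 < t₀ := by
    refine ht₀.1.lt_of_ne fun h => ?_
    subst h
    exact (hinit θ₀ hθ₀).not_ge hle
  have hleft : ∀ᶠ s in 𝓝[<] t₀, s ∈ Ico 0 t₀ :=
    mem_of_superset (Ioo_mem_nhdsLT ht₀pos) Ioo_subset_Ico_self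
  have hat : ∀ η ∈ Icc (0 : ℝ) 1, 0 ≤ g t₀ η := fun η hη =>
    ge_of_tendsto ((hg' t₀ η).continuousAt.tendsto.mono_left nhdsWithin_le_nhds)
      (hleft.mono fun s hs => (hbefore s hs η hη).le)
  have hzero : g t₀ θ₀ = 0 := le_antisymm hle (hat θ₀ hθ₀)
  refine (htouch t₀ ht₀ θ₀ hθ₀ hzero hat).not_ge ?_
  have hsub : Iio t₀ ⊆ {t₀}ᶜ := fun s hs => ne_of_lt hs
  refine le_of_tendsto ((hasDerivAt_iff_tendsto_slope.1 (hg' t₀ θ₀)).mono_left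
    (nhdsWithin_mono _ hsub)) (hleft.mono fun s hs => ?_)
  rw [slope_def_field, hzero, sub_zero]
  exact div_nonpos_of_nonneg_of_nonpos (hbefore s hs θ₀ hθ₀).le (sub_nonpos.2 hs.2.le)

/-- Second-order condition at a minimum over the closed interval of a function whose derivative
is `k * q`, with `k` positive and `q` vanishing at the endpoints. -/
theorem critical_of_isMinOn_of_neumann {h k q : ℝ → ℝ} {r θ : ℝ} (hθ : θ ∈ Icc (0 : ℝ) 1)
    (hh : ∀ η ∈ Icc (0 : ℝ) 1, HasDerivAt h (k η * q η) η)
    (hk : ContinuousAt k θ) (hkpos : 0 < k θ) (hq : HasDerivAt q r θ)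
    (hq0 : q 0 = 0) (hq1 : q 1 = 0) (hmin : IsMinOn h (Icc 0 1) θ) :
    q θ = 0 ∧ 0 ≤ r := by
  have hqθ : q θ = 0 := by
    rcases hθ.1.eq_or_lt with h0 | h0
    · rw [← h0, hq0]
    rcases hθ.2.eq_or_lt with h1 | h1
    · rw [h1, hq1]
    · have := (hmin.isLocalMin (Icc_mem_nhds h0 h1)).hasDerivAt_eq_zero (hh θ hθ)
      exact (mul_eq_zero.1 this).resolve_left hkpos.ne'
  refine ⟨hqθ, ?_⟩
  by_contra! hr
  have hslope : ∀ᶠ η in 𝓝 θ, η ≠ θ → slope q θ η < 0 :=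
    eventually_nhdsWithin_iff.1 ((hasDerivAt_iff_tendsto_slope.1 hq).eventually (gt_mem_nhds hr))
  obtain ⟨δ, hδ, hball⟩ := Metric.eventually_nhds_iff.1
    (hslope.and (hk.eventually (lt_mem_nhds hkpos)))
  have hsl : ∀ η, |η - θ| < δ → η ≠ θ → q η / (η - θ) < 0 ∧ 0 < k η := by
    intro η hη hne
    obtain ⟨h1, h2⟩ := hball (y := η) (by rwa [Real.dist_eq])
    have := h1 hne
    rw [slope_def_field, hqθ, sub_zero] at this
    exact ⟨this, h2⟩
  rcases hθ.2.lt_or_eq with h1 | h1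
  · obtain ⟨b, hb1, hb2⟩ := exists_between (lt_min h1 (lt_add_of_pos_right θ hδ))
    have hsub : Icc θ b ⊆ Icc (0 : ℝ) 1 :=
      Icc_subset_Icc hθ.1 (hb2.le.trans (min_le_left _ _))
    have hanti : StrictAntiOn h (Icc θ b) := by
      refine strictAntiOn_of_deriv_neg (convex_Icc _ _)
        (fun η hη => (hh η (hsub hη)).continuousAt.continuousWithinAt) fun η hη => ?_
      rw [interior_Icc] at hη
      rw [(hh η (hsub (Ioo_subset_Icc_self hη))).deriv]
      have hlt : η < θ + δ := hη.2.trans (hb2.trans_le (min_le_right _ _))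
      obtain ⟨hs, hkη⟩ := hsl η (abs_lt.2 ⟨by linarith [hη.1], by linarith⟩) hη.1.ne'
      exact mul_neg_of_pos_of_neg hkη
        (by simpa using (div_lt_iff₀ (sub_pos.2 hη.1)).1 hs)
    exact (hanti (left_mem_Icc.2 hb1.le) (right_mem_Icc.2 hb1.le) hb1).not_ge
      (hmin (hsub (right_mem_Icc.2 hb1.le)))
  · have h0 : 0 < θ := h1 ▸ one_pos
    obtain ⟨b, hb1, hb2⟩ := exists_between (max_lt h0 (sub_lt_self θ hδ))
    have hsub : Icc b θ ⊆ Icc (0 : ℝ) 1 :=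
      Icc_subset_Icc ((le_max_left _ _).trans hb1.le) hθ.2
    have hmono : StrictMonoOn h (Icc b θ) := by
      refine strictMonoOn_of_deriv_pos (convex_Icc _ _)
        (fun η hη => (hh η (hsub hη)).continuousAt.continuousWithinAt) fun η hη => ?_
      rw [interior_Icc] at hη
      rw [(hh η (hsub (Ioo_subset_Icc_self hη))).deriv]
      have hlt : θ - δ < η := ((le_max_right _ _).trans_lt hb1).trans hη.1
      obtain ⟨hs, hkη⟩ := hsl η (abs_lt.2 ⟨by linarith, by linarith [hη.2]⟩) hη.2.ne
      exact mul_pos hkη (by simpa using (div_lt_iff_of_neg (sub_neg.2 hη.2)).1 hs)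
    exact (hmono (left_mem_Icc.2 hb2.le) (right_mem_Icc.2 hb2.le) hb2).not_ge
      (hmin (hsub (left_mem_Icc.2 hb2.le)))

theorem HasFDerivAt.hasDerivAt_left {E : Type*} [NormedAddCommGroup E] [NormedSpace ℝ E]
    {F : ℝ × ℝ → E} {L : ℝ × ℝ →L[ℝ] E} {t θ : ℝ} (h : HasFDerivAt F L (t, θ)) :
    HasDerivAt (fun s => F (s, θ)) (L (1, 0)) t :=
  HasFDerivAt.comp_hasDerivAt (f := fun s : ℝ => (s, θ)) t h
    ((hasDerivAt_id t).prodMk (hasDerivAt_const t θ))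

theorem HasFDerivAt.hasDerivAt_right {E : Type*} [NormedAddCommGroup E] [NormedSpace ℝ E]
    {F : ℝ × ℝ → E} {L : ℝ × ℝ →L[ℝ] E} {t θ : ℝ} (h : HasFDerivAt F L (t, θ)) :
    HasDerivAt (fun η => F (t, η)) (L (0, 1)) θ :=
  HasFDerivAt.comp_hasDerivAt (f := fun η : ℝ => (t, η)) θ h
    ((hasDerivAt_const θ t).prodMk (hasDerivAt_id θ))

theorem hasDerivAt_right_of_contDiff {X : ℝ → ℝ → ℝ} (hX : ContDiff ℝ 1 (uncurry X)) (t θ : ℝ) :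
    HasDerivAt (X t) (fderiv ℝ (uncurry X) (t, θ) (0, 1)) θ :=
  (hX.differentiable one_ne_zero (t, θ)).hasFDerivAt.hasDerivAt_right

/-- A `C^2` function of two variables has commuting mixed partial derivatives. -/
theorem exists_mixed_partial {X : ℝ → ℝ → ℝ} (hX : ContDiff ℝ 2 (uncurry X)) :
    ∃ q r : ℝ → ℝ → ℝ, ∀ t θ,
      HasDerivAt (fun s => X s θ) (q t θ) t ∧ HasDerivAt (fun s => deriv (X s) θ) (r t θ) t ∧
        HasDerivAt (q t) (r t θ) θ := by
  have h1 : ContDiff ℝ 1 (uncurry X) := hX.of_le one_le_two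
  have hF : ContDiff ℝ 1 (fderiv ℝ (uncurry X)) :=
    hX.fderiv_right (by norm_num [one_add_one_eq_two])
  have hd (t θ : ℝ) := (hF.differentiable one_ne_zero (t, θ)).hasFDerivAt
  refine ⟨fun t θ => fderiv ℝ (uncurry X) (t, θ) (1, 0),
    fun t θ => fderiv ℝ (fderiv ℝ (uncurry X)) (t, θ) (1, 0) (0, 1), fun t θ => ⟨?_, ?_, ?_⟩⟩
  · exact (h1.differentiable one_ne_zero (t, θ)).hasFDerivAt.hasDerivAt_left
  · simp_rw [fun s => (hasDerivAt_right_of_contDiff h1 s θ).deriv]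
    simpa using (hd t θ).hasDerivAt_left.clm_apply (hasDerivAt_const t ((0 : ℝ), (1 : ℝ)))
  · have hsymm : IsSymmSndFDerivAt ℝ (uncurry X) (t, θ) :=
      hX.contDiffAt.isSymmSndFDerivAt (by simp [minSmoothness_of_isRCLikeNormedField])
    have h := (hd t θ).hasDerivAt_right.clm_apply (hasDerivAt_const θ ((1 : ℝ), (0 : ℝ)))
    simp only [map_zero, add_zero] at h
    rwa [hsymm.eq] at h

theorem continuous_uncurry_deriv {X : ℝ → ℝ → ℝ} (hX : ContDiff ℝ 1 (uncurry X)) :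
    Continuous (uncurry fun t θ => deriv (X t) θ) := by
  have : (uncurry fun t θ => deriv (X t) θ) = fun z => fderiv ℝ (uncurry X) z (0, 1) := by
    ext ⟨t, θ⟩
    exact (hasDerivAt_right_of_contDiff hX t θ).deriv
  rw [this]
  exact (hX.continuous_fderiv one_ne_zero).clm_apply continuous_const

theorem lagrangian_monotonicity_propagates (lam a1 A1 : ℝ)
    (hlam0 : 0 < lam) (hlam1 : lam ≤ 1) (ha1 : 0 < a1)
    (ρ : ℝ → ℝ) (hρC1 : ContDiff ℝ 1 ρ) (hρper : Function.Periodic ρ 1)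
    (hρbd : ∀ y ∈ Set.Icc (0 : ℝ) 1, lam ≤ ρ y ∧ ρ y ≤ 1 / lam)
    (X : ℝ → ℝ → ℝ) (hX : ContDiff ℝ (⊤ : ℕ∞) (Function.uncurry X))
    -- the PDE `∂ₜX = (1/2) ρ(X) ∂_θX ∂²_θθX + (1/6) ρ'(X) (∂_θX)³`
    (hpde : ∀ t, 0 ≤ t → ∀ θ ∈ Set.Icc (0 : ℝ) 1,
      HasDerivAt (fun s => X s θ)
        ((1 / 2) * ρ (X t θ) * deriv (X t) θ * deriv (deriv (X t)) θ
          + (1 / 6) * deriv ρ (X t θ) * (deriv (X t) θ) ^ 3) t)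
    -- boundary conditions
    (hbd : ∀ t, 0 ≤ t → X t 0 = 0 ∧ X t 1 = 1)
    -- initial monotonicity bounds
    (hinit : ∀ θ ∈ Set.Icc (0 : ℝ) 1, a1 ≤ deriv (X 0) θ ∧ deriv (X 0) θ ≤ A1) :
    ∀ t, 0 ≤ t → ∀ θ ∈ Set.Icc (0 : ℝ) 1,
      lam ^ ((2 : ℝ) / 3) * a1 ≤ deriv (X t) θ ∧
        deriv (X t) θ ≤ A1 / lam ^ ((2 : ℝ) / 3) := by
  have hX2 : ContDiff ℝ 2 (uncurry X) := contDiff_infty.1 hX 2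
  have hX1 : ContDiff ℝ 1 (uncurry X) := hX2.of_le one_le_two
  obtain ⟨q, r, hqr⟩ := exists_mixed_partial hX2
  have hXθ (t θ : ℝ) : HasDerivAt (X t) (deriv (X t) θ) θ :=
    (hasDerivAt_right_of_contDiff hX1 t θ).differentiableAt.hasDerivAt
  have hXθθ (t θ : ℝ) : HasDerivAt (deriv (X t)) (deriv (deriv (X t)) θ) θ := by
    have h : ContDiff ℝ 2 (X t) := hX2.comp (contDiff_prodMk_right t)
    exact ((h.deriv' (n := 1)).differentiable one_ne_zero θ).hasDerivAt
  have hρ (y : ℝ) : HasDerivAt ρ (deriv ρ y) y := (hρC1.differentiable one_ne_zero y).hasDerivAt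
  have hρall (y : ℝ) : lam ≤ ρ y ∧ ρ y ≤ 1 / lam := by
    obtain ⟨z, hz, hyz⟩ := hρper.exists_mem_Ico₀ one_pos y
    rw [hyz]
    exact hρbd z (Ico_subset_Icc_self hz)
  have hρpos (y : ℝ) : 0 < ρ y := hlam0.trans_le (hρall y).1
  have hpcont := continuous_uncurry_deriv hX1
  set w : ℝ → ℝ → ℝ := fun t θ => ρ (X t θ) * deriv (X t) θ ^ 3 with hw
  set w' : ℝ → ℝ → ℝ := fun t θ =>
    deriv ρ (X t θ) * q t θ * deriv (X t) θ ^ 3 + 3 * ρ (X t θ) * deriv (X t) θ ^ 2 * r t θ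
    with hw'
  have hwcont : Continuous (uncurry w) :=
    (hρC1.continuous.comp hX1.continuous).mul (hpcont.pow 3)
  have hwt (t θ : ℝ) : HasDerivAt (fun s => w s θ) (w' t θ) t := by
    obtain ⟨h1, h2, -⟩ := hqr t θ
    refine (((hρ (X t θ)).comp t h1).mul (h2.pow 3)).congr_deriv ?_
    simp only [hw', comp_apply, Pi.pow_apply]
    push_cast
    ring
  have hwθ (t : ℝ) (ht : 0 ≤ t) (θ : ℝ) (hθ : θ ∈ Icc (0 : ℝ) 1) :
      HasDerivAt (w t) (6 * deriv (X t) θ * q t θ) θ := by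
    rw [(hqr t θ).1.unique (hpde t ht θ hθ)]
    refine (((hρ (X t θ)).comp θ (hXθ t θ)).mul ((hXθθ t θ).pow 3)).congr_deriv ?_
    simp only [comp_apply, Pi.pow_apply]
    push_cast
    ring
  have hwpos (t θ : ℝ) (h : 0 < w t θ) : 0 < deriv (X t) θ := by
    have : 0 < deriv (X t) θ ^ 3 := (pos_iff_pos_of_mul_pos h).1 (hρpos _)
    exact (Odd.pow_pos_iff ⟨1, rfl⟩).1 this
  have hq (t : ℝ) (ht : 0 ≤ t) (i : ℝ) (hi : i ∈ Icc (0 : ℝ) 1) (c : ℝ)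
      (hc : ∀ s, 0 ≤ s → X s i = c) : q t i = 0 := by
    have h1 := (hqr t i).1.hasDerivWithinAt (s := Ici t)
    have h2 : HasDerivWithinAt (fun s => X s i) 0 (Ici t) t :=
      (hasDerivWithinAt_const t (Ici t) c).congr (fun s hs => hc s (ht.trans hs)) (hc t ht)
    exact (uniqueDiffWithinAt_Ici t).eq_deriv _ h1 h2
  have hq0 (t : ℝ) (ht : 0 ≤ t) : q t 0 = 0 :=
    hq t ht 0 (by simp) 0 fun s hs => (hbd s hs).1
  have hq1 (t : ℝ) (ht : 0 ≤ t) : q t 1 = 0 :=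
    hq t ht 1 (by simp) 1 fun s hs => (hbd s hs).2
  have hkcont (t θ : ℝ) : ContinuousAt (fun η => 6 * deriv (X t) η) θ :=
    (hXθθ t θ).continuousAt.const_mul 6
  have hw'eq (t θ : ℝ) (h : q t θ = 0) :
      w' t θ = 3 * ρ (X t θ) * deriv (X t) θ ^ 2 * r t θ := by
    simp only [hw', h]
    ring
  have hmin (t : ℝ) (ht : 0 ≤ t) (θ : ℝ) (hθ : θ ∈ Icc (0 : ℝ) 1) (hp : 0 < deriv (X t) θ)
      (h : IsMinOn (w t) (Icc 0 1) θ) : 0 ≤ w' t θ := by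
    obtain ⟨h0, hr⟩ := critical_of_isMinOn_of_neumann hθ (hwθ t ht) (hkcont t θ)
      (by positivity) (hqr t θ).2.2 (hq0 t ht) (hq1 t ht) h
    rw [hw'eq t θ h0]
    have := hρpos (X t θ)
    positivity
  have hmax (t : ℝ) (ht : 0 ≤ t) (θ : ℝ) (hθ : θ ∈ Icc (0 : ℝ) 1) (hp : 0 < deriv (X t) θ)
      (h : IsMaxOn (w t) (Icc 0 1) θ) : w' t θ ≤ 0 := by
    obtain ⟨h0, hr⟩ := critical_of_isMinOn_of_neumann (q := fun η => -q t η) hθ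
      (fun η hη => (hwθ t ht η hη).neg.congr_deriv (by ring)) (hkcont t θ)
      (by positivity) (hqr t θ).2.2.neg (by simp [hq0 t ht]) (by simp [hq1 t ht]) h.neg
    rw [hw'eq t θ (neg_eq_zero.1 h0)]
    have := hρpos (X t θ)
    exact mul_nonpos_of_nonneg_of_nonpos (by positivity) (neg_nonneg.1 hr)
  have htime (ε t : ℝ) : HasDerivAt (fun s : ℝ => ε * (1 + s)) ε t :=
    (((hasDerivAt_id t).const_add 1).const_mul ε).congr_deriv (mul_one ε)
  have hlower (t : ℝ) (ht : 0 ≤ t) (θ : ℝ) (hθ : θ ∈ Icc (0 : ℝ) 1) : lam * a1 ^ 3 ≤ w t θ := by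
    by_contra! hlt
    set m := lam * a1 ^ 3 with hm
    have hmpos : 0 < m := by positivity
    have hd : 0 < min (m - w t θ) (m / 2) := lt_min (sub_pos.2 hlt) (half_pos hmpos)
    have ht1 : 0 < 1 + t := by linarith
    set ε := min (m - w t θ) (m / 2) / (1 + t) with hε
    have hεpos : 0 < ε := div_pos hd ht1
    have hεt : ε * (1 + t) = min (m - w t θ) (m / 2) := div_mul_cancel₀ _ ht1.ne'
    have hpos := pos_of_no_first_touching (g := fun s η => w s η - m + ε * (1 + s))
      (g' := fun s η => w' s η + ε) (T := t)
      ((hwcont.sub continuous_const).add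
        (continuous_const.mul (continuous_const.add continuous_fst)))
      (fun s η => ((hwt s η).sub_const m).add (htime ε s))
      (fun η hη => by
        have h3 : a1 ^ 3 ≤ deriv (X 0) η ^ 3 := pow_le_pow_left₀ ha1.le (hinit η hη).1 3
        have : m ≤ w 0 η := mul_le_mul (hρall _).1 h3 (by positivity) (hρpos _).le
        linarith)
      (fun s hs η hη hzero hnn => by
        have hεs : ε * (1 + s) ≤ m / 2 :=
          (mul_le_mul_of_nonneg_left (by linarith [hs.2]) hεpos.le).trans
            (hεt.le.trans (min_le_right _ _))
        have hp : 0 < deriv (X s) η := hwpos s η (by linarith)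
        have := hmin s hs.1 η hη hp fun ξ hξ => by
          have := hnn ξ hξ
          simp only [mem_ofPred_eq]
          linarith
        linarith) t ⟨ht, le_rfl⟩ θ hθ
    linarith [min_le_left (m - w t θ) (m / 2)]
  have hppos (t : ℝ) (ht : 0 ≤ t) (θ : ℝ) (hθ : θ ∈ Icc (0 : ℝ) 1) : 0 < deriv (X t) θ :=
    hwpos t θ (lt_of_lt_of_le (by positivity) (hlower t ht θ hθ))
  have hupper (t : ℝ) (ht : 0 ≤ t) (θ : ℝ) (hθ : θ ∈ Icc (0 : ℝ) 1) :
      w t θ ≤ 1 / lam * A1 ^ 3 := by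
    by_contra! hlt
    set M := 1 / lam * A1 ^ 3 with hM
    have ht1 : 0 < 1 + t := by linarith
    set ε := (w t θ - M) / (1 + t) with hε
    have hεpos : 0 < ε := div_pos (sub_pos.2 hlt) ht1
    have hεt : ε * (1 + t) = w t θ - M := div_mul_cancel₀ _ ht1.ne'
    have hpos := pos_of_no_first_touching (g := fun s η => M - w s η + ε * (1 + s))
      (g' := fun s η => -w' s η + ε) (T := t)
      ((continuous_const.sub hwcont).add
        (continuous_const.mul (continuous_const.add continuous_fst)))
      (fun s η => ((hwt s η).const_sub M).add (htime ε s))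
      (fun η hη => by
        have h3 : deriv (X 0) η ^ 3 ≤ A1 ^ 3 :=
          pow_le_pow_left₀ (hppos 0 le_rfl η hη).le (hinit η hη).2 3
        have : w 0 η ≤ M := mul_le_mul (hρall _).2 h3
          (pow_pos (hppos 0 le_rfl η hη) 3).le (by positivity)
        linarith)
      (fun s hs η hη hzero hnn => by
        have := hmax s hs.1 η hη (hppos s hs.1 η hη) fun ξ hξ => by
          have := hnn ξ hξ
          simp only [mem_ofPred_eq]
          linarith
        linarith) t ⟨ht, le_rfl⟩ θ hθ
    linarith
  have hroot : (lam ^ ((2 : ℝ) / 3)) ^ 3 = lam ^ 2 := by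
    rw [← Real.rpow_natCast, ← Real.rpow_mul hlam0.le, ← Real.rpow_natCast]
    norm_num
  have hcube : StrictMono fun x : ℝ => x ^ 3 := Odd.strictMono_pow ⟨1, rfl⟩
  intro t ht θ hθ
  have hp3 : 0 < deriv (X t) θ ^ 3 := pow_pos (hppos t ht θ hθ) 3
  constructor
  · refine hcube.le_iff_le.1 ?_
    have h : lam * a1 ^ 3 ≤ 1 / lam * deriv (X t) θ ^ 3 :=
      (hlower t ht θ hθ).trans (mul_le_mul_of_nonneg_right (hρall _).2 hp3.le)
    rw [one_div_mul_eq_div, le_div_iff₀ hlam0] at h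
    simp only [mul_pow, hroot]
    linarith
  · refine hcube.le_iff_le.1 ?_
    have h : lam * deriv (X t) θ ^ 3 ≤ 1 / lam * A1 ^ 3 :=
      (mul_le_mul_of_nonneg_right (hρall _).1 hp3.le).trans (hupper t ht θ hθ)
    rw [one_div_mul_eq_div, le_div_iff₀ hlam0] at h
    simp only [div_pow, hroot]
    rw [le_div_iff₀ (by positivity)]
    linarith
end

section
/- Let X_1, X_2 be smooth solutions of ∂_t X = (1/2) ∂_θX ∂²_{θθ}X on [0,∞)×[0,1] with boundary conditions X_i(t,0)=0, X_i(t,1)=1, and suppose ∂_θX_i(0,θ) ≥ c > 0 for i=1,2 and all θ. Then for all t ≥ 0: ∫_0^1 |X_1(t,θ)−X_2(t,θ)|^2 dθ ≤ ( ∫_0^1 |X_1(0,θ)−X_2(0,θ)|^2 dθ ) e^{−4ct}. -/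
open MeasureTheory Set Filter Topology

/-! ### Calculus preliminaries -/

theorem IsLocalMax.deriv_deriv_nonpos {f : ℝ → ℝ} {a : ℝ} (h : IsLocalMax f a)
    (hc : ContinuousAt f a) : deriv (deriv f) a ≤ 0 := by
  by_contra! hpos
  have hmin : IsLocalMin f a := isLocalMin_of_deriv_deriv_pos hpos h.deriv_eq_zero hc
  have hconst : f =ᶠ[𝓝 a] fun _ => f a := by
    filter_upwards [h, hmin] with x hx hx'
    exact le_antisymm hx hx'
  have h2 : deriv (deriv f) a = deriv (deriv fun _ => f a) a := hconst.deriv.deriv_eq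
  simp at h2
  linarith

theorem ContDiff.differentiable_deriv_of_two {f : ℝ → ℝ} (hf : ContDiff ℝ 2 f) :
    Differentiable ℝ (deriv f) :=
  (contDiff_succ_iff_deriv.1 (show ContDiff ℝ (1 + 1) f from hf)).2.2.differentiable one_ne_zero

theorem ContDiff.continuous_deriv_deriv_of_two {f : ℝ → ℝ} (hf : ContDiff ℝ 2 f) :
    Continuous (deriv (deriv f)) :=
  (contDiff_succ_iff_deriv.1 (show ContDiff ℝ (1 + 1) f from hf)).2.2.continuous_deriv le_rfl

theorem ContDiff.differentiable_of_two {f : ℝ → ℝ} (hf : ContDiff ℝ 2 f) : Differentiable ℝ f :=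
  hf.differentiable two_ne_zero

/-- The first and second derivative tests at a local maximum of a difference. -/
theorem IsLocalMax.deriv_eq_and_deriv_deriv_le {f g : ℝ → ℝ} (hf : ContDiff ℝ 2 f)
    (hg : ContDiff ℝ 2 g) {a : ℝ} (h : IsLocalMax (fun θ => f θ - g θ) a) :
    deriv f a = deriv g a ∧ deriv (deriv f) a ≤ deriv (deriv g) a := by
  have hd : deriv (fun θ => f θ - g θ) = fun θ => deriv f θ - deriv g θ := by
    funext θ
    exact deriv_fun_sub (hf.differentiable_of_two θ) (hg.differentiable_of_two θ)
  have h1 := h.deriv_eq_zero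
  have h2 := h.deriv_deriv_nonpos
    (hf.continuous.continuousAt.sub hg.continuous.continuousAt)
  rw [hd] at h1 h2
  rw [deriv_fun_sub (hf.differentiable_deriv_of_two a) (hg.differentiable_deriv_of_two a)] at h2
  exact ⟨by linarith, by linarith⟩

theorem HasDerivAt.nonneg_of_left_max {g : ℝ → ℝ} {d r s : ℝ} (hsr : s < r)
    (hg : HasDerivAt g d r) (hmax : ∀ x ∈ Icc s r, g x ≤ g r) : 0 ≤ d := by
  have h : Tendsto (slope g r) (𝓝[<] r) (𝓝 d) :=
    (hasDerivWithinAt_iff_tendsto_slope' self_notMem_Iio).1 hg.hasDerivWithinAt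
  refine ge_of_tendsto h ?_
  filter_upwards [Ioo_mem_nhdsLT hsr] with x hx
  rw [slope_def_field]
  exact div_nonneg_of_nonpos (by linarith [hmax x ⟨hx.1.le, hx.2.le⟩]) (by linarith [hx.2])

/-- An abstract maximum principle: a family of functions of time that starts nonpositive, and whose
time derivative is nonpositive at every positive spatial maximum, stays nonpositive. -/
theorem nonpos_of_deriv_nonpos_at_max {P : Type*} [TopologicalSpace P] {C : Set P}
    (hC : IsCompact C) {F : ℝ → P → ℝ} {s t : ℝ} (hst : s ≤ t)
    (hF : ContinuousOn (fun z : ℝ × P => F z.1 z.2) (Icc s t ×ˢ C))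
    (h0 : ∀ p ∈ C, F s p ≤ 0)
    (hd : ∀ r ∈ Icc s t, ∀ p ∈ C, 0 < F r p → (∀ q ∈ C, F r q ≤ F r p) →
      ∃ d ≤ 0, HasDerivAt (fun r => F r p) d r) :
    ∀ p ∈ C, F t p ≤ 0 := by
  intro p₀ hp₀
  by_contra! hpos
  obtain ⟨ε, hε, hε'⟩ : ∃ ε > 0, 0 < F t p₀ - ε * (t - s) := by
    refine ⟨F t p₀ / (2 * (t - s + 1)), by have : 0 ≤ t - s := by linarith
                                           positivity, ?_⟩
    have h1 : 0 < t - s + 1 := by linarith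
    rw [sub_pos, div_mul_eq_mul_div, div_lt_iff₀ (by positivity)]
    nlinarith
  have hG : ContinuousOn (fun z : ℝ × P => F z.1 z.2 - ε * (z.1 - s)) (Icc s t ×ˢ C) :=
    hF.sub (by fun_prop)
  obtain ⟨⟨r, p⟩, ⟨hr, hp⟩, hmax⟩ := (isCompact_Icc.prod hC).exists_isMaxOn
    ⟨(t, p₀), ⟨⟨hst, le_rfl⟩, hp₀⟩⟩ hG
  have hmax' : ∀ r' ∈ Icc s t, ∀ q ∈ C, F r' q - ε * (r' - s) ≤ F r p - ε * (r - s) :=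
    fun r' hr' q hq => hmax (show (r', q) ∈ Icc s t ×ˢ C from ⟨hr', hq⟩)
  have hr1 : s ≤ r := hr.1
  have hFpos : 0 < F r p := by
    have := hmax' t ⟨hst, le_rfl⟩ p₀ hp₀
    nlinarith
  have hsr : s < r := by
    refine lt_of_le_of_ne hr1 fun h => ?_
    subst h
    exact absurd (h0 p hp) (not_le.2 hFpos)
  obtain ⟨d, hd0, hder⟩ := hd r hr p hp hFpos fun q hq => by linarith [hmax' r hr q hq]
  have hder' : HasDerivAt (fun x => F x p - ε * (x - s)) (d - ε * 1) r :=
    hder.sub (((hasDerivAt_id r).sub_const s).const_mul ε)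
  have := hder'.nonneg_of_left_max hsr fun x hx => hmax' x ⟨hx.1, hx.2.trans hr.2⟩ p hp
  linarith

/-- A family of functions that is separately continuous, and monotone in the second variable after
subtracting a fixed linear function, is jointly continuous. -/
theorem continuousOn_prod_of_monotoneOn {X : ℝ → ℝ → ℝ} {J : Set ℝ} {k : ℝ}
    (hmono : ∀ r ∈ J, MonotoneOn (fun θ => X r θ - k * θ) (Icc 0 1))
    (hθ : ∀ r ∈ J, Continuous (X r)) (ht : ∀ θ ∈ Icc (0 : ℝ) 1, ContinuousOn (fun r => X r θ) J) :
    ContinuousOn (fun z : ℝ × ℝ => X z.1 z.2) (J ×ˢ Icc 0 1) := by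
  have key : ContinuousOn (fun z : ℝ × ℝ => X z.1 (projIcc 0 1 zero_le_one z.2)
      - k * (projIcc 0 1 zero_le_one z.2 : ℝ)) (J ×ˢ Icc 0 1) := by
    set v : ℝ → ℝ → ℝ := fun r θ => X r (projIcc 0 1 zero_le_one θ)
      - k * (projIcc 0 1 zero_le_one θ : ℝ) with hv
    have vmono : ∀ r ∈ J, Monotone (v r) := fun r hr a b hab =>
      hmono r hr (projIcc 0 1 zero_le_one a).2 (projIcc 0 1 zero_le_one b).2
        (monotone_projIcc zero_le_one hab)
    have vcont : ∀ r ∈ J, Continuous (v r) := fun r hr => by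
      have := hθ r hr
      have h2 : Continuous fun θ : ℝ => (projIcc (0 : ℝ) 1 zero_le_one θ : ℝ) :=
        continuous_subtype_val.comp continuous_projIcc
      exact (this.comp h2).sub (continuous_const.mul h2)
    have vt : ∀ θ, ContinuousOn (fun r => v r θ) J := fun θ =>
      (ht _ (projIcc 0 1 zero_le_one θ).2).sub continuousOn_const
    rintro ⟨r₀, θ₀⟩ ⟨hr₀, -⟩
    change Tendsto (fun z : ℝ × ℝ => v z.1 z.2) (𝓝[J ×ˢ Icc 0 1] (r₀, θ₀)) (𝓝 (v r₀ θ₀))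
    have hfst : Tendsto Prod.fst (𝓝[J ×ˢ Icc (0 : ℝ) 1] (r₀, θ₀)) (𝓝[J] r₀) := by
      rw [nhdsWithin_prod_eq]
      exact tendsto_fst
    have hsnd : Tendsto Prod.snd (𝓝[J ×ˢ Icc (0 : ℝ) 1] (r₀, θ₀)) (𝓝 θ₀) := by
      rw [nhdsWithin_prod_eq]
      exact tendsto_snd.mono_right nhdsWithin_le_nhds
    refine tendsto_order.2 ⟨fun a ha => ?_, fun a ha => ?_⟩
    · have h1 : ∀ᶠ θ in 𝓝[<] θ₀, a < v r₀ θ :=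
        nhdsWithin_le_nhds ((vcont r₀ hr₀).continuousAt.eventually_const_lt ha)
      obtain ⟨θ₁, hθ₁, hlt⟩ := (h1.and self_mem_nhdsWithin).exists
      have h2 := hfst.eventually ((vt θ₁ r₀ hr₀).eventually_const_lt hθ₁)
      filter_upwards [h2, hsnd.eventually (lt_mem_nhds hlt), self_mem_nhdsWithin] with z hz hz' hzJ
      exact lt_of_lt_of_le hz (vmono z.1 hzJ.1 (le_of_lt hz'))
    · have h1 : ∀ᶠ θ in 𝓝[>] θ₀, v r₀ θ < a :=
        nhdsWithin_le_nhds ((vcont r₀ hr₀).continuousAt.eventually_lt_const ha)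
      obtain ⟨θ₁, hθ₁, hlt⟩ := (h1.and self_mem_nhdsWithin).exists
      have h2 := hfst.eventually ((vt θ₁ r₀ hr₀).eventually_lt_const hθ₁)
      filter_upwards [h2, hsnd.eventually (gt_mem_nhds hlt), self_mem_nhdsWithin] with z hz hz' hzJ
      exact lt_of_le_of_lt (vmono z.1 hzJ.1 (le_of_lt hz')) hz
  have h3 : ContinuousOn (fun z : ℝ × ℝ => X z.1 z.2 - k * z.2) (J ×ˢ Icc 0 1) := by
    refine key.congr fun z hz => ?_
    simp only [projIcc_of_mem zero_le_one hz.2]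
  have h4 : ContinuousOn (fun z : ℝ × ℝ => k * z.2) (J ×ˢ Icc 0 1) := by fun_prop
  exact (h3.add h4).congr fun z _ => by simp

/-- A `C²` function has a global slope bound on the unit interval. -/
theorem ContDiff.exists_monotoneOn_sub {f : ℝ → ℝ} (hf : ContDiff ℝ 2 f) :
    ∃ K : ℝ, ∀ k, K ≤ k → MonotoneOn (fun θ => f θ - (-k) * θ) (Icc 0 1) ∧
      MonotoneOn (fun θ => -f θ - (-k) * θ) (Icc 0 1) := by
  obtain ⟨K, hK⟩ := isCompact_Icc.exists_bound_of_continuousOn (s := Icc (0 : ℝ) 1)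
    (hf.continuous_deriv one_le_two).continuousOn
  refine ⟨K, fun k hk => ⟨?_, ?_⟩⟩
  · refine monotoneOn_of_deriv_nonneg (convex_Icc 0 1)
      (hf.continuous.sub (by fun_prop)).continuousOn
      (hf.differentiable_of_two.sub (by fun_prop)).differentiableOn fun x hx => ?_
    have h1 : HasDerivAt (fun θ => f θ - (-k) * θ) (deriv f x - (-k) * 1) x :=
      (hf.differentiable_of_two x).hasDerivAt.sub ((hasDerivAt_id x).const_mul _)
    rw [h1.deriv]
    have := (abs_le.1 (hK x (interior_subset hx))).1
    linarith
  · refine monotoneOn_of_deriv_nonneg (convex_Icc 0 1)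
      (hf.continuous.neg.sub (by fun_prop)).continuousOn
      (hf.differentiable_of_two.neg.sub (by fun_prop)).differentiableOn fun x hx => ?_
    have h1 : HasDerivAt (fun θ => -f θ - (-k) * θ) (-deriv f x - (-k) * 1) x :=
      (hf.differentiable_of_two x).hasDerivAt.neg.sub ((hasDerivAt_id x).const_mul _)
    rw [h1.deriv]
    have := (abs_le.1 (hK x (interior_subset hx))).2
    linarith

/-! ### Solutions of the gradient flow on a time interval -/

/-- Pointwise solutions of `∂ₜX = (1/2) ∂_θX ∂²_θθX` on `[s, t] × [0, 1]`, of class `C²` in space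
at each time and with boundary values of zero velocity. No joint regularity is assumed. -/
structure IsSlopeFlow (X : ℝ → ℝ → ℝ) (s t : ℝ) : Prop where
  smooth : ∀ r ∈ Icc s t, ContDiff ℝ 2 (X r)
  pde : ∀ r ∈ Icc s t, ∀ θ ∈ Icc (0 : ℝ) 1,
    HasDerivAt (fun r => X r θ) ((1 / 2) * deriv (X r) θ * deriv (deriv (X r)) θ) r
  left : ∀ r ∈ Icc s t, deriv (X r) 0 * deriv (deriv (X r)) 0 = 0
  right : ∀ r ∈ Icc s t, deriv (X r) 1 * deriv (deriv (X r)) 1 = 0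

namespace IsSlopeFlow

variable {X : ℝ → ℝ → ℝ} {s t : ℝ}

theorem mono (h : IsSlopeFlow X s t) {s' t' : ℝ} (hs : s ≤ s') (ht : t' ≤ t) :
    IsSlopeFlow X s' t' :=
  ⟨fun r hr => h.smooth r (Icc_subset_Icc hs ht hr), fun r hr => h.pde r (Icc_subset_Icc hs ht hr),
    fun r hr => h.left r (Icc_subset_Icc hs ht hr), fun r hr => h.right r (Icc_subset_Icc hs ht hr)⟩

theorem continuousOn_time (h : IsSlopeFlow X s t) {θ : ℝ} (hθ : θ ∈ Icc (0 : ℝ) 1) :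
    ContinuousOn (fun r => X r θ) (Icc s t) :=
  fun r hr => (h.pde r hr θ hθ).continuousAt.continuousWithinAt

/-- The equation is invariant under simultaneous reversal of time and sign. -/
theorem reverse (h : IsSlopeFlow X s t) : IsSlopeFlow (fun r θ => -X (-r) θ) (-t) (-s) := by
  have hmem : ∀ r ∈ Icc (-t) (-s), -r ∈ Icc s t := fun r hr =>
    ⟨by linarith [hr.2], by linarith [hr.1]⟩
  have hd : ∀ r, deriv (fun θ => -X (-r) θ) = fun θ => -deriv (X (-r)) θ := fun r => by
    funext θ
    exact deriv.fun_neg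
  have hdd : ∀ r, deriv (deriv (fun θ => -X (-r) θ)) = fun θ => -deriv (deriv (X (-r))) θ :=
    fun r => by
      rw [hd]
      funext θ
      exact deriv.fun_neg
  refine ⟨fun r hr => (h.smooth _ (hmem r hr)).neg, fun r hr θ hθ => ?_, fun r hr => ?_,
    fun r hr => ?_⟩
  · rw [hdd, hd]
    have h1 := (h.pde _ (hmem r hr) θ hθ).scomp r (hasDerivAt_neg r)
    refine h1.neg.congr_deriv ?_
    simp
  · rw [hdd, hd]
    simpa using h.left _ (hmem r hr)
  · rw [hdd, hd]
    simpa using h.right _ (hmem r hr)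

/-- The velocity at the left end of a maximal drop of `X r θ - k * θ`. -/
theorem exists_velocity_left (h : IsSlopeFlow X s t) {r : ℝ} (hr : r ∈ Icc s t) {a b k : ℝ}
    (ha : 0 ≤ a) (hab : a < b)
    (hmax : ∀ a' ∈ Icc 0 b, X r a' - k * a' ≤ X r a - k * a) :
    ∃ m ≤ 0, deriv (X r) a * deriv (deriv (X r)) a = k * m := by
  rcases ha.eq_or_lt with rfl | ha
  · exact ⟨0, le_rfl, by simpa using h.left r hr⟩
  · have hloc : IsLocalMax (fun θ => X r θ - k * θ) a := by
      filter_upwards [Icc_mem_nhds ha hab] with x hx using hmax x hx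
    obtain ⟨h1, h2⟩ := hloc.deriv_eq_and_deriv_deriv_le (h.smooth r hr) (by fun_prop)
    have h3 : deriv (fun θ : ℝ => k * θ) = fun _ => k := by funext θ; simp
    rw [h3] at h1 h2
    exact ⟨_, by simpa using h2, by rw [h1]⟩

/-- The velocity at the right end of a maximal drop of `X r θ - k * θ`. -/
theorem exists_velocity_right (h : IsSlopeFlow X s t) {r : ℝ} (hr : r ∈ Icc s t) {a b k : ℝ}
    (hb : b ≤ 1) (hab : a < b)
    (hmin : ∀ b' ∈ Icc a 1, X r b - k * b ≤ X r b' - k * b') :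
    ∃ m, 0 ≤ m ∧ deriv (X r) b * deriv (deriv (X r)) b = k * m := by
  rcases hb.eq_or_lt with rfl | hb
  · exact ⟨0, le_rfl, by simpa using h.right r hr⟩
  · have hloc : IsLocalMax (fun θ => k * θ - X r θ) b := by
      filter_upwards [Icc_mem_nhds hab hb] with x hx
      linarith [hmin x hx]
    obtain ⟨h1, h2⟩ := hloc.deriv_eq_and_deriv_deriv_le (by fun_prop) (h.smooth r hr)
    have h3 : deriv (fun θ : ℝ => k * θ) = fun _ => k := by funext θ; simp
    rw [h3] at h1 h2
    exact ⟨_, by simpa using h2, by rw [← h1]⟩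

/-- The time derivative of a positive maximal drop of `X r θ - k * θ` has the sign of `-k`. -/
theorem exists_hasDerivAt_drop (h : IsSlopeFlow X s t) {r : ℝ} (hr : r ∈ Icc s t) {a b k : ℝ}
    (ha : a ∈ Icc (0 : ℝ) 1) (hb : b ∈ Icc (0 : ℝ) 1) (hab : a ≤ b)
    (hpos : 0 < (X r a - k * a) - (X r b - k * b))
    (hmax : ∀ a' ∈ Icc (0 : ℝ) 1, ∀ b' ∈ Icc (0 : ℝ) 1, a' ≤ b' →
      (X r a' - k * a') - (X r b' - k * b') ≤ (X r a - k * a) - (X r b - k * b)) :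
    ∃ m ≤ 0, HasDerivAt (fun r => (X r a - k * a) - (X r b - k * b)) (k * m) r := by
  have hab' : a < b := by
    refine lt_of_le_of_ne hab ?_
    rintro rfl
    simp at hpos
  obtain ⟨m, hm, hma⟩ := h.exists_velocity_left hr ha.1 hab' (k := k) fun a' ha' => by
    linarith [hmax a' ⟨ha'.1, ha'.2.trans hb.2⟩ b hb ha'.2]
  obtain ⟨m', hm', hmb⟩ := h.exists_velocity_right hr hb.2 hab' (k := k) fun b' hb' => by
    linarith [hmax a ha b' ⟨ha.1.trans hb'.1, hb'.2⟩ hb'.1]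
  refine ⟨(m - m') / 2, by linarith, ?_⟩
  refine (((h.pde r hr a ha).sub_const _).sub ((h.pde r hr b hb).sub_const _)).congr_deriv ?_
  linear_combination (1 / 2) * hma - (1 / 2) * hmb

theorem continuousOn_drop {J : Set ℝ} (k : ℝ)
    (hc : ContinuousOn (fun z : ℝ × ℝ => X z.1 z.2) (J ×ˢ Icc 0 1)) :
    ContinuousOn (fun z : ℝ × (ℝ × ℝ) => (X z.1 z.2.1 - k * z.2.1) - (X z.1 z.2.2 - k * z.2.2))
      (J ×ˢ ((Icc (0 : ℝ) 1 ×ˢ Icc (0 : ℝ) 1) ∩ {p : ℝ × ℝ | p.1 ≤ p.2})) := by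
  have h1 := hc.comp (f := fun z : ℝ × (ℝ × ℝ) => (z.1, z.2.1))
    (s := J ×ˢ ((Icc (0 : ℝ) 1 ×ˢ Icc (0 : ℝ) 1) ∩ {p : ℝ × ℝ | p.1 ≤ p.2}))
    (by fun_prop) fun z hz => ⟨hz.1, hz.2.1.1⟩
  have h2 := hc.comp (f := fun z : ℝ × (ℝ × ℝ) => (z.1, z.2.2))
    (s := J ×ˢ ((Icc (0 : ℝ) 1 ×ˢ Icc (0 : ℝ) 1) ∩ {p : ℝ × ℝ | p.1 ≤ p.2}))
    (by fun_prop) fun z hz => ⟨hz.1, hz.2.1.2⟩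
  exact (h1.sub (by fun_prop)).sub (h2.sub (by fun_prop))

theorem isCompact_ordered_pairs :
    IsCompact ((Icc (0 : ℝ) 1 ×ˢ Icc (0 : ℝ) 1) ∩ {p : ℝ × ℝ | p.1 ≤ p.2}) :=
  (isCompact_Icc.prod isCompact_Icc).inter_right (isClosed_le continuous_fst continuous_snd)

/-- Nonnegative lower slope bounds propagate forward in time along continuous solutions. -/
theorem monotoneOn_forward (h : IsSlopeFlow X s t) (hst : s ≤ t)
    (hc : ContinuousOn (fun z : ℝ × ℝ => X z.1 z.2) (Icc s t ×ˢ Icc 0 1)) {k : ℝ} (hk : 0 ≤ k)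
    (hs : MonotoneOn (fun θ => X s θ - k * θ) (Icc 0 1)) :
    MonotoneOn (fun θ => X t θ - k * θ) (Icc 0 1) := by
  intro a ha b hb hab
  have := nonpos_of_deriv_nonpos_at_max isCompact_ordered_pairs
    (F := fun r p => (X r p.1 - k * p.1) - (X r p.2 - k * p.2)) hst (continuousOn_drop k hc)
    (fun p hp => by
      have := hs hp.1.1 hp.1.2 hp.2
      simp only at this
      linarith)
    (fun r hr p hp hpos hmax => by
      obtain ⟨m, hm, hd⟩ := h.exists_hasDerivAt_drop hr hp.1.1 hp.1.2 hp.2 hpos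
        fun a' ha' b' hb' hab' => hmax (a', b') ⟨⟨ha', hb'⟩, hab'⟩
      exact ⟨_, mul_nonpos_of_nonneg_of_nonpos hk hm, hd⟩) (a, b) ⟨⟨ha, hb⟩, hab⟩
  simp only at this ⊢
  linarith

/-- Nonpositive lower slope bounds propagate backward in time along continuous solutions. -/
theorem monotoneOn_backward (h : IsSlopeFlow X s t) (hst : s ≤ t)
    (hc : ContinuousOn (fun z : ℝ × ℝ => X z.1 z.2) (Icc s t ×ˢ Icc 0 1)) {k : ℝ} (hk : k ≤ 0)
    (ht : MonotoneOn (fun θ => X t θ - k * θ) (Icc 0 1)) :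
    MonotoneOn (fun θ => X s θ - k * θ) (Icc 0 1) := by
  intro a ha b hb hab
  have hmem : ∀ r ∈ Icc (-t) (-s), -r ∈ Icc s t := fun r hr =>
    ⟨by linarith [hr.2], by linarith [hr.1]⟩
  have := nonpos_of_deriv_nonpos_at_max isCompact_ordered_pairs
    (F := fun r p => (X (-r) p.1 - k * p.1) - (X (-r) p.2 - k * p.2)) (neg_le_neg hst)
    ((continuousOn_drop k hc).comp (f := fun z : ℝ × (ℝ × ℝ) => (-z.1, z.2)) (by fun_prop)
      fun z hz => ⟨hmem _ hz.1, hz.2⟩)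
    (fun p hp => by
      have := ht hp.1.1 hp.1.2 hp.2
      simp only [neg_neg] at this ⊢
      linarith)
    (fun r hr p hp hpos hmax => by
      obtain ⟨m, hm, hd⟩ := h.exists_hasDerivAt_drop (hmem r hr) hp.1.1 hp.1.2 hp.2 hpos
        fun a' ha' b' hb' hab' => hmax (a', b') ⟨⟨ha', hb'⟩, hab'⟩
      refine ⟨-(k * m), neg_nonpos.2 (mul_nonneg_of_nonpos_of_nonpos hk hm), ?_⟩
      refine (hd.scomp r (hasDerivAt_neg r)).congr_deriv ?_
      simp) (a, b) ⟨⟨ha, hb⟩, hab⟩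
  simp only [neg_neg] at this ⊢
  linarith

theorem continuousOn_reverse
    (hc : ContinuousOn (fun z : ℝ × ℝ => X z.1 z.2) (Icc s t ×ˢ Icc 0 1)) :
    ContinuousOn (fun z : ℝ × ℝ => -X (-z.1) z.2) (Icc (-t) (-s) ×ˢ Icc 0 1) :=
  (hc.comp (f := fun z : ℝ × ℝ => (-z.1, z.2)) (by fun_prop)
    fun z hz => ⟨⟨by linarith [hz.1.2], by linarith [hz.1.1]⟩, hz.2⟩).neg

/-- Upper slope bounds propagate forward in time along continuous solutions. -/
theorem monotoneOn_neg_forward (h : IsSlopeFlow X s t) (hst : s ≤ t)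
    (hc : ContinuousOn (fun z : ℝ × ℝ => X z.1 z.2) (Icc s t ×ˢ Icc 0 1)) {k : ℝ} (hk : k ≤ 0)
    (hs : MonotoneOn (fun θ => -X s θ - k * θ) (Icc 0 1)) :
    MonotoneOn (fun θ => -X t θ - k * θ) (Icc 0 1) := by
  have := h.reverse.monotoneOn_backward (neg_le_neg hst) (continuousOn_reverse hc) hk
    (by simpa using hs)
  simpa using this

/-! ### Joint continuity -/

/-- Joint continuity extends to the right end of a time interval, because upper slope bounds
propagate forward. -/
theorem continuousOn_of_Ico (h : IsSlopeFlow X s t) (hst : s < t)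
    (hc : ContinuousOn (fun z : ℝ × ℝ => X z.1 z.2) (Ico s t ×ˢ Icc 0 1)) :
    ContinuousOn (fun z : ℝ × ℝ => X z.1 z.2) (Icc s t ×ˢ Icc 0 1) := by
  obtain ⟨K, hK⟩ := (h.smooth s ⟨le_rfl, hst.le⟩).exists_monotoneOn_sub
  set k := max K 0
  have hbefore : ∀ r ∈ Ico s t, MonotoneOn (fun θ => -X r θ - (-k) * θ) (Icc 0 1) := fun r hr =>
    (h.mono le_rfl hr.2.le).monotoneOn_neg_forward hr.1
      (hc.mono (prod_mono (Icc_subset_Ico_right hr.2) Subset.rfl))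
      (neg_nonpos.2 (le_max_right _ _)) (hK k (le_max_left _ _)).2
  have hend : MonotoneOn (fun θ => -X t θ - (-k) * θ) (Icc 0 1) := by
    intro a ha b hb hab
    have hlim : ∀ θ ∈ Icc (0 : ℝ) 1,
        Tendsto (fun r => -X r θ - (-k) * θ) (𝓝[<] t) (𝓝 (-X t θ - (-k) * θ)) := fun θ hθ =>
      ((((h.pde t ⟨hst.le, le_rfl⟩ θ hθ).continuousAt.tendsto).mono_left
        nhdsWithin_le_nhds).neg).sub_const _
    refine le_of_tendsto_of_tendsto (hlim a ha) (hlim b hb) ?_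
    filter_upwards [Ico_mem_nhdsLT hst] with r hr using hbefore r hr ha hb hab
  have hneg := continuousOn_prod_of_monotoneOn (X := fun r θ => -X r θ) (J := Icc s t) (k := -k)
    (fun r hr => hr.2.eq_or_lt.elim (fun hrt => hrt ▸ hend) fun hrt => hbefore r ⟨hr.1, hrt⟩)
    (fun r hr => (h.smooth r hr).continuous.neg) fun θ hθ => (h.continuousOn_time hθ).neg
  exact hneg.neg.congr fun z _ => (neg_neg _).symm

/-- A lower slope bound on a closed set of times containing all joint discontinuities extends to
every earlier time. -/
theorem monotoneOn_of_singular (h : IsSlopeFlow X s t) {E : Set ℝ} (hE : IsClosed E)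
    (hreg : ∀ r ∈ Icc s t, r ∉ E → ∀ θ ∈ Icc (0 : ℝ) 1,
      ContinuousWithinAt (fun z : ℝ × ℝ => X z.1 z.2) (Icc s t ×ˢ Icc 0 1) (r, θ))
    {r e k : ℝ} (hsr : s ≤ r) (hre : r ≤ e) (het : e ≤ t) (he : e ∈ E) (hk : k ≤ 0)
    (hslope : ∀ x ∈ E, x ∈ Icc r e → MonotoneOn (fun θ => X x θ - k * θ) (Icc 0 1)) :
    MonotoneOn (fun θ => X r θ - k * θ) (Icc 0 1) := by
  have hbdd : BddBelow (E ∩ Icc r e) := ⟨r, fun x hx => hx.2.1⟩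
  have hbE : sInf (E ∩ Icc r e) ∈ E ∩ Icc r e :=
    (hE.inter isClosed_Icc).csInf_mem ⟨e, he, hre, le_rfl⟩ hbdd
  set b := sInf (E ∩ Icc r e)
  have hbslope := hslope b hbE.1 hbE.2
  rcases hbE.2.1.eq_or_lt with hrb | hrb
  · rwa [← hrb] at hbslope
  · have hsub : IsSlopeFlow X r b := h.mono hsr (hbE.2.2.trans het)
    have hc : ContinuousOn (fun z : ℝ × ℝ => X z.1 z.2) (Ico r b ×ˢ Icc 0 1) := by
      rintro ⟨x, θ⟩ ⟨hx, hθ⟩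
      have hx' : x < b := hx.2
      have hxE : x ∉ E := fun hxE =>
        absurd (csInf_le hbdd ⟨hxE, hx.1, hx'.le.trans hbE.2.2⟩) (not_le.2 hx')
      refine (hreg x ⟨hsr.trans hx.1, hx'.le.trans (hbE.2.2.trans het)⟩ hxE θ hθ).mono
        (prod_mono (fun y hy => ?_) Subset.rfl)
      exact ⟨hsr.trans hy.1, hy.2.le.trans (hbE.2.2.trans het)⟩
    exact hsub.monotoneOn_backward hrb.le (hsub.continuousOn_of_Ico hrb hc) hk hbslope

/-- Solutions that are merely separately regular are jointly continuous. -/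
theorem continuousOn (h : IsSlopeFlow X s t) :
    ContinuousOn (fun z : ℝ × ℝ => X z.1 z.2) (Icc s t ×ˢ Icc 0 1) := by
  by_contra hdisc
  set N : Set ℝ := {r | r ∈ Icc s t ∧ ∃ θ ∈ Icc (0 : ℝ) 1,
    ¬ ContinuousWithinAt (fun z : ℝ × ℝ => X z.1 z.2) (Icc s t ×ˢ Icc 0 1) (r, θ)}
  set E := closure N
  have hE : IsClosed E := isClosed_closure
  have hEsub : E ⊆ Icc s t := closure_minimal (fun r hr => hr.1) isClosed_Icc
  have hreg : ∀ r ∈ Icc s t, r ∉ E → ∀ θ ∈ Icc (0 : ℝ) 1,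
      ContinuousWithinAt (fun z : ℝ × ℝ => X z.1 z.2) (Icc s t ×ˢ Icc 0 1) (r, θ) := by
    intro r hr hrE θ hθ
    by_contra hcon
    exact hrE (subset_closure ⟨hr, θ, hθ, hcon⟩)
  have hne : Nonempty E := by
    simp only [ContinuousOn, not_forall] at hdisc
    obtain ⟨⟨r, θ⟩, ⟨hr, hθ⟩, hcon⟩ := hdisc
    exact ⟨r, subset_closure ⟨hr, θ, hθ, hcon⟩⟩
  have : CompactSpace E := isCompact_iff_compactSpace.1 (isCompact_Icc.of_isClosed_subset hE hEsub)
  have htime : ∀ θ ∈ Icc (0 : ℝ) 1, Continuous fun x : E => X x θ := fun θ hθ =>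
    continuousOn_iff_continuous_domRestrict.1 ((h.continuousOn_time hθ).mono hEsub)
  set f : ℕ → Set E := fun n => {x | ∀ a ∈ Icc (0 : ℝ) 1, ∀ b ∈ Icc (0 : ℝ) 1, a ≤ b →
    X x a - (-(n : ℝ)) * a ≤ X x b - (-(n : ℝ)) * b ∧
    -X x a - (-(n : ℝ)) * a ≤ -X x b - (-(n : ℝ)) * b} with hf
  have hclosed : ∀ n, IsClosed (f n) := by
    intro n
    simp only [hf, ofPred_forall]
    refine isClosed_iInter fun a => isClosed_iInter fun ha => isClosed_iInter fun b =>
      isClosed_iInter fun hb => isClosed_iInter fun _ => ?_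
    have h1 : IsClosed {x : E | X x a - (-(n : ℝ)) * a ≤ X x b - (-(n : ℝ)) * b} :=
      isClosed_le ((htime a ha).sub continuous_const) ((htime b hb).sub continuous_const)
    have h2 : IsClosed {x : E | -X x a - (-(n : ℝ)) * a ≤ -X x b - (-(n : ℝ)) * b} :=
      isClosed_le ((htime a ha).neg.sub continuous_const) ((htime b hb).neg.sub continuous_const)
    exact h1.inter h2
  have hcover : ⋃ n, f n = univ := by
    refine eq_univ_of_forall fun x => mem_iUnion.2 ?_
    obtain ⟨K, hK⟩ := (h.smooth x (hEsub x.2)).exists_monotoneOn_sub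
    obtain ⟨n, hn⟩ := exists_nat_ge K
    exact ⟨n, fun a ha b hb hab => ⟨(hK n hn).1 ha hb hab, (hK n hn).2 ha hb hab⟩⟩
  obtain ⟨n, x, hx⟩ := nonempty_interior_of_iUnion_of_closed hclosed hcover
  obtain ⟨δ, hδ, hball⟩ := Metric.isOpen_iff.1 isOpen_interior x hx
  obtain ⟨e, heN, hxe⟩ := Metric.mem_closure_iff.1 x.2 δ hδ
  have heE : e ∈ E := subset_closure heN
  obtain ⟨ρ, hρ, hρ'⟩ : ∃ ρ > 0, ρ + dist (x : ℝ) e < δ :=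
    ⟨(δ - dist (x : ℝ) e) / 2, by linarith, by linarith⟩
  have hn0 : -(n : ℝ) ≤ 0 := by simp
  have hgood : ∀ y, ∀ hy : y ∈ E, y ∈ Icc (e - ρ) (e + ρ) → (⟨y, hy⟩ : E) ∈ f n := by
    intro y hy hye
    refine interior_subset (hball ?_)
    have h1 : dist y e ≤ ρ := by
      rw [Real.dist_eq, abs_le]
      exact ⟨by linarith [hye.1], by linarith [hye.2]⟩
    have h2 : dist y (x : ℝ) ≤ dist y e + dist e (x : ℝ) := dist_triangle _ _ _
    rw [dist_comm e] at h2
    exact Metric.mem_ball.2 (show dist y (x : ℝ) < δ by linarith)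
  have hleft : ContinuousOn (fun z : ℝ × ℝ => X z.1 z.2)
      ((Icc s t ∩ Icc (e - ρ) e) ×ˢ Icc 0 1) := by
    refine continuousOn_prod_of_monotoneOn (k := -(n : ℝ)) (fun r hr => ?_)
      (fun r hr => (h.smooth r hr.1).continuous)
      fun θ hθ => (h.continuousOn_time hθ).mono inter_subset_left
    exact h.monotoneOn_of_singular hE hreg hr.1.1 hr.2.2 heN.1.2 heE hn0 fun y hy hyr a ha b hb hab =>
      (hgood y hy ⟨hr.2.1.trans hyr.1, by linarith [hyr.2]⟩ a ha b hb hab).1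
  have hright : ContinuousOn (fun z : ℝ × ℝ => -X z.1 z.2)
      ((Icc s t ∩ Icc e (e + ρ)) ×ˢ Icc 0 1) := by
    refine continuousOn_prod_of_monotoneOn (X := fun r θ => -X r θ) (k := -(n : ℝ)) (fun r hr => ?_)
      (fun r hr => (h.smooth r hr.1).continuous.neg)
      fun θ hθ => ((h.continuousOn_time hθ).mono inter_subset_left).neg
    have hrev := h.reverse.monotoneOn_of_singular (E := Neg.neg ⁻¹' E) (hE.preimage continuous_neg)
      (fun y hy hyE θ hθ => by
        have hy' : -y ∈ Icc s t := ⟨by linarith [hy.2], by linarith [hy.1]⟩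
        have h1 := hreg (-y) hy' hyE θ hθ
        exact (ContinuousWithinAt.comp (f := fun z : ℝ × ℝ => (-z.1, z.2)) (x := (y, θ)) h1
          (by fun_prop) fun z hz => ⟨⟨by linarith [hz.1.2], by linarith [hz.1.1]⟩, hz.2⟩).neg)
      (r := -r) (e := -e) (k := -(n : ℝ)) (by linarith [hr.1.2]) (by linarith [hr.2.1])
      (by linarith [heN.1.1]) (by simpa using heE) hn0
      fun y hy hyr a ha b hb hab =>
        (hgood (-y) hy ⟨by linarith [hyr.2], by linarith [hyr.1, hr.2.2]⟩ a ha b hb hab).2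
    simpa using hrev
  obtain ⟨hest, θ, hθ, hcon⟩ := heN
  refine hcon ?_
  have hl := hleft (e, θ) ⟨⟨hest, by linarith, le_rfl⟩, hθ⟩
  have hr := (hright (e, θ) ⟨⟨hest, le_rfl, by linarith⟩, hθ⟩).neg.congr
    (g := fun z : ℝ × ℝ => X z.1 z.2) (fun z _ => (neg_neg _).symm) (neg_neg _).symm
  refine (hl.union hr).mono_of_mem_nhdsWithin ?_
  have hnhds : {z : ℝ × ℝ | z.1 ∈ Icc (e - ρ) (e + ρ)} ∈ 𝓝 (e, θ) :=
    continuous_fst.continuousAt.preimage_mem_nhds (Icc_mem_nhds (by simpa) (by simpa))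
  filter_upwards [self_mem_nhdsWithin, mem_nhdsWithin_of_mem_nhds hnhds] with z hz hz'
  rcases le_total z.1 e with hze | hze
  · exact Or.inl ⟨⟨hz.1, hz'.1, hze⟩, hz.2⟩
  · exact Or.inr ⟨⟨hz.1, hze, hz'.2⟩, hz.2⟩

end IsSlopeFlow

/-! ### Slope bounds and Lipschitz dependence on time -/

theorem MonotoneOn.le_deriv {f : ℝ → ℝ} (hf : Differentiable ℝ f) {k : ℝ}
    (h : MonotoneOn (fun θ => f θ - k * θ) (Icc 0 1)) {θ : ℝ} (hθ : θ ∈ Icc (0 : ℝ) 1) :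
    k ≤ deriv f θ := by
  have h1 : HasDerivAt (fun θ => f θ - k * θ) (deriv f θ - k * 1) θ :=
    (hf θ).hasDerivAt.sub ((hasDerivAt_id θ).const_mul _)
  have h2 := h.derivWithin_nonneg (x := θ)
  rw [h1.hasDerivWithinAt.derivWithin (uniqueDiffOn_Icc zero_lt_one θ hθ)] at h2
  linarith

theorem monotoneOn_sub_of_le_deriv {f : ℝ → ℝ} (hf : Differentiable ℝ f) {k : ℝ}
    (h : ∀ θ ∈ Icc (0 : ℝ) 1, k ≤ deriv f θ) :
    MonotoneOn (fun θ => f θ - k * θ) (Icc 0 1) := by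
  refine monotoneOn_of_deriv_nonneg (convex_Icc 0 1) (hf.sub (by fun_prop)).continuous.continuousOn
    (hf.sub (by fun_prop)).differentiableOn fun x hx => ?_
  have h1 : HasDerivAt (fun θ => f θ - k * θ) (deriv f x - k * 1) x :=
    (hf x).hasDerivAt.sub ((hasDerivAt_id x).const_mul _)
  rw [h1.deriv]
  linarith [h x (interior_subset hx)]

/-- Comparison of a monotone subsolution `U` with a supersolution `V`. -/
theorem slopeFlow_comparison {U V : ℝ → ℝ → ℝ} {T : ℝ} (hT : 0 ≤ T)
    (hUc : ContinuousOn (fun z : ℝ × ℝ => U z.1 z.2) (Icc 0 T ×ˢ Icc 0 1))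
    (hVc : ContinuousOn (fun z : ℝ × ℝ => V z.1 z.2) (Icc 0 T ×ˢ Icc 0 1))
    (hUs : ∀ r ∈ Icc 0 T, ContDiff ℝ 2 (U r)) (hVs : ∀ r ∈ Icc 0 T, ContDiff ℝ 2 (V r))
    (hU : ∀ r ∈ Icc 0 T, ∀ θ ∈ Icc (0 : ℝ) 1, ∃ u,
      u ≤ (1 / 2) * deriv (U r) θ * deriv (deriv (U r)) θ ∧ HasDerivAt (fun r => U r θ) u r)
    (hV : ∀ r ∈ Icc 0 T, ∀ θ ∈ Icc (0 : ℝ) 1, ∃ v,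
      (1 / 2) * deriv (V r) θ * deriv (deriv (V r)) θ ≤ v ∧ HasDerivAt (fun r => V r θ) v r)
    (hUmono : ∀ r ∈ Icc 0 T, ∀ θ ∈ Icc (0 : ℝ) 1, 0 ≤ deriv (U r) θ)
    (hleft : ∀ r ∈ Icc 0 T, U r 0 ≤ V r 0) (hright : ∀ r ∈ Icc 0 T, U r 1 ≤ V r 1)
    (hinit : ∀ θ ∈ Icc (0 : ℝ) 1, U 0 θ ≤ V 0 θ) :
    ∀ θ ∈ Icc (0 : ℝ) 1, U T θ ≤ V T θ := by
  intro θ hθ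
  have := nonpos_of_deriv_nonpos_at_max isCompact_Icc (F := fun r θ => U r θ - V r θ) hT
    (hUc.sub hVc) (fun θ hθ => sub_nonpos.2 (hinit θ hθ)) (fun r hr p hp hpos hmax => by
      have hp0 : 0 < p := lt_of_le_of_ne hp.1 fun h => by
        subst h
        linarith [hleft r hr]
      have hp1 : p < 1 := lt_of_le_of_ne hp.2 fun h => by
        subst h
        linarith [hright r hr]
      have hloc : IsLocalMax (fun θ => U r θ - V r θ) p := by
        filter_upwards [Icc_mem_nhds hp0 hp1] with x hx using hmax x hx
      obtain ⟨h1, h2⟩ := hloc.deriv_eq_and_deriv_deriv_le (hUs r hr) (hVs r hr)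
      obtain ⟨u, hu, hu'⟩ := hU r hr p hp
      obtain ⟨v, hv, hv'⟩ := hV r hr p hp
      refine ⟨u - v, ?_, hu'.sub hv'⟩
      rw [← h1] at hv
      have := mul_le_mul_of_nonneg_left h2 (hUmono r hr p hp)
      linarith) θ hθ
  exact sub_nonpos.1 this

/-- A solution on `[0, ∞) × [0, 1]` with slope at least `c`, equal to `0` and `1` at the ends. -/
structure IsIncreasingFlow (X : ℝ → ℝ → ℝ) (c : ℝ) : Prop where
  flow : ∀ T, IsSlopeFlow X 0 T
  bdry : ∀ r, 0 ≤ r → X r 0 = 0 ∧ X r 1 = 1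
  slope : ∀ r, 0 ≤ r → ∀ θ ∈ Icc (0 : ℝ) 1, c ≤ deriv (X r) θ

/-- The lower bound on the initial slope is preserved. -/
theorem IsIncreasingFlow.of_initial {X : ℝ → ℝ → ℝ} {c : ℝ} (hc : 0 ≤ c)
    (hsm : ∀ t, 0 ≤ t → ContDiff ℝ 2 (X t))
    (hpde : ∀ t, 0 ≤ t → ∀ θ ∈ Icc (0 : ℝ) 1,
      HasDerivAt (fun s => X s θ) ((1 / 2) * deriv (X t) θ * deriv (deriv (X t)) θ) t)
    (hbd : ∀ t, 0 ≤ t → X t 0 = 0 ∧ X t 1 = 1)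
    (hmono : ∀ θ ∈ Icc (0 : ℝ) 1, c ≤ deriv (X 0) θ) : IsIncreasingFlow X c := by
  have hvel : ∀ θ ∈ Icc (0 : ℝ) 1, (∃ v, ∀ t, 0 ≤ t → X t θ = v) → ∀ t, 0 ≤ t →
      deriv (X t) θ * deriv (deriv (X t)) θ = 0 := by
    rintro θ hθ ⟨v, hv⟩ t ht
    have h1 : HasDerivWithinAt (fun s => X s θ) 0 (Ici 0) t :=
      (hasDerivWithinAt_const t (Ici 0) v).congr (fun s hs => hv s hs) (hv t ht)
    have := UniqueDiffWithinAt.eq_deriv (Ici 0) (uniqueDiffOn_Ici 0 t ht)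
      (hpde t ht θ hθ).hasDerivWithinAt h1
    linarith
  have hflow : ∀ T, IsSlopeFlow X 0 T := fun T =>
    ⟨fun r hr => hsm r hr.1, fun r hr => hpde r hr.1,
      fun r hr => hvel 0 (by simp) ⟨0, fun t ht => (hbd t ht).1⟩ r hr.1,
      fun r hr => hvel 1 (by simp) ⟨1, fun t ht => (hbd t ht).2⟩ r hr.1⟩
  refine ⟨hflow, hbd, fun r hr θ hθ => ?_⟩
  exact ((hflow r).monotoneOn_forward hr (hflow r).continuousOn hc
    (monotoneOn_sub_of_le_deriv (hsm 0 le_rfl).differentiable_of_two hmono)).le_deriv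
    (hsm r hr).differentiable_of_two hθ

namespace IsIncreasingFlow

variable {X : ℝ → ℝ → ℝ} {c : ℝ}

theorem smooth (h : IsIncreasingFlow X c) {r : ℝ} (hr : 0 ≤ r) : ContDiff ℝ 2 (X r) :=
  (h.flow r).smooth r ⟨hr, le_rfl⟩

theorem pde (h : IsIncreasingFlow X c) {r : ℝ} (hr : 0 ≤ r) {θ : ℝ} (hθ : θ ∈ Icc (0 : ℝ) 1) :
    HasDerivAt (fun r => X r θ) ((1 / 2) * deriv (X r) θ * deriv (deriv (X r)) θ) r :=
  (h.flow r).pde r ⟨hr, le_rfl⟩ θ hθ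

theorem mem_Icc (h : IsIncreasingFlow X c) (hc : 0 ≤ c) {r : ℝ} (hr : 0 ≤ r) {θ : ℝ}
    (hθ : θ ∈ Icc (0 : ℝ) 1) : X r θ ∈ Icc (0 : ℝ) 1 := by
  have hm := monotoneOn_sub_of_le_deriv (h.smooth hr).differentiable_of_two (k := 0)
    fun x hx => hc.trans (h.slope r hr x hx)
  have h0 := hm (left_mem_Icc.2 zero_le_one) hθ hθ.1
  have h1 := hm hθ (right_mem_Icc.2 zero_le_one) hθ.2
  simp only [zero_mul, sub_zero, (h.bdry r hr).1, (h.bdry r hr).2] at h0 h1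
  exact ⟨h0, h1⟩

/-- The velocity of a solution is bounded, uniformly in time. -/
theorem exists_velocity_bound (h : IsIncreasingFlow X c) (hc : 0 ≤ c) :
    ∃ C, 0 ≤ C ∧ ∀ t, 0 < t → ∀ θ ∈ Icc (0 : ℝ) 1,
      |(1 / 2) * deriv (X t) θ * deriv (deriv (X t)) θ| ≤ C := by
  have h0 := h.smooth le_rfl
  obtain ⟨C, hC⟩ := isCompact_Icc.exists_bound_of_continuousOn (s := Icc (0 : ℝ) 1)
    (f := fun θ => (1 / 2) * deriv (X 0) θ * deriv (deriv (X 0)) θ)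
    ((continuous_const.mul (h0.continuous_deriv one_le_two)).mul
      h0.continuous_deriv_deriv_of_two).continuousOn
  have hC0 : 0 ≤ C := (norm_nonneg _).trans (hC 0 (by simp))
  have hslope : ∀ r, 0 ≤ r → ∀ θ ∈ Icc (0 : ℝ) 1, 0 ≤ deriv (X r) θ := fun r hr θ hθ =>
    hc.trans (h.slope r hr θ hθ)
  have hcX := fun T => (h.flow T).continuousOn
  have hcX0 : ∀ T, ContinuousOn (fun z : ℝ × ℝ => X 0 z.2) (Icc 0 T ×ˢ Icc 0 1) := fun T =>
    (h0.continuous.comp continuous_snd).continuousOn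
  have hlin : ∀ (a b r : ℝ), HasDerivAt (fun r => a + b * r) b r := fun a b r =>
    (((hasDerivAt_id r).const_mul b).const_add a).congr_deriv (mul_one b)
  have hinit : ∀ k, 0 ≤ k → ∀ θ ∈ Icc (0 : ℝ) 1, X k θ ≤ X 0 θ + C * k ∧ X 0 θ + -C * k ≤ X k θ := by
    intro k hk θ hθ
    constructor
    · refine slopeFlow_comparison (U := X) (V := fun r θ => X 0 θ + C * r) hk (hcX k)
        ((hcX0 k).add (by fun_prop)) (fun r hr => h.smooth hr.1)
        (fun r _ => h0.add contDiff_const) (fun r hr θ hθ => ⟨_, le_rfl, h.pde hr.1 hθ⟩)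
        (fun r hr θ hθ => ⟨C, ?_, hlin _ _ _⟩) (fun r hr => hslope r hr.1) (fun r hr => ?_)
        (fun r hr => ?_) (fun θ hθ => by simp) θ hθ
      · simpa [deriv_add_const'] using (abs_le.1 (hC θ hθ)).2
      · rw [(h.bdry r hr.1).1, (h.bdry 0 le_rfl).1]
        nlinarith [hr.1]
      · rw [(h.bdry r hr.1).2, (h.bdry 0 le_rfl).2]
        nlinarith [hr.1]
    · refine slopeFlow_comparison (U := fun r θ => X 0 θ + -C * r) (V := X) hk
        ((hcX0 k).add (by fun_prop)) (hcX k) (fun r _ => h0.add contDiff_const)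
        (fun r hr => h.smooth hr.1) (fun r hr θ hθ => ⟨-C, ?_, hlin _ _ _⟩)
        (fun r hr θ hθ => ⟨_, le_rfl, h.pde hr.1 hθ⟩) (fun r hr θ hθ => ?_) (fun r hr => ?_)
        (fun r hr => ?_) (fun θ hθ => by simp) θ hθ
      · simpa [deriv_add_const'] using (abs_le.1 (hC θ hθ)).1
      · simpa [deriv_add_const'] using hslope 0 le_rfl θ hθ
      · rw [(h.bdry r hr.1).1, (h.bdry 0 le_rfl).1]
        nlinarith [hr.1]
      · rw [(h.bdry r hr.1).2, (h.bdry 0 le_rfl).2]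
        nlinarith [hr.1]
  have hshift : ∀ t, 0 ≤ t → ∀ k, 0 ≤ k → ∀ θ ∈ Icc (0 : ℝ) 1,
      X (t + k) θ ≤ X t θ + C * k ∧ X t θ + -(C * k) ≤ X (t + k) θ := by
    intro t ht k hk θ hθ
    have hck : 0 ≤ C * k := mul_nonneg hC0 hk
    have hcs : ContinuousOn (fun z : ℝ × ℝ => X (z.1 + k) z.2) (Icc 0 t ×ˢ Icc 0 1) :=
      (hcX (t + k)).comp (f := fun z : ℝ × ℝ => (z.1 + k, z.2)) (by fun_prop)
        fun z hz => ⟨⟨by linarith [hz.1.1], by linarith [hz.1.2]⟩, hz.2⟩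
    have hpdes : ∀ r ∈ Icc 0 t, ∀ θ ∈ Icc (0 : ℝ) 1, HasDerivAt (fun r => X (r + k) θ)
        ((1 / 2) * deriv (X (r + k)) θ * deriv (deriv (X (r + k))) θ) r := fun r hr θ hθ =>
      (h.pde (add_nonneg hr.1 hk) hθ).comp_add_const r k
    constructor
    · refine slopeFlow_comparison (U := fun r => X (r + k)) (V := fun r θ => X r θ + C * k) ht hcs
        ((hcX t).add continuousOn_const) (fun r hr => h.smooth (add_nonneg hr.1 hk))
        (fun r hr => (h.smooth hr.1).add contDiff_const)
        (fun r hr θ hθ => ⟨_, le_rfl, hpdes r hr θ hθ⟩)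
        (fun r hr θ hθ => ⟨_, ?_, (h.pde hr.1 hθ).add_const _⟩)
        (fun r hr => hslope _ (add_nonneg hr.1 hk)) (fun r hr => ?_) (fun r hr => ?_)
        (fun θ hθ => by simpa using (hinit k hk θ hθ).1) θ hθ
      · simp [deriv_add_const']
      · rw [(h.bdry r hr.1).1, (h.bdry (r + k) (add_nonneg hr.1 hk)).1]
        linarith
      · rw [(h.bdry r hr.1).2, (h.bdry (r + k) (add_nonneg hr.1 hk)).2]
        linarith
    · refine slopeFlow_comparison (U := fun r θ => X r θ + -(C * k)) (V := fun r => X (r + k)) ht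
        ((hcX t).add continuousOn_const) hcs (fun r hr => (h.smooth hr.1).add contDiff_const)
        (fun r hr => h.smooth (add_nonneg hr.1 hk))
        (fun r hr θ hθ => ⟨_, ?_, (h.pde hr.1 hθ).add_const _⟩)
        (fun r hr θ hθ => ⟨_, le_rfl, hpdes r hr θ hθ⟩)
        (fun r hr θ hθ => ?_) (fun r hr => ?_) (fun r hr => ?_)
        (fun θ hθ => by simpa using (hinit k hk θ hθ).2) θ hθ
      · simp [deriv_add_const']
      · simpa [deriv_add_const'] using hslope r hr.1 θ hθ
      · rw [(h.bdry r hr.1).1, (h.bdry (r + k) (add_nonneg hr.1 hk)).1]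
        linarith
      · rw [(h.bdry r hr.1).2, (h.bdry (r + k) (add_nonneg hr.1 hk)).2]
        linarith
  refine ⟨C, hC0, fun t ht θ hθ => ?_⟩
  refine (h.pde ht.le hθ).le_of_lip' hC0 ?_
  filter_upwards [lt_mem_nhds ht] with s hs
  rw [Real.norm_eq_abs, Real.norm_eq_abs]
  rcases le_total s t with hst | hst
  · have := hshift s hs.le (t - s) (sub_nonneg.2 hst) θ hθ
    rw [add_sub_cancel] at this
    rw [abs_sub_comm s t, abs_of_nonneg (sub_nonneg.2 hst), abs_le]
    exact ⟨by linarith [this.1], by linarith [this.2]⟩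
  · have := hshift t ht.le (s - t) (sub_nonneg.2 hst) θ hθ
    rw [add_sub_cancel] at this
    rw [abs_of_nonneg (sub_nonneg.2 hst), abs_le]
    exact ⟨by linarith [this.2], by linarith [this.1]⟩

end IsIncreasingFlow

/-! ### Energy dissipation -/

theorem cos_two_mul_sub_one_pos {θ : ℝ} (hθ : θ ∈ Icc (0 : ℝ) 1) : 0 < Real.cos (2 * θ - 1) := by
  apply Real.cos_pos_of_mem_Ioo
  constructor <;> linarith [hθ.1, hθ.2, Real.pi_gt_three]

/-- Dissipation of the squared distance, using the Poincaré inequality with constant `4`, which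
comes from the test function `-2 * tan (2 * θ - 1)`. -/
theorem integral_dissipation_le {f g : ℝ → ℝ} {c : ℝ} (hc : 0 ≤ c) (hf : ContDiff ℝ 2 f)
    (hg : ContDiff ℝ 2 g) (h0 : f 0 = g 0) (h1 : f 1 = g 1)
    (hfc : ∀ θ ∈ Icc (0 : ℝ) 1, c ≤ deriv f θ) (hgc : ∀ θ ∈ Icc (0 : ℝ) 1, c ≤ deriv g θ) :
    ∫ θ in (0 : ℝ)..1, 2 * (f θ - g θ) * ((1 / 2) * deriv f θ * deriv (deriv f) θ
      - (1 / 2) * deriv g θ * deriv (deriv g) θ) ≤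
      -4 * c * ∫ θ in (0 : ℝ)..1, (f θ - g θ) ^ 2 := by
  set φ : ℝ → ℝ := fun θ => -2 * Real.tan (2 * θ - 1) with hφ
  have hφd : ∀ θ ∈ Icc (0 : ℝ) 1, HasDerivAt φ (-4 - φ θ ^ 2) θ := by
    intro θ hθ
    have hcos := cos_two_mul_sub_one_pos hθ
    have hlin : HasDerivAt (fun θ : ℝ => 2 * θ - 1) 2 θ := by
      simpa using ((hasDerivAt_id θ).const_mul 2).sub_const 1
    have := ((Real.hasDerivAt_tan hcos.ne').comp θ hlin).const_mul (-2)
    refine this.congr_deriv ?_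
    simp only [hφ, Real.tan_eq_sin_div_cos]
    field_simp
    linear_combination 4 * Real.sin_sq_add_cos_sq (2 * θ - 1)
  have hφc : ContinuousOn φ (Icc 0 1) := fun θ hθ => (hφd θ hθ).continuousAt.continuousWithinAt
  have cf := hf.continuous
  have cg := hg.continuous
  have cf' := hf.continuous_deriv one_le_two
  have cg' := hg.continuous_deriv one_le_two
  have cf'' := hf.continuous_deriv_deriv_of_two
  have cg'' := hg.continuous_deriv_deriv_of_two
  set H' : ℝ → ℝ := fun θ => (1 / 2) * (deriv f θ - deriv g θ) * (deriv f θ ^ 2 - deriv g θ ^ 2)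
    + (f θ - g θ) * (deriv f θ * deriv (deriv f) θ - deriv g θ * deriv (deriv g) θ)
    - c * (2 * (f θ - g θ) * (deriv f θ - deriv g θ) * φ θ
      + (f θ - g θ) ^ 2 * (-4 - φ θ ^ 2)) with hH'
  have hH : ∀ θ ∈ uIcc (0 : ℝ) 1, HasDerivAt (fun θ => (1 / 2) * (f θ - g θ) *
      (deriv f θ ^ 2 - deriv g θ ^ 2) - c * ((f θ - g θ) ^ 2 * φ θ)) (H' θ) θ := by
    intro θ hθ
    rw [uIcc_of_le zero_le_one] at hθ
    have du := (hf.differentiable_of_two θ).hasDerivAt.sub (hg.differentiable_of_two θ).hasDerivAt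
    have df' := (hf.differentiable_deriv_of_two θ).hasDerivAt
    have dg' := (hg.differentiable_deriv_of_two θ).hasDerivAt
    refine (((du.const_mul (1 / 2)).mul ((df'.pow 2).sub (dg'.pow 2))).sub
      (((du.pow 2).mul (hφd θ hθ)).const_mul c)).congr_deriv ?_
    simp only [hH', Pi.sub_apply, Pi.pow_apply]
    push_cast
    ring
  have hH'c : ContinuousOn H' (Icc 0 1) := by fun_prop
  have hH'i : IntervalIntegrable H' volume 0 1 :=
    ContinuousOn.intervalIntegrable (by rwa [uIcc_of_le zero_le_one])
  have hzero : ∫ θ in (0 : ℝ)..1, H' θ = 0 := by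
    rw [intervalIntegral.integral_eq_sub_of_hasDerivAt hH hH'i]
    simp [h0, h1]
  have hsq : IntervalIntegrable (fun θ => -4 * c * (f θ - g θ) ^ 2) volume 0 1 :=
    Continuous.intervalIntegrable (by fun_prop) _ _
  calc _ ≤ ∫ θ in (0 : ℝ)..1, (H' θ + -4 * c * (f θ - g θ) ^ 2) := by
        refine intervalIntegral.integral_mono_on zero_le_one
          (Continuous.intervalIntegrable (by fun_prop) _ _) (hH'i.add hsq) fun θ hθ => ?_
        have h2 : 0 ≤ (deriv f θ - deriv g θ) ^ 2 * (deriv f θ + deriv g θ - 2 * c) :=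
          mul_nonneg (sq_nonneg _) (by linarith [hfc θ hθ, hgc θ hθ])
        have h3 : 0 ≤ c * (deriv f θ - deriv g θ - (f θ - g θ) * φ θ) ^ 2 :=
          mul_nonneg hc (sq_nonneg _)
        simp only [hH']
        linarith
    _ = -4 * c * ∫ θ in (0 : ℝ)..1, (f θ - g θ) ^ 2 := by
        rw [intervalIntegral.integral_add hH'i hsq, hzero, intervalIntegral.integral_const_mul,
          zero_add]

theorem IsIncreasingFlow.integral_sq_sub_le {X₁ X₂ : ℝ → ℝ → ℝ} {c : ℝ} (hc : 0 ≤ c)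
    (h₁ : IsIncreasingFlow X₁ c) (h₂ : IsIncreasingFlow X₂ c) {t : ℝ} (ht : 0 ≤ t) :
    ∫ θ in (0 : ℝ)..1, (X₁ t θ - X₂ t θ) ^ 2 ≤
      (∫ θ in (0 : ℝ)..1, (X₁ 0 θ - X₂ 0 θ) ^ 2) * Real.exp (-4 * c * t) := by
  have hu : uIoc (0 : ℝ) 1 ⊆ Icc 0 1 := by
    rw [uIoc_of_le zero_le_one]
    exact Ioc_subset_Icc_self
  have hdiff : ∀ r, 0 ≤ r → ∀ θ ∈ Icc (0 : ℝ) 1, |X₁ r θ - X₂ r θ| ≤ 1 := fun r hr θ hθ => by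
    have m₁ := h₁.mem_Icc hc hr hθ
    have m₂ := h₂.mem_Icc hc hr hθ
    exact abs_le.2 ⟨by linarith [m₁.1, m₂.2], by linarith [m₁.2, m₂.1]⟩
  have hcsq : ∀ r, 0 ≤ r → Continuous fun θ => (X₁ r θ - X₂ r θ) ^ 2 := fun r hr =>
    ((h₁.smooth hr).continuous.sub (h₂.smooth hr).continuous).pow 2
  set Φ : ℝ → ℝ := fun r => ∫ θ in (0 : ℝ)..1, (X₁ r θ - X₂ r θ) ^ 2
  have hΦc : ContinuousOn Φ (Ici 0) := by
    intro r hr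
    refine intervalIntegral.continuousWithinAt_of_dominated_interval (bound := fun _ => 1) ?_ ?_
      intervalIntegrable_const ?_
    · filter_upwards [self_mem_nhdsWithin] with s hs using (hcsq s hs).aestronglyMeasurable
    · filter_upwards [self_mem_nhdsWithin] with s hs
      refine ae_of_all _ fun θ hθ => ?_
      rw [norm_pow, Real.norm_eq_abs]
      exact pow_le_one₀ (abs_nonneg _) (hdiff s hs θ (hu hθ))
    · refine ae_of_all _ fun θ hθ => ?_
      exact (((h₁.pde hr (hu hθ)).continuousAt.sub
        (h₂.pde hr (hu hθ)).continuousAt).pow 2).continuousWithinAt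
  obtain ⟨C₁, hC₁, hb₁⟩ := h₁.exists_velocity_bound hc
  obtain ⟨C₂, hC₂, hb₂⟩ := h₂.exists_velocity_bound hc
  set Φ' : ℝ → ℝ → ℝ := fun r θ => 2 * (X₁ r θ - X₂ r θ) *
    ((1 / 2) * deriv (X₁ r) θ * deriv (deriv (X₁ r)) θ
      - (1 / 2) * deriv (X₂ r) θ * deriv (deriv (X₂ r)) θ) with hΦ'
  have hΦd : ∀ r, 0 < r → HasDerivAt Φ (∫ θ in (0 : ℝ)..1, Φ' r θ) r := by
    intro r hr
    refine (intervalIntegral.hasDerivAt_integral_of_dominated_loc_of_deriv_le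
      (bound := fun _ => 2 * 1 * (C₁ + C₂)) (s := Ioi 0) (Ioi_mem_nhds hr) ?_
      ((hcsq r hr.le).intervalIntegrable _ _) ?_ ?_ intervalIntegrable_const ?_).2
    · filter_upwards [Ioi_mem_nhds hr] with s hs using (hcsq s (le_of_lt hs)).aestronglyMeasurable
    · have c₁ := h₁.smooth hr.le
      have c₂ := h₂.smooth hr.le
      have := c₁.continuous
      have := c₂.continuous
      have := c₁.continuous_deriv one_le_two
      have := c₂.continuous_deriv one_le_two
      have := c₁.continuous_deriv_deriv_of_two
      have := c₂.continuous_deriv_deriv_of_two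
      exact Continuous.aestronglyMeasurable (by fun_prop)
    · refine ae_of_all _ fun θ hθ s hs => ?_
      rw [norm_mul, norm_mul, Real.norm_two, Real.norm_eq_abs, Real.norm_eq_abs]
      gcongr
      · exact hdiff s (le_of_lt hs) θ (hu hθ)
      · exact (abs_sub _ _).trans (add_le_add (hb₁ s hs θ (hu hθ)) (hb₂ s hs θ (hu hθ)))
    · refine ae_of_all _ fun θ hθ s hs => ?_
      refine (((h₁.pde (le_of_lt hs) (hu hθ)).sub (h₂.pde (le_of_lt hs) (hu hθ))).pow 2).congr_deriv
        ?_
      simp [hΦ']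
  have hexp : ∀ r, HasDerivAt (fun r => Real.exp (4 * c * r)) (Real.exp (4 * c * r) * (4 * c)) r :=
    fun r => by simpa using ((hasDerivAt_id r).const_mul (4 * c)).exp
  have hprod : ∀ r, 0 < r → HasDerivAt (fun r => Φ r * Real.exp (4 * c * r))
      ((∫ θ in (0 : ℝ)..1, Φ' r θ) * Real.exp (4 * c * r)
        + Φ r * (Real.exp (4 * c * r) * (4 * c))) r := fun r hr => (hΦd r hr).mul (hexp r)
  have hanti : AntitoneOn (fun r => Φ r * Real.exp (4 * c * r)) (Ici 0) := by
    refine antitoneOn_of_deriv_nonpos (convex_Ici 0) (hΦc.mul (by fun_prop)) ?_ ?_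
    · rw [interior_Ici]
      exact fun r hr => (hprod r hr).differentiableAt.differentiableWithinAt
    · rw [interior_Ici]
      intro r hr
      have hr' : 0 ≤ r := le_of_lt hr
      rw [(hprod r hr).deriv]
      have hdis : ∫ θ in (0 : ℝ)..1, Φ' r θ ≤ -4 * c * Φ r :=
        integral_dissipation_le hc (h₁.smooth hr') (h₂.smooth hr')
        (by rw [(h₁.bdry r hr').1, (h₂.bdry r hr').1])
        (by rw [(h₁.bdry r hr').2, (h₂.bdry r hr').2]) (h₁.slope r hr') (h₂.slope r hr')
      nlinarith [mul_le_mul_of_nonneg_right hdis (Real.exp_pos (4 * c * r)).le]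
  have hfin := hanti (mem_Ici.2 le_rfl) (mem_Ici.2 ht) ht
  simp only [mul_zero, Real.exp_zero, mul_one] at hfin
  rw [show -4 * c * t = -(4 * c * t) by ring, Real.exp_neg, ← div_eq_mul_inv,
    le_div_iff₀ (Real.exp_pos _)]
  exact hfin

theorem L2_contraction_rho_one (c : ℝ) (hc : 0 < c) (X₁ X₂ : ℝ → ℝ → ℝ)
    (hsm₁ : ∀ t, 0 ≤ t → ContDiff ℝ 2 (X₁ t))
    (hsm₂ : ∀ t, 0 ≤ t → ContDiff ℝ 2 (X₂ t))
    -- the PDE `∂ₜX = (1/2) ∂_θX ∂²_θθX` on `[0,∞) × [0,1]`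
    (hpde₁ : ∀ t, 0 ≤ t → ∀ θ ∈ Set.Icc (0 : ℝ) 1,
      HasDerivAt (fun s => X₁ s θ)
        ((1 / 2) * deriv (X₁ t) θ * deriv (deriv (X₁ t)) θ) t)
    (hpde₂ : ∀ t, 0 ≤ t → ∀ θ ∈ Set.Icc (0 : ℝ) 1,
      HasDerivAt (fun s => X₂ s θ)
        ((1 / 2) * deriv (X₂ t) θ * deriv (deriv (X₂ t)) θ) t)
    -- boundary conditions
    (hbd₁ : ∀ t, 0 ≤ t → X₁ t 0 = 0 ∧ X₁ t 1 = 1)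
    (hbd₂ : ∀ t, 0 ≤ t → X₂ t 0 = 0 ∧ X₂ t 1 = 1)
    -- initial monotonicity
    (hmono₁ : ∀ θ ∈ Set.Icc (0 : ℝ) 1, c ≤ deriv (X₁ 0) θ)
    (hmono₂ : ∀ θ ∈ Set.Icc (0 : ℝ) 1, c ≤ deriv (X₂ 0) θ) :
    ∀ t, 0 ≤ t →
      ∫ θ in (0 : ℝ)..1, (X₁ t θ - X₂ t θ) ^ 2 ≤
        (∫ θ in (0 : ℝ)..1, (X₁ 0 θ - X₂ 0 θ) ^ 2) * Real.exp (-4 * c * t) := by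
  have h₁ := IsIncreasingFlow.of_initial hc.le hsm₁ hpde₁ hbd₁ hmono₁
  have h₂ := IsIncreasingFlow.of_initial hc.le hsm₂ hpde₂ hbd₂ hmono₂
  exact fun t ht => h₁.integral_sq_sub_le hc.le h₂ ht
end

section
/- Let X = X(t,θ) be a smooth solution of ∂_t X = (1/2) ∂_θX ∂²_{θθ}X on [0,∞)×[0,1] with X(t,0)=0, X(t,1)=1, with ∂_θX(t,θ) ≥ c > 0 for all t,θ and sup_{t≥0} ‖X(t,·)‖_{C^4([0,1])} ≤ K < ∞. For i = 1,…,N set X^i(t) := X(t,(i−1/2)/N), with the conventions X^0 := −X^1 and X^{N+1} := 2−X^N. Then there is a constant Ĉ, depending only on K, such that for all t ≥ 0 and all i = 1,…,N: | ∂_t X^i(t) − (N^3/4)( (X^{i+1}(t)−X^i(t))^2 − (X^i(t)−X^{i−1}(t))^2 ) | ≤ Ĉ/N^2. -/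
/-- Integrating a bound of order `n` on the derivative gives a bound of order `n + 1`. -/
theorem abs_le_mul_pow_succ_of_hasDerivAt {s : Set ℝ} (hs : Convex ℝ s) {g g' : ℝ → ℝ}
    {C x : ℝ} {n : ℕ} (hC : 0 ≤ C) (hx : x ∈ s) (hg : ∀ y, HasDerivAt g (g' y) y) (hgx : g x = 0)
    (hb : ∀ y ∈ s, |g' y| ≤ C * |y - x| ^ n) {y : ℝ} (hy : y ∈ s) :
    |g y| ≤ C * |y - x| ^ (n + 1) := by
  have hseg : segment ℝ x y ⊆ s := hs.segment_subset hx hy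
  have h := Convex.norm_image_sub_le_of_norm_hasDerivWithin_le (C := C * |y - x| ^ n)
    (f := g) (f' := g') (s := segment ℝ x y) (fun z _ => (hg z).hasDerivWithinAt)
    (fun z hz => by
      refine (hb z (hseg hz)).trans ?_
      have hzx : |z - x| ≤ |y - x| := by
        rw [segment_eq_uIcc] at hz
        exact Set.abs_sub_left_of_mem_uIcc hz
      gcongr)
    (convex_segment x y) (left_mem_segment ℝ x y) (right_mem_segment ℝ x y)
  rw [hgx, sub_zero, Real.norm_eq_abs, Real.norm_eq_abs] at h
  rw [pow_succ, ← mul_assoc]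
  exact h

theorem abs_taylor_two_le {s : Set ℝ} (hs : Convex ℝ s) {f f₁ f₂ : ℝ → ℝ} {K x : ℝ}
    (hK : 0 ≤ K) (hx : x ∈ s) (h₀ : ∀ y, HasDerivAt f (f₁ y) y)
    (h₁ : ∀ y, HasDerivAt f₁ (f₂ y) y) (hb : ∀ y ∈ s, |f₂ y| ≤ K) {y : ℝ} (hy : y ∈ s) :
    |f y - (f x + (y - x) * f₁ x)| ≤ K * |y - x| ^ 2 := by
  refine abs_le_mul_pow_succ_of_hasDerivAt hs (g := fun y => f y - (f x + (y - x) * f₁ x))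
    (g' := fun y => f₁ y - f₁ x) hK hx
    (fun y => ?_) (by simp) (fun y hy => ?_) hy
  · exact ((h₀ y).sub ((((hasDerivAt_id y).sub_const x).mul_const (f₁ x)).const_add
      (f x))).congr_deriv (by ring)
  · exact abs_le_mul_pow_succ_of_hasDerivAt hs (g := fun y => f₁ y - f₁ x) (n := 0) hK hx
      (fun y => (h₁ y).sub_const _) (by simp) (by simpa using hb) hy

theorem abs_taylor_four_le {s : Set ℝ} (hs : Convex ℝ s) {f f₁ f₂ f₃ f₄ : ℝ → ℝ} {K x : ℝ}
    (hK : 0 ≤ K) (hx : x ∈ s) (h₀ : ∀ y, HasDerivAt f (f₁ y) y)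
    (h₁ : ∀ y, HasDerivAt f₁ (f₂ y) y) (h₂ : ∀ y, HasDerivAt f₂ (f₃ y) y)
    (h₃ : ∀ y, HasDerivAt f₃ (f₄ y) y) (hb : ∀ y ∈ s, |f₄ y| ≤ K) {y : ℝ} (hy : y ∈ s) :
    |f y - (f x + (y - x) * f₁ x + (y - x) ^ 2 / 2 * f₂ x + (y - x) ^ 3 / 6 * f₃ x)|
      ≤ K * |y - x| ^ 4 := by
  have hd (y : ℝ) : HasDerivAt (fun y => y - x) 1 y := (hasDerivAt_id y).sub_const x
  refine abs_le_mul_pow_succ_of_hasDerivAt hs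
    (g := fun y => f y - (f x + (y - x) * f₁ x + (y - x) ^ 2 / 2 * f₂ x + (y - x) ^ 3 / 6 * f₃ x))
    (g' := fun y => f₁ y - (f₁ x + (y - x) * f₂ x + (y - x) ^ 2 / 2 * f₃ x)) hK hx
    (fun y => ?_) (by simp) (fun y hy => ?_) hy
  · exact ((h₀ y).sub (((((hd y).mul_const (f₁ x)).const_add (f x)).add
      ((((hd y).pow 2).div_const 2).mul_const (f₂ x))).add
      ((((hd y).pow 3).div_const 6).mul_const (f₃ x)))).congr_deriv (by push_cast; ring)
  refine abs_le_mul_pow_succ_of_hasDerivAt hs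
    (g := fun y => f₁ y - (f₁ x + (y - x) * f₂ x + (y - x) ^ 2 / 2 * f₃ x))
    (g' := fun y => f₂ y - (f₂ x + (y - x) * f₃ x)) hK hx
    (fun y => ?_) (by simp) (fun y hy => abs_taylor_two_le hs hK hx h₂ h₃ hb hy) hy
  exact ((h₁ y).sub ((((hd y).mul_const (f₂ x)).const_add (f₁ x)).add
    ((((hd y).pow 2).div_const 2).mul_const (f₃ x)))).congr_deriv (by push_cast; ring)

/-- The odd reflection of `f` across a zero `y` of its second derivative agrees with the third-order
Taylor polynomial of `f` up to fourth order. -/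
theorem abs_reflection_taylor_four_le {s : Set ℝ} (hs : Convex ℝ s) {f f₁ f₂ f₃ f₄ : ℝ → ℝ}
    {K x : ℝ} (hK : 0 ≤ K) (hx : x ∈ s) (h₀ : ∀ y, HasDerivAt f (f₁ y) y)
    (h₁ : ∀ y, HasDerivAt f₁ (f₂ y) y) (h₂ : ∀ y, HasDerivAt f₂ (f₃ y) y)
    (h₃ : ∀ y, HasDerivAt f₃ (f₄ y) y) (hb : ∀ y ∈ s, |f₄ y| ≤ K) {y H : ℝ} (hy : y ∈ s)
    (hfy : f₂ y = 0) (hH : H = 2 * (y - x)) :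
    |2 * f y - f x - (f x + H * f₁ x + H ^ 2 / 2 * f₂ x + H ^ 3 / 6 * f₃ x)| ≤ K * |H| ^ 4 := by
  have e₀ := abs_taylor_four_le hs hK hx h₀ h₁ h₂ h₃ hb hy
  have e₂ := abs_taylor_two_le hs hK hx h₂ h₃ hb hy
  rw [hfy] at e₂
  subst hH
  generalize y - x = d at *
  have hd : |d| ^ 4 = |d| ^ 2 * |d| ^ 2 := by ring
  rw [abs_mul, mul_pow, abs_two]
  have e₃ : |d ^ 2 * (0 - (f₂ x + d * f₃ x))| ≤ K * |d| ^ 4 := by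
    rw [abs_mul, abs_pow]
    calc |d| ^ 2 * |0 - (f₂ x + d * f₃ x)| ≤ |d| ^ 2 * (K * |d| ^ 2) := by gcongr
      _ = K * |d| ^ 4 := by ring
  have hpos : 0 ≤ K * |d| ^ 4 := by positivity
  rw [abs_le] at *
  constructor <;> nlinarith

/-- Consistency of the centred scheme whose neighbouring values `p`, `m` agree with the
third-order Taylor polynomials up to `K * h ^ 4`. -/
theorem abs_scheme_sub_le {h K f f₁ f₂ f₃ p m : ℝ} (hh : 0 < h) (hh1 : h ≤ 1) (h₁ : |f₁| ≤ K)
    (h₂ : |f₂| ≤ K) (h₃ : |f₃| ≤ K)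
    (hp : |p - (f + h * f₁ + h ^ 2 / 2 * f₂ + h ^ 3 / 6 * f₃)| ≤ K * h ^ 4)
    (hm : |m - (f - h * f₁ + h ^ 2 / 2 * f₂ - h ^ 3 / 6 * f₃)| ≤ K * h ^ 4) :
    |2 * h ^ 3 * f₁ * f₂ - ((p - f) ^ 2 - (f - m) ^ 2)| ≤ 12 * K ^ 2 * h ^ 5 := by
  have hK : 0 ≤ K := (abs_nonneg _).trans h₁
  obtain ⟨a, ha⟩ : ∃ a, a = p - (f + h * f₁ + h ^ 2 / 2 * f₂ + h ^ 3 / 6 * f₃) := ⟨_, rfl⟩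
  obtain ⟨b, hb⟩ : ∃ b, b = m - (f - h * f₁ + h ^ 2 / 2 * f₂ - h ^ 3 / 6 * f₃) := ⟨_, rfl⟩
  rw [← ha] at hp
  rw [← hb] at hm
  have key : 2 * h ^ 3 * f₁ * f₂ - ((p - f) ^ 2 - (f - m) ^ 2)
      = -(h ^ 2 * f₂ * (h ^ 3 / 3 * f₃ + (a - b))
        + (a + b) * (2 * h * f₁ + (h ^ 3 / 3 * f₃ + (a - b)))) := by
    rw [ha, hb]; ring
  have h43 : h ^ 4 ≤ h ^ 3 := pow_le_pow_of_le_one hh.le hh1 (by norm_num)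
  have h31 : h ^ 3 ≤ h := by simpa using pow_le_pow_of_le_one hh.le hh1 (show 1 ≤ 3 by norm_num)
  have hsub : |a - b| ≤ 2 * K * h ^ 4 := (abs_sub a b).trans (by linarith)
  have hadd : |a + b| ≤ 2 * K * h ^ 4 := (abs_add_le a b).trans (by linarith)
  have hr : |h ^ 3 / 3 * f₃ + (a - b)| ≤ 7 / 3 * K * h ^ 3 := by
    have : |h ^ 3 / 3 * f₃| ≤ h ^ 3 / 3 * K := by
      rw [abs_mul, abs_of_pos (by positivity : 0 < h ^ 3 / 3)]; gcongr
    have h4 : 2 * K * h ^ 4 ≤ 2 * K * h ^ 3 := by gcongr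
    exact (abs_add_le _ _).trans (by linarith)
  have hq : |2 * h * f₁ + (h ^ 3 / 3 * f₃ + (a - b))| ≤ 13 / 3 * K * h := by
    have : |2 * h * f₁| ≤ 2 * h * K := by
      rw [abs_mul, abs_of_pos (by positivity : 0 < 2 * h)]; gcongr
    have h3 : 7 / 3 * K * h ^ 3 ≤ 7 / 3 * K * h := by gcongr
    exact (abs_add_le _ _).trans (by linarith)
  have hf : |h ^ 2 * f₂| ≤ h ^ 2 * K := by
    rw [abs_mul, abs_of_pos (by positivity : 0 < h ^ 2)]; gcongr
  rw [key, abs_neg]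
  calc _ ≤ |h ^ 2 * f₂| * |h ^ 3 / 3 * f₃ + (a - b)|
        + |a + b| * |2 * h * f₁ + (h ^ 3 / 3 * f₃ + (a - b))| := by
        rw [← abs_mul, ← abs_mul]; exact abs_add_le _ _
    _ ≤ h ^ 2 * K * (7 / 3 * K * h ^ 3) + 2 * K * h ^ 4 * (13 / 3 * K * h) := by gcongr
    _ ≤ 12 * K ^ 2 * h ^ 5 := by
        have : 0 ≤ K ^ 2 * h ^ 5 := by positivity
        linarith

/-- If `u` is constant on `[0, ∞)`, its derivative at any `t ≥ 0` vanishes. -/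
theorem HasDerivAt.eq_zero_of_eqOn_Ici {u : ℝ → ℝ} {a D t : ℝ} (ht : 0 ≤ t)
    (hu : HasDerivAt u D t) (ha : ∀ s, 0 ≤ s → u s = a) : D = 0 := by
  have h : HasDerivWithinAt u 0 (Set.Ici 0) t :=
    (hasDerivWithinAt_const t (Set.Ici 0) a).congr (fun s hs => ha s hs) (ha t ht)
  exact (uniqueDiffOn_Ici (0 : ℝ) t ht).eq_deriv _ hu.hasDerivWithinAt h


/-- The reference grid points `(i - 1/2)/N`. -/
noncomputable def grid (N i : ℕ) : ℝ := ((i : ℝ) - 1 / 2) / N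

/-- Extension of a finite family `v 1, …, v N` by the boundary conventions
`v 0 := -v 1` and `v (N+1) := 2 - v N`. -/
noncomputable def pad (N : ℕ) (v : ℕ → ℝ) : ℕ → ℝ :=
  fun i => if i = 0 then -v 1 else if i = N + 1 then 2 - v N else v i

theorem consistency_estimate_rho_one (K : ℝ) (hK : 0 < K) :
    ∃ Chat : ℝ, 0 < Chat ∧
      ∀ (c : ℝ), 0 < c → ∀ (N : ℕ), 1 ≤ N → ∀ (X : ℝ → ℝ → ℝ),
        -- spatial regularity
        (∀ t, 0 ≤ t → ContDiff ℝ 4 (X t)) →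
        -- the PDE `∂ₜX = (1/2) ∂_θX ∂²_θθX`
        (∀ t, 0 ≤ t → ∀ θ ∈ Set.Icc (0 : ℝ) 1,
          HasDerivAt (fun s => X s θ)
            ((1 / 2) * deriv (X t) θ * deriv (deriv (X t)) θ) t) →
        -- boundary conditions
        (∀ t, 0 ≤ t → X t 0 = 0 ∧ X t 1 = 1) →
        -- uniform monotonicity
        (∀ t, 0 ≤ t → ∀ θ ∈ Set.Icc (0 : ℝ) 1, c ≤ deriv (X t) θ) →
        -- `sup_t ‖X(t,·)‖_{C⁴([0,1])} ≤ K`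
        (∀ t, 0 ≤ t → ∀ k : ℕ, k ≤ 4 → ∀ θ ∈ Set.Icc (0 : ℝ) 1,
          |iteratedDeriv k (X t) θ| ≤ K) →
        -- conclusion: consistency of the discretized values `Xⁱ(t) = X(t, (i-1/2)/N)`
        ∀ t, 0 ≤ t → ∀ i ∈ Finset.Icc 1 N, ∀ D : ℝ,
          HasDerivAt (fun s => X s (grid N i)) D t →
          |D - ((N : ℝ) ^ 3 / 4) *
              ((pad N (fun j => X t (grid N j)) (i + 1) - pad N (fun j => X t (grid N j)) i) ^ 2
                - (pad N (fun j => X t (grid N j)) i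
                    - pad N (fun j => X t (grid N j)) (i - 1)) ^ 2)| ≤
            Chat / (N : ℝ) ^ 2 := by
  refine ⟨3 * K ^ 2, by positivity, ?_⟩
  intro c hc N hN X hX hpde hbc hmono hbd t ht i hi D hD
  obtain ⟨hi1, hiN⟩ := Finset.mem_Icc.1 hi
  have hN0 : (0 : ℝ) < N := by exact_mod_cast hN
  obtain ⟨h, hh⟩ : ∃ h : ℝ, h = 1 / N := ⟨_, rfl⟩
  have hpos : 0 < h := by rw [hh]; positivity
  have hNh : (N : ℝ) * h = 1 := by rw [hh]; field_simp
  have hh1 : h ≤ 1 := by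
    have : (1 : ℝ) ≤ N := by exact_mod_cast hN
    nlinarith
  have hgrid (j : ℕ) : grid N j = (j - 1 / 2) * h := by rw [grid, hh]; ring
  have hmem (j : ℕ) (hj1 : 1 ≤ j) (hjN : j ≤ N) : grid N j ∈ Set.Icc (0 : ℝ) 1 := by
    have hj1' : (1 : ℝ) ≤ j := by exact_mod_cast hj1
    have hjN' : (j : ℝ) ≤ N := by exact_mod_cast hjN
    rw [hgrid]
    constructor <;> nlinarith
  have h0mem : (0 : ℝ) ∈ Set.Icc (0 : ℝ) 1 := by simp
  have h1mem : (1 : ℝ) ∈ Set.Icc (0 : ℝ) 1 := by simp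
  have hx := hmem i hi1 hiN
  have hder (k : ℕ) (hk : k < 4) (y : ℝ) :
      HasDerivAt (iteratedDeriv k (X t)) (iteratedDeriv (k + 1) (X t) y) y := by
    rw [iteratedDeriv_succ]
    exact ((hX t ht).differentiable_iteratedDeriv k (by exact_mod_cast hk) y).hasDerivAt
  have e1 : deriv (X t) = iteratedDeriv 1 (X t) := iteratedDeriv_one.symm
  have e2 : deriv (deriv (X t)) = iteratedDeriv 2 (X t) := by
    rw [iteratedDeriv_succ, iteratedDeriv_one]
  have h₀ : ∀ y, HasDerivAt (X t) (iteratedDeriv 1 (X t) y) y := by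
    simpa using hder 0 (by norm_num)
  have h₁ := hder 1 (by norm_num)
  have h₂ := hder 2 (by norm_num)
  have h₃ := hder 3 (by norm_num)
  have hb := hbd t ht 4 le_rfl
  have hs : Convex ℝ (Set.Icc (0 : ℝ) 1) := convex_Icc 0 1
  have hbdry (y a : ℝ) (hy : y ∈ Set.Icc (0 : ℝ) 1) (hya : ∀ s, 0 ≤ s → X s y = a) :
      iteratedDeriv 2 (X t) y = 0 := by
    have h := (hpde t ht y hy).eq_zero_of_eqOn_Ici ht hya
    have hne : deriv (X t) y ≠ 0 := (hc.trans_le (hmono t ht y hy)).ne'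
    rw [← e2]
    simpa [hne] using h
  have hpadi : pad N (fun j => X t (grid N j)) i = X t (grid N i) := by
    rw [pad, if_neg (by omega), if_neg (by omega)]
  have hp : |pad N (fun j => X t (grid N j)) (i + 1) - (X t (grid N i)
      + h * iteratedDeriv 1 (X t) (grid N i) + h ^ 2 / 2 * iteratedDeriv 2 (X t) (grid N i)
      + h ^ 3 / 6 * iteratedDeriv 3 (X t) (grid N i))| ≤ K * h ^ 4 := by
    rcases hiN.eq_or_lt with rfl | hlt
    · have := abs_reflection_taylor_four_le hs hK.le hx h₀ h₁ h₂ h₃ hb h1mem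
        (hbdry 1 1 h1mem fun s hs => (hbc s hs).2) (H := h) (by rw [hgrid]; linarith)
      rw [(hbc t ht).2, abs_of_pos hpos, mul_one] at this
      rw [pad, if_neg (by omega), if_pos rfl]
      exact this
    · have := abs_taylor_four_le hs hK.le hx h₀ h₁ h₂ h₃ hb (hmem (i + 1) (by omega) hlt)
      have hd : grid N (i + 1) - grid N i = h := by rw [hgrid, hgrid]; push_cast; ring
      rw [hd, abs_of_pos hpos] at this
      rw [pad, if_neg (by omega), if_neg (by omega)]
      exact this
  have hm : |pad N (fun j => X t (grid N j)) (i - 1) - (X t (grid N i)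
      - h * iteratedDeriv 1 (X t) (grid N i) + h ^ 2 / 2 * iteratedDeriv 2 (X t) (grid N i)
      - h ^ 3 / 6 * iteratedDeriv 3 (X t) (grid N i))| ≤ K * h ^ 4 := by
    rcases hi1.eq_or_lt with rfl | hlt
    · have := abs_reflection_taylor_four_le hs hK.le hx h₀ h₁ h₂ h₃ hb h0mem
        (hbdry 0 0 h0mem fun s hs => (hbc s hs).1) (H := -h) (by rw [hgrid]; push_cast; ring)
      rw [(hbc t ht).1, abs_neg, abs_of_pos hpos] at this
      rw [pad, if_pos rfl]
      convert this using 2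
      ring
    · have := abs_taylor_four_le hs hK.le hx h₀ h₁ h₂ h₃ hb
        (hmem (i - 1) (by omega) (by omega))
      have hd : grid N (i - 1) - grid N i = -h := by
        rw [hgrid, hgrid, Nat.cast_sub hi1]; push_cast; ring
      rw [hd, abs_neg, abs_of_pos hpos] at this
      rw [pad, if_neg (by omega), if_neg (by omega)]
      convert this using 2
      ring
  have main := abs_scheme_sub_le hpos hh1 (hbd t ht 1 (by norm_num) _ hx)
    (hbd t ht 2 (by norm_num) _ hx) (hbd t ht 3 (by norm_num) _ hx) hp hm
  rw [hD.unique (hpde t ht _ hx), hpadi, e2, e1]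
  have hNinv : (N : ℝ) = h⁻¹ := by rw [hh]; simp
  rw [hNinv]
  calc _ = (h⁻¹) ^ 3 / 4 * |2 * h ^ 3 * iteratedDeriv 1 (X t) (grid N i)
          * iteratedDeriv 2 (X t) (grid N i)
          - ((pad N (fun j => X t (grid N j)) (i + 1) - X t (grid N i)) ^ 2
            - (X t (grid N i) - pad N (fun j => X t (grid N j)) (i - 1)) ^ 2)| := by
        rw [← abs_of_pos (by positivity : 0 < (h⁻¹) ^ 3 / 4), ← abs_mul,
          abs_of_pos (by positivity : 0 < (h⁻¹) ^ 3 / 4)]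
        congr 1
        field_simp
        ring
    _ ≤ (h⁻¹) ^ 3 / 4 * (12 * K ^ 2 * h ^ 5) := by gcongr
    _ = 3 * K ^ 2 / (h⁻¹) ^ 2 := by field_simp; ring
end

section
/- Let (x̄^1(t),…,x̄^N(t)) solve the rescaled discrete gradient flow d/dt x̄^i = (N^3/4)((x̄^{i+1}−x̄^i)^2 − (x̄^i−x̄^{i−1})^2), i = 1,…,N, with the conventions x̄^0 := −x̄^1 and x̄^{N+1} := 2−x̄^N. Set W^i(t) := N(x̄^{i+1}(t)−x̄^i(t)) for i = 0,…,N. If c ≤ W^i(0) ≤ C for all i, where 0 < c ≤ C, then c ≤ W^i(t) ≤ C for all i = 0,…,N and all t ≥ 0. -/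
/-- A differentiable function which vanishes at `t` and is nonnegative just before `t`
has nonpositive derivative at `t`. -/
theorem HasDerivAt.nonpos_of_nonneg_left {f : ℝ → ℝ} {f' a t : ℝ} (hat : a < t)
    (hf : HasDerivAt f f' t) (ht : f t = 0) (hnn : ∀ s, a ≤ s → s < t → 0 ≤ f s) : f' ≤ 0 := by
  have h := (hasDerivWithinAt_iff_tendsto_slope' (s := Set.Iio t) (by simp)).1
    (hf.hasDerivWithinAt (s := Set.Iio t))
  refine le_of_tendsto h ?_
  filter_upwards [Ioo_mem_nhdsLT hat] with s hs
  rw [slope_def_field]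
  exact div_nonpos_of_nonneg_of_nonpos (by simpa [ht] using hnn s hs.1.le hs.2)
    (sub_nonpos.2 hs.2.le)

/-- First exit principle for a finite family of functions: if the family starts positive and
any member that vanishes while the others are nonnegative has positive derivative, then the
family stays positive. -/
theorem forall_pos_of_hasDerivAt_pos {ι : Type*} (s : Finset ι) (f : ℝ → ι → ℝ) (T : ℝ)
    (hcont : ∀ i ∈ s, ContinuousOn (fun t => f t i) (Set.Icc 0 T))
    (h0 : ∀ i ∈ s, 0 < f 0 i)
    (hd : ∀ t ∈ Set.Icc 0 T, ∀ i ∈ s, f t i = 0 → (∀ j ∈ s, 0 ≤ f t j) →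
      ∃ d, 0 < d ∧ HasDerivAt (fun u => f u i) d t) :
    ∀ t ∈ Set.Icc 0 T, ∀ i ∈ s, 0 < f t i := by
  by_contra! hcon
  obtain ⟨t₁, ht₁, i₁, hi₁, hle₁⟩ := hcon
  set S : Set ℝ := ⋃ i ∈ s, {t ∈ Set.Icc 0 T | f t i ≤ 0} with hS
  have hSc : IsClosed S := by
    refine s.finite_toSet.isClosed_biUnion fun i hi => ?_
    exact (hcont i hi).preimage_isClosed_of_isClosed isClosed_Icc isClosed_Iic
  have hmem : ∀ t, t ∈ S ↔ ∃ i ∈ s, t ∈ Set.Icc 0 T ∧ f t i ≤ 0 := by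
    intro t; simp only [hS, Set.mem_iUnion, exists_prop]; rfl
  have hbdd : BddBelow S := ⟨0, fun t ht => by
    obtain ⟨i, -, h, -⟩ := (hmem t).1 ht
    exact h.1⟩
  have hne : S.Nonempty := ⟨t₁, (hmem t₁).2 ⟨i₁, hi₁, ht₁, hle₁⟩⟩
  obtain ⟨i, hi, ht, hle⟩ := (hmem _).1 (hSc.csInf_mem hne hbdd)
  set t := sInf S
  have hbefore : ∀ u, 0 ≤ u → u < t → ∀ j ∈ s, 0 < f u j := by
    intro u hu hut j hj
    by_contra! hneg
    exact (csInf_le hbdd ((hmem u).2 ⟨j, hj, ⟨hu, hut.le.trans ht.2⟩, hneg⟩)).not_gt hut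
  have htpos : 0 < t := by
    refine lt_of_le_of_ne ht.1 fun h => ?_
    rw [← h] at hle
    exact (h0 i hi).not_ge hle
  have hnonneg : ∀ j ∈ s, 0 ≤ f t j := by
    intro j hj
    have hlim : Filter.Tendsto (fun u => f u j) (nhdsWithin t (Set.Ico 0 t)) (nhds (f t j)) :=
      ((hcont j hj) t ht).mono_left
        (nhdsWithin_mono t fun u hu => ⟨hu.1, hu.2.le.trans ht.2⟩)
    have : (nhdsWithin t (Set.Ico 0 t)).NeBot := by
      rw [nhdsWithin_Ico_eq_nhdsLT htpos]; infer_instance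
    refine ge_of_tendsto hlim ?_
    filter_upwards [self_mem_nhdsWithin] with u hu
    exact (hbefore u hu.1 hu.2 j hj).le
  have hzero : f t i = 0 := le_antisymm hle (hnonneg i hi)
  obtain ⟨d, hdpos, hder⟩ := hd t ht i hi hzero hnonneg
  exact (hder.nonpos_of_nonneg_left htpos hzero
    fun u hu hut => (hbefore u hu hut i hi).le).not_gt hdpos

/-- Positive lower bounds are preserved by `∂ₜ Wⁱ = K ((Wʲ)² + (Wᵏ)² - 2 (Wⁱ)²)`, whatever the
neighbours `j`, `k` of `i` are. -/
theorem le_of_hasDerivAt_sq_diffusion {ι : Type*} (s : Finset ι) (W : ℝ → ι → ℝ) {K c : ℝ}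
    (hK : 0 ≤ K) (hc : 0 < c)
    (hW : ∀ t, 0 ≤ t → ∀ i ∈ s, ∃ j ∈ s, ∃ k ∈ s, HasDerivAt (fun u => W u i)
      (K * (W t j ^ 2 + W t k ^ 2 - 2 * W t i ^ 2)) t)
    (h0 : ∀ i ∈ s, c ≤ W 0 i) :
    ∀ t, 0 ≤ t → ∀ i ∈ s, c ≤ W t i := by
  intro T hT i hi
  by_contra! hlt
  obtain ⟨ε, hε, hεc, hεW⟩ : ∃ ε : ℝ, 0 < ε ∧ ε * (1 + T) < c ∧ ε * (1 + T) ≤ c - W T i := by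
    have hT1 : 0 < 1 + T := by linarith
    have hm : 0 < min (c / 2) (c - W T i) := lt_min (by linarith) (by linarith)
    refine ⟨min (c / 2) (c - W T i) / (1 + T), div_pos hm hT1, ?_, ?_⟩
    · rw [div_mul_cancel₀ _ hT1.ne']
      linarith [min_le_left (c / 2) (c - W T i)]
    · rw [div_mul_cancel₀ _ hT1.ne']
      exact min_le_right _ _
  have hlin (t : ℝ) : HasDerivAt (fun u : ℝ => c - ε * (1 + u)) (-ε) t := by
    simpa using (((hasDerivAt_id t).const_add 1).const_mul ε).const_sub c
  have key := forall_pos_of_hasDerivAt_pos s (fun t i => W t i - (c - ε * (1 + t))) T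
    (fun i hi t ht => by
      obtain ⟨j, -, k, -, h⟩ := hW t ht.1 i hi
      exact (h.sub (hlin t)).continuousAt.continuousWithinAt)
    (fun i hi => by linarith [h0 i hi])
    (fun t ht i hi hz hnn => by
      obtain ⟨j, hj, k, hk, h⟩ := hW t ht.1 i hi
      refine ⟨_, ?_, h.sub (hlin t)⟩
      have hpos : 0 < W t i := by nlinarith [ht.2]
      have hij : W t i ^ 2 ≤ W t j ^ 2 := pow_le_pow_left₀ hpos.le (by linarith [hnn j hj]) 2
      have hik : W t i ^ 2 ≤ W t k ^ 2 := pow_le_pow_left₀ hpos.le (by linarith [hnn k hk]) 2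
      have := mul_nonneg hK (by linarith : 0 ≤ W t j ^ 2 + W t k ^ 2 - 2 * W t i ^ 2)
      linarith)
    T ⟨hT, le_rfl⟩ i hi
  linarith

/-- Upper bounds of nonnegative solutions are preserved by
`∂ₜ Wⁱ = K ((Wʲ)² + (Wᵏ)² - 2 (Wⁱ)²)`, whatever the neighbours `j`, `k` of `i` are. -/
theorem ge_of_hasDerivAt_sq_diffusion {ι : Type*} (s : Finset ι) (W : ℝ → ι → ℝ) {K C : ℝ}
    (hK : 0 ≤ K)
    (hW : ∀ t, 0 ≤ t → ∀ i ∈ s, ∃ j ∈ s, ∃ k ∈ s, HasDerivAt (fun u => W u i)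
      (K * (W t j ^ 2 + W t k ^ 2 - 2 * W t i ^ 2)) t)
    (hnonneg : ∀ t, 0 ≤ t → ∀ i ∈ s, 0 ≤ W t i)
    (h0 : ∀ i ∈ s, W 0 i ≤ C) :
    ∀ t, 0 ≤ t → ∀ i ∈ s, W t i ≤ C := by
  intro T hT i hi
  by_contra! hlt
  have hT1 : 0 < 1 + T := by linarith
  obtain ⟨ε, hε, hεW⟩ : ∃ ε : ℝ, 0 < ε ∧ ε * (1 + T) = W T i - C :=
    ⟨(W T i - C) / (1 + T), div_pos (by linarith) hT1, div_mul_cancel₀ _ hT1.ne'⟩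
  have hlin (t : ℝ) : HasDerivAt (fun u : ℝ => C + ε * (1 + u)) ε t := by
    simpa using (((hasDerivAt_id t).const_add 1).const_mul ε).const_add C
  have key := forall_pos_of_hasDerivAt_pos s (fun t i => C + ε * (1 + t) - W t i) T
    (fun i hi t ht => by
      obtain ⟨j, -, k, -, h⟩ := hW t ht.1 i hi
      exact ((hlin t).sub h).continuousAt.continuousWithinAt)
    (fun i hi => by linarith [h0 i hi])
    (fun t ht i hi hz hnn => by
      obtain ⟨j, hj, k, hk, h⟩ := hW t ht.1 i hi
      refine ⟨_, ?_, (hlin t).sub h⟩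
      have hij : W t j ^ 2 ≤ W t i ^ 2 :=
        pow_le_pow_left₀ (hnonneg t ht.1 j hj) (by linarith [hnn j hj]) 2
      have hik : W t k ^ 2 ≤ W t i ^ 2 :=
        pow_le_pow_left₀ (hnonneg t ht.1 k hk) (by linarith [hnn k hk]) 2
      have := mul_nonneg hK (by linarith : 0 ≤ 2 * W t i ^ 2 - W t j ^ 2 - W t k ^ 2)
      linarith)
    T ⟨hT, le_rfl⟩ i hi
  linarith

@[simp] theorem pad_zero (N : ℕ) (v : ℕ → ℝ) : pad N v 0 = -v 1 := by simp [pad]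

@[simp] theorem pad_add_one (N : ℕ) (v : ℕ → ℝ) : pad N v (N + 1) = 2 - v N := by simp [pad]

theorem pad_of_mem {N i : ℕ} (hi : i ∈ Finset.Icc 1 N) (v : ℕ → ℝ) : pad N v i = v i := by
  rw [Finset.mem_Icc] at hi
  simp [pad, show i ≠ 0 by omega, show i ≠ N + 1 by omega]

theorem discrete_monotonicity_rho_one (N : ℕ) (hN : 1 ≤ N) (c C : ℝ)
    (hc : 0 < c) (hcC : c ≤ C) (x : ℝ → ℕ → ℝ)
    -- the rescaled discrete gradient flow
    (hODE : ∀ t, 0 ≤ t → ∀ i ∈ Finset.Icc 1 N,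
      HasDerivAt (fun s => x s i)
        (((N : ℝ) ^ 3 / 4) * ((pad N (x t) (i + 1) - pad N (x t) i) ^ 2
          - (pad N (x t) i - pad N (x t) (i - 1)) ^ 2)) t)
    -- initial bounds on `Wⁱ(0) = N (x̄^{i+1}(0) - x̄ⁱ(0))`
    (hinit : ∀ i ∈ Finset.Icc 0 N,
      c ≤ (N : ℝ) * (pad N (x 0) (i + 1) - pad N (x 0) i) ∧
        (N : ℝ) * (pad N (x 0) (i + 1) - pad N (x 0) i) ≤ C) :
    ∀ t, 0 ≤ t → ∀ i ∈ Finset.Icc 0 N,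
      c ≤ (N : ℝ) * (pad N (x t) (i + 1) - pad N (x t) i) ∧
        (N : ℝ) * (pad N (x t) (i + 1) - pad N (x t) i) ≤ C := by
  set W : ℝ → ℕ → ℝ := fun t i => (N : ℝ) * (pad N (x t) (i + 1) - pad N (x t) i) with hWdef
  have hx {t : ℝ} (ht : 0 ≤ t) {i : ℕ} (hi : i + 1 ∈ Finset.Icc 1 N) :
      HasDerivAt (fun s => pad N (x s) (i + 1))
        ((N : ℝ) / 4 * (W t (i + 1) ^ 2 - W t i ^ 2)) t := by
    simp_rw [pad_of_mem hi]
    refine (hODE t ht _ hi).congr_deriv ?_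
    simp only [hWdef, Nat.add_sub_cancel]
    ring
  have hW : ∀ t, 0 ≤ t → ∀ i ∈ Finset.Icc 0 N, ∃ j ∈ Finset.Icc 0 N, ∃ k ∈ Finset.Icc 0 N,
      HasDerivAt (fun u => W u i)
        ((N : ℝ) ^ 2 / 4 * (W t j ^ 2 + W t k ^ 2 - 2 * W t i ^ 2)) t := by
    intro t ht i hi
    rw [Finset.mem_Icc] at hi
    rcases Nat.eq_zero_or_pos i with rfl | hipos
    · have h1 : 0 + 1 ∈ Finset.Icc 1 N := Finset.mem_Icc.2 ⟨le_rfl, hN⟩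
      refine ⟨1, Finset.mem_Icc.2 ⟨by omega, hN⟩, 1, Finset.mem_Icc.2 ⟨by omega, hN⟩, ?_⟩
      have hW0 : (fun u => W u 0) = fun u => (N : ℝ) * (2 * pad N (x u) (0 + 1)) := by
        funext u
        simp only [hWdef, pad_zero, pad_of_mem h1]
        ring
      rw [hW0]
      refine (((hx ht h1).const_mul 2).const_mul (N : ℝ)).congr_deriv ?_
      ring
    · obtain ⟨m, rfl⟩ := Nat.exists_eq_add_of_lt hipos
      rw [zero_add] at hi ⊢
      have hm : m + 1 ∈ Finset.Icc 1 N := Finset.mem_Icc.2 ⟨by omega, hi.2⟩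
      rcases hi.2.eq_or_lt with hmN | hmN
      · refine ⟨m, Finset.mem_Icc.2 (by omega), m, Finset.mem_Icc.2 (by omega), ?_⟩
        have hWN : (fun u => W u (m + 1)) =
            fun u => (N : ℝ) * (2 - 2 * pad N (x u) (m + 1)) := by
          funext u
          have hlast : pad N (x u) (m + 1 + 1) = 2 - x u (m + 1) := by
            rw [hmN, pad_add_one]
          simp only [hWdef, hlast, pad_of_mem hm]
          ring
        rw [hWN]
        refine ((((hx ht hm).const_mul 2).const_sub 2).const_mul (N : ℝ)).congr_deriv ?_
        ring
      · have hm' : m + 1 + 1 ∈ Finset.Icc 1 N := Finset.mem_Icc.2 (by omega)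
        refine ⟨m + 1 + 1, Finset.mem_Icc.2 (by omega), m, Finset.mem_Icc.2 (by omega), ?_⟩
        refine (((hx ht hm').sub (hx ht hm)).const_mul (N : ℝ)).congr_deriv ?_
        ring
  have hK : 0 ≤ (N : ℝ) ^ 2 / 4 := by positivity
  have hlow := le_of_hasDerivAt_sq_diffusion _ W hK hc hW fun i hi => (hinit i hi).1
  have hupp := ge_of_hasDerivAt_sq_diffusion _ W hK hW
    (fun t ht i hi => hc.le.trans (hlow t ht i hi)) fun i hi => (hinit i hi).2
  exact fun t ht i hi => ⟨hlow t ht i hi, hupp t ht i hi⟩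
end
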